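/- arXiv:1303.2306 — 2 statements merged into one kernel-verified Lean document; each statement's English description precedes it below -/
import Mathlib

section
/- Assume E(ξ log ξ) < ∞ and that F̄ is regularly varying at infinity with index −1. Then, uniformly in n ≥ 1, P{W_n > x} ~ Σ_{i=0}^{n-1} m^i·F̄(m^{i+1}x) ~ (1/(m·log m))·x^{-1}·∫_x^{m^n x} F̄(u) du as x → ∞. -/
open MeasureTheory Filter ProbabilityTheory

set_option linter.unusedSectionVars false

structure GW {Ω : Type*} [MeasurableSpace Ω] (μ : Measure Ω)
    (ξ : ℕ → ℕ → Ω → ℕ) (Z : ℕ → Ω → ℕ) (m : ℝ) : Prop where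
  meas : ∀ n i, Measurable (ξ n i)
  indep : iIndepFun (fun p : ℕ × ℕ => ξ p.1 p.2) μ
  ident : ∀ n i, Measure.map (ξ n i) μ = Measure.map (ξ 0 0) μ
  int : Integrable (fun ω => (ξ 0 0 ω : ℝ)) μ
  mean : m = ∫ ω, (ξ 0 0 ω : ℝ) ∂μ
  one_lt : 1 < m
  Z0 : ∀ ω, Z 0 ω = 1
  Zrec : ∀ n ω, Z (n + 1) ω = ∑ i ∈ Finset.range (Z n ω), ξ n i ω

def Fil {Ω : Type*} (ξ : ℕ → ℕ → Ω → ℕ) (i : ℕ) : MeasurableSpace Ω :=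
  ⨆ p ∈ {p : ℕ × ℕ | p.1 < i}, MeasurableSpace.comap (ξ p.1 p.2) ⊤

noncomputable def Ex {Ω : Type*} [MeasurableSpace Ω] (μ : Measure Ω) (ξ : ℕ → ℕ → Ω → ℕ)
    (g : ℕ → ENNReal) : ENNReal := ∫⁻ ω, g (ξ 0 0 ω) ∂μ

theorem measurable_sm {γ : Type*} [AddCommMonoid γ] [MeasurableSpace γ] [MeasurableAdd₂ γ]
    (g : ℕ → γ) :
    Measurable (fun p : ℕ × (ℕ → ℕ) => ∑ j ∈ Finset.range p.1, g (p.2 j)) := by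
  apply measurable_from_prod_countable_right
  intro k
  refine Finset.measurable_fun_sum (f := fun (j : ℕ) (y : ℕ → ℕ) => g (y j)) (Finset.range k) fun j _ => ?_
  exact (measurable_of_countable g).comp (measurable_pi_apply j)

namespace GW
variable {Ω : Type*} [mΩ : MeasurableSpace Ω] {μ : Measure Ω} [IsProbabilityMeasure μ]
    {ξ : ℕ → ℕ → Ω → ℕ} {Z : ℕ → Ω → ℕ} {m : ℝ}

theorem fil_le (h : GW μ ξ Z m) (i : ℕ) : Fil ξ i ≤ mΩ :=
  iSup₂_le fun p _ => (h.meas p.1 p.2).comap_le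

theorem fil_mono {i k : ℕ} (hik : i ≤ k) : Fil ξ i ≤ Fil ξ k :=
  biSup_mono fun _ hp => lt_of_lt_of_le hp hik

theorem xi_fil (i j : ℕ) : Measurable[Fil ξ (i+1)] (ξ i j) := by
  rw [measurable_iff_comap_le]
  exact le_iSup₂_of_le (f := fun (p : ℕ × ℕ) (_ : p ∈ {p : ℕ × ℕ | p.1 < i+1}) =>
    MeasurableSpace.comap (ξ p.1 p.2) ⊤) (i, j) (Nat.lt_succ_self i) le_rfl

theorem row_fil (i : ℕ) : Measurable[Fil ξ (i+1)] (fun ω j => ξ i j ω) := by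
  apply @measurable_pi_lambda _ _ _ (Fil ξ (i+1))
  intro j
  exact xi_fil i j

theorem sm_fil {γ : Type*} [AddCommMonoid γ] [MeasurableSpace γ] [MeasurableAdd₂ γ]
    {i : ℕ} (hZ : Measurable[Fil ξ i] (Z i)) (g : ℕ → γ) :
    Measurable[Fil ξ (i+1)] (fun ω => ∑ j ∈ Finset.range (Z i ω), g (ξ i j ω)) := by
  have h1 : Measurable[Fil ξ (i+1)] (Z i) := hZ.mono (fil_mono (Nat.le_succ i)) le_rfl
  have h2 := h1.prodMk (row_fil (ξ := ξ) i)
  exact (measurable_sm g).comp h2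

theorem Z_fil (h : GW μ ξ Z m) (i : ℕ) : Measurable[Fil ξ i] (Z i) := by
  induction i with
  | zero =>
    have : Z 0 = fun _ => 1 := funext h.Z0
    rw [this]; exact @measurable_const _ _ _ (Fil ξ 0) _
  | succ i ih =>
    have : Z (i+1) = fun ω => ∑ j ∈ Finset.range (Z i ω), id (ξ i j ω) := funext (h.Zrec i)
    rw [this]
    exact sm_fil ih id

theorem Z_meas (h : GW μ ξ Z m) (i : ℕ) : Measurable (Z i) := (h.Z_fil i).mono (h.fil_le i) le_rfl

theorem row_meas (h : GW μ ξ Z m) (i : ℕ) : Measurable (fun ω j => ξ i j ω) :=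
  measurable_pi_lambda _ fun j => h.meas i j

theorem indep_row (h : GW μ ξ Z m) (i : ℕ) {β : Type*} [MeasurableSpace β] {X : Ω → β}
    (hX : Measurable[Fil ξ i] X) : IndepFun X (fun ω j => ξ i j ω) μ := by
  have h1 := indep_iSup_of_disjoint (fun p : ℕ × ℕ => (h.meas p.1 p.2).comap_le) h.indep.iIndep
    (S := {p | p.1 < i}) (T := {p | p.1 = i}) (by
      rw [Set.disjoint_left]; intro p hp hq
      simp only [Set.mem_ofPred_eq] at hp hq
      omega)
  rw [IndepFun_iff_Indep]
  refine indep_of_indep_of_le_left (indep_of_indep_of_le_right h1 ?_) ?_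
  · rw [← measurable_iff_comap_le]
    refine @measurable_pi_lambda _ _ _ (_) _ _ ?_
    intro j
    rw [measurable_iff_comap_le]
    exact le_iSup₂_of_le (f := fun (p : ℕ × ℕ) (_ : p ∈ {p : ℕ × ℕ | p.1 = i}) =>
      MeasurableSpace.comap (ξ p.1 p.2) ⊤) (i, j) rfl le_rfl
  · exact measurable_iff_comap_le.1 hX

theorem master (h : GW μ ξ Z m) (i : ℕ) {β : Type*} [MeasurableSpace β] {X : Ω → β}
    (hX : Measurable[Fil ξ i] X) {H : β × (ℕ → ℕ) → ENNReal} (hH : Measurable H) :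
    ∫⁻ ω, H (X ω, fun j => ξ i j ω) ∂μ = ∫⁻ ω, ∫⁻ ω', H (X ω, fun j => ξ i j ω') ∂μ ∂μ := by
  have hX' : Measurable X := hX.mono (h.fil_le i) le_rfl
  have hY := h.row_meas i
  have h1 := (indepFun_iff_map_prod_eq_prod_map_map hX'.aemeasurable hY.aemeasurable).1
    (h.indep_row i hX)
  rw [← lintegral_map hH (hX'.prodMk hY), h1, lintegral_prod _ hH.aemeasurable,
    lintegral_map hH.lintegral_prod_right' hX']
  refine lintegral_congr fun ω => ?_
  exact lintegral_map (hH.comp measurable_prodMk_left) hY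

theorem ex_xi (h : GW μ ξ Z m) (i j : ℕ) (g : ℕ → ENNReal) :
    ∫⁻ ω, g (ξ i j ω) ∂μ = Ex μ ξ g := by
  unfold Ex
  rw [← lintegral_map (measurable_of_countable g) (h.meas i j), h.ident,
    lintegral_map (measurable_of_countable g) (h.meas 0 0)]

theorem ex_xi_mul (h : GW μ ξ Z m) (i : ℕ) {j k : ℕ} (hjk : j ≠ k) (f g : ℕ → ENNReal) :
    ∫⁻ ω, f (ξ i j ω) * g (ξ i k ω) ∂μ = Ex μ ξ f * Ex μ ξ g := by
  have hi : IndepFun (ξ i j) (ξ i k) μ := h.indep.indepFun (i := (i,j)) (j := (i,k)) (by simpa using hjk)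
  have h2 := hi.comp (measurable_of_countable f) (measurable_of_countable g)
  have := lintegral_mul_eq_lintegral_mul_lintegral_of_indepFun
    ((measurable_of_countable f).comp (h.meas i j)) ((measurable_of_countable g).comp (h.meas i k)) h2
  simpa [h.ex_xi] using this

theorem gmeas (h : GW μ ξ Z m) (i j : ℕ) {γ : Type*} [MeasurableSpace γ] (g : ℕ → γ) :
    Measurable (fun ω => g (ξ i j ω)) :=
  (measurable_of_countable g).comp (h.meas i j)

theorem e1 (h : GW μ ξ Z m) (i k : ℕ) (g : ℕ → ENNReal) :
    ∫⁻ ω, ∑ j ∈ Finset.range k, g (ξ i j ω) ∂μ = k * Ex μ ξ g := by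
  rw [lintegral_finsetSum _ fun j _ => h.gmeas i j g]
  simp [h.ex_xi]

theorem e2 (h : GW μ ξ Z m) (i k : ℕ) (f g : ℕ → ENNReal) :
    ∫⁻ ω, (∑ j ∈ Finset.range k, f (ξ i j ω)) * ∑ j ∈ Finset.range k, g (ξ i j ω) ∂μ
      ≤ k * Ex μ ξ (fun v => f v * g v) + k ^ 2 * (Ex μ ξ f * Ex μ ξ g) := by
  simp_rw [Finset.sum_mul_sum]
  have hm : ∀ j l, Measurable fun ω => f (ξ i j ω) * g (ξ i l ω) := fun j l =>
    (h.gmeas i j f).mul (h.gmeas i l g)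
  rw [lintegral_finsetSum _ fun j _ => Finset.measurable_fun_sum _ fun l _ => hm j l]
  have : ∀ j ∈ Finset.range k, ∫⁻ ω, ∑ l ∈ Finset.range k, f (ξ i j ω) * g (ξ i l ω) ∂μ
      ≤ Ex μ ξ (fun v => f v * g v) + k * (Ex μ ξ f * Ex μ ξ g) := by
    intro j hj
    rw [lintegral_finsetSum _ fun l _ => hm j l]
    calc _ ≤ ∑ l ∈ Finset.range k, ((if l = j then Ex μ ξ (fun v => f v * g v) else 0)
            + Ex μ ξ f * Ex μ ξ g) := by
          refine Finset.sum_le_sum fun l _ => ?_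
          split_ifs with hl
          · subst hl
            rw [h.ex_xi i l (fun v => f v * g v)]
            exact le_self_add
          · rw [h.ex_xi_mul i (Ne.symm hl)]; simp
      _ = _ := by
          rw [Finset.sum_add_distrib, Finset.sum_ite_eq' , if_pos hj]; simp
  refine (Finset.sum_le_sum this).trans ?_
  simp only [Finset.sum_const, Finset.card_range, nsmul_eq_mul]
  apply le_of_eq; ring

/-- counting successes -/
theorem pair_le (k : ℕ) (b : ℕ → ℕ) (hb : ∀ j, b j ≤ 1) :
    (∑ j ∈ Finset.range k, b j) * ((∑ j ∈ Finset.range k, b j) - 1)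
      ≤ ∑ j ∈ Finset.range k, ∑ l ∈ Finset.range k, if j = l then 0 else b j * b l := by
  rw [Finset.sum_mul]
  refine Finset.sum_le_sum fun j hj => ?_
  have h1 := Finset.add_sum_erase _ b hj
  have h2 := Finset.add_sum_erase _ (fun l => if j = l then 0 else b j * b l) hj
  simp only [if_true, zero_add] at h2
  rw [← h2, ← h1]
  have h3 : ∑ x ∈ (Finset.range k).erase j, (if j = x then 0 else b j * b x)
      = b j * ∑ x ∈ (Finset.range k).erase j, b x := by
    rw [Finset.mul_sum]
    refine Finset.sum_congr rfl fun x hx => ?_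
    rw [if_neg (Finset.ne_of_mem_erase hx).symm]
  rw [h3]
  exact Nat.mul_le_mul_left _ (by have := hb j; omega)

theorem e3 (h : GW μ ξ Z m) (i k : ℕ) (b : ℕ → ℕ) (hb : ∀ v, b v ≤ 1) :
    ∫⁻ ω, (((∑ j ∈ Finset.range k, b (ξ i j ω)) * ((∑ j ∈ Finset.range k, b (ξ i j ω)) - 1) : ℕ)
      : ENNReal) ∂μ ≤ k ^ 2 * (Ex μ ξ (fun v => (b v : ENNReal))) ^ 2 := by
  calc _ ≤ ∫⁻ ω, ∑ j ∈ Finset.range k, ∑ l ∈ Finset.range k,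
        (if j = l then 0 else (b (ξ i j ω) : ENNReal) * (b (ξ i l ω) : ENNReal)) ∂μ := by
        refine lintegral_mono fun ω => ?_
        have := pair_le k (fun j => b (ξ i j ω)) (fun j => hb _)
        have h2 : (((∑ j ∈ Finset.range k, b (ξ i j ω)) * ((∑ j ∈ Finset.range k, b (ξ i j ω)) - 1) : ℕ)
          : ENNReal) ≤ ((∑ j ∈ Finset.range k, ∑ l ∈ Finset.range k,
            if j = l then 0 else b (ξ i j ω) * b (ξ i l ω) : ℕ) : ENNReal) := by
          exact_mod_cast this
        refine h2.trans (le_of_eq ?_)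
        push_cast
        rfl
    _ = ∑ j ∈ Finset.range k, ∑ l ∈ Finset.range k, ∫⁻ ω,
        (if j = l then 0 else (b (ξ i j ω) : ENNReal) * (b (ξ i l ω) : ENNReal)) ∂μ := by
        have hm : ∀ j l, Measurable fun ω =>
            (if j = l then 0 else (b (ξ i j ω) : ENNReal) * (b (ξ i l ω) : ENNReal)) := by
          intro j l
          split_ifs
          · exact measurable_const
          · exact (h.gmeas i j (fun v => (b v : ENNReal))).mul (h.gmeas i l (fun v => (b v : ENNReal)))
        rw [lintegral_finsetSum _ fun j _ => Finset.measurable_fun_sum _ fun l _ => hm j l]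
        refine Finset.sum_congr rfl fun j _ => ?_
        rw [lintegral_finsetSum _ fun l _ => hm j l]
    _ ≤ ∑ j ∈ Finset.range k, ∑ l ∈ Finset.range k, (Ex μ ξ (fun v => (b v : ENNReal))) ^ 2 := by
        refine Finset.sum_le_sum fun j _ => Finset.sum_le_sum fun l _ => ?_
        split_ifs with hjl
        · simp
        · rw [h.ex_xi_mul i hjl (fun v => (b v : ENNReal)) (fun v => (b v : ENNReal)), sq]
    _ = _ := by simp; ring

theorem c1 (h : GW μ ξ Z m) (i : ℕ) {f : Ω → ENNReal} (hf : Measurable[Fil ξ i] f)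
    (g : ℕ → ENNReal) :
    ∫⁻ ω, f ω * ∑ j ∈ Finset.range (Z i ω), g (ξ i j ω) ∂μ = Ex μ ξ g * ∫⁻ ω, f ω * Z i ω ∂μ := by
  have hX := hf.prodMk (h.Z_fil i)
  have hH : Measurable (fun p : (ENNReal × ℕ) × (ℕ → ℕ) =>
      p.1.1 * ∑ j ∈ Finset.range p.1.2, g (p.2 j)) :=
    (measurable_fst.fst).mul ((measurable_sm g).comp (measurable_fst.snd.prodMk measurable_snd))
  have := h.master i hX hH
  simp only at this
  rw [this, ← lintegral_const_mul]
  · refine lintegral_congr fun ω => ?_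
    rw [lintegral_const_mul, h.e1]
    · ring
    · exact Finset.measurable_fun_sum _ fun j _ => h.gmeas i j g
  · exact (hf.mono (h.fil_le i) le_rfl).mul ((measurable_of_countable _).comp (h.Z_meas i))

theorem c2 (h : GW μ ξ Z m) (i : ℕ) {f : Ω → ENNReal} (hf : Measurable[Fil ξ i] f)
    (g g' : ℕ → ENNReal) :
    ∫⁻ ω, f ω * ((∑ j ∈ Finset.range (Z i ω), g (ξ i j ω)) *
      ∑ j ∈ Finset.range (Z i ω), g' (ξ i j ω)) ∂μ
      ≤ Ex μ ξ (fun v => g v * g' v) * ∫⁻ ω, f ω * Z i ω ∂μ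
        + Ex μ ξ g * Ex μ ξ g' * ∫⁻ ω, f ω * (Z i ω) ^ 2 ∂μ := by
  have hX := hf.prodMk (h.Z_fil i)
  have hH : Measurable (fun p : (ENNReal × ℕ) × (ℕ → ℕ) =>
      p.1.1 * ((∑ j ∈ Finset.range p.1.2, g (p.2 j)) * ∑ j ∈ Finset.range p.1.2, g' (p.2 j))) :=
    (measurable_fst.fst).mul (((measurable_sm g).comp (measurable_fst.snd.prodMk measurable_snd)).mul
      ((measurable_sm g').comp (measurable_fst.snd.prodMk measurable_snd)))
  have := h.master i hX hH
  simp only at this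
  have hfm := hf.mono (h.fil_le i) le_rfl
  have hZm : Measurable (fun ω => (Z i ω : ENNReal)) := (measurable_of_countable _).comp (h.Z_meas i)
  have hz1 : Measurable fun ω => f ω * (Z i ω : ENNReal) := hfm.mul hZm
  have hz2 : Measurable fun ω => f ω * (Z i ω : ENNReal) ^ 2 := hfm.mul (hZm.pow_const 2)
  rw [this, ← lintegral_const_mul _ hz1, ← lintegral_const_mul _ hz2,
    ← lintegral_add_left (by fun_prop)]
  refine lintegral_mono fun ω => ?_
  simp only
  rw [lintegral_const_mul]
  · refine (mul_le_mul_right (h.e2 i _ g g') _).trans (le_of_eq ?_)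
    ring
  · exact (Finset.measurable_fun_sum _ fun j _ => h.gmeas i j g).mul
      (Finset.measurable_fun_sum _ fun j _ => h.gmeas i j g')

theorem c3 (h : GW μ ξ Z m) (i : ℕ) {f : Ω → ENNReal} (hf : Measurable[Fil ξ i] f)
    (b : ℕ → ℕ) (hb : ∀ v, b v ≤ 1) :
    ∫⁻ ω, f ω * (((∑ j ∈ Finset.range (Z i ω), b (ξ i j ω)) *
      ((∑ j ∈ Finset.range (Z i ω), b (ξ i j ω)) - 1) : ℕ) : ENNReal) ∂μ
      ≤ (Ex μ ξ (fun v => (b v : ENNReal))) ^ 2 * ∫⁻ ω, f ω * (Z i ω) ^ 2 ∂μ := by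
  have hX := hf.prodMk (h.Z_fil i)
  have hφ : Measurable (fun s : ℕ => ((s * (s - 1) : ℕ) : ENNReal)) := measurable_of_countable _
  have hH : Measurable (fun p : (ENNReal × ℕ) × (ℕ → ℕ) =>
      p.1.1 * (((∑ j ∈ Finset.range p.1.2, b (p.2 j)) * ((∑ j ∈ Finset.range p.1.2, b (p.2 j)) - 1) : ℕ)
        : ENNReal)) :=
    (measurable_fst.fst).mul (hφ.comp ((measurable_sm b).comp
      (measurable_fst.snd.prodMk measurable_snd)))
  have := h.master i hX hH
  simp only at this
  have hfm := hf.mono (h.fil_le i) le_rfl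
  have hZm : Measurable (fun ω => (Z i ω : ENNReal)) := (measurable_of_countable _).comp (h.Z_meas i)
  have hz2 : Measurable fun ω => f ω * (Z i ω : ENNReal) ^ 2 := hfm.mul (hZm.pow_const 2)
  rw [this, ← lintegral_const_mul _ hz2]
  refine lintegral_mono fun ω => ?_
  simp only
  rw [lintegral_const_mul]
  · refine (mul_le_mul_right (h.e3 i _ b hb) _).trans (le_of_eq ?_)
    ring
  · exact hφ.comp (Finset.measurable_fun_sum _ fun j _ => h.gmeas i j b)

theorem rint (h : GW μ ξ Z m) (i j : ℕ) (g : ℕ → ℝ) :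
    ∫ ω, g (ξ i j ω) ∂μ = ∫ ω, g (ξ 0 0 ω) ∂μ := by
  rw [← integral_map (φ := ξ i j) (h.meas i j).aemeasurable
      (measurable_of_countable g).aestronglyMeasurable, h.ident,
    integral_map (h.meas 0 0).aemeasurable (measurable_of_countable g).aestronglyMeasurable]

theorem e4 (h : GW μ ξ Z m) (i k : ℕ) (g : ℕ → ℝ) (C : ℝ) (hC : ∀ v, |g v| ≤ C) (a c : ℝ) :
    ∫⁻ ω, ENNReal.ofReal ((a + c * ∑ j ∈ Finset.range k, (g (ξ i j ω) - ∫ ω, g (ξ 0 0 ω) ∂μ)) ^ 2) ∂μ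
      ≤ ENNReal.ofReal (a ^ 2) + ENNReal.ofReal (c ^ 2 * ∫ ω, g (ξ 0 0 ω) ^ 2 ∂μ) * k := by
  set e := ∫ ω, g (ξ 0 0 ω) ∂μ with he
  have hL : ∀ j, MemLp (fun ω => g (ξ i j ω)) 2 μ := fun j =>
    MemLp.of_bound (h.gmeas i j g).aestronglyMeasurable C (Eventually.of_forall fun ω => hC _)
  set T : Ω → ℝ := ∑ j ∈ Finset.range k, (fun ω => g (ξ i j ω)) with hT
  have hTL : MemLp T 2 μ := memLp_finsetSum' _ fun j _ => hL j
  have hET : ∫ ω, T ω ∂μ = k * e := by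
    simp only [hT, Finset.sum_apply]
    rw [integral_finsetSum _ fun j _ => (hL j).integrable (by norm_num)]
    simp [h.rint i _ g, he]
  have hVar : Var[T; μ] ≤ k * ∫ ω, g (ξ 0 0 ω) ^ 2 ∂μ := by
    rw [hT, IndepFun.variance_sum (fun j _ => hL j)]
    · calc _ ≤ ∑ j ∈ Finset.range k, ∫ ω, g (ξ 0 0 ω) ^ 2 ∂μ := by
            refine Finset.sum_le_sum fun j _ => ?_
            refine (variance_le_expectation_sq (h.gmeas i j g).aestronglyMeasurable).trans (le_of_eq ?_)
            exact h.rint i j (fun v => g v ^ 2)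
        _ = _ := by simp
    · intro j _ l _ hjl
      have hi : IndepFun (ξ i j) (ξ i l) μ :=
        h.indep.indepFun (i := (i,j)) (j := (i,l)) (by simpa using hjl)
      exact hi.comp (measurable_of_countable g) (measurable_of_countable g)
  set D : Ω → ℝ := fun ω => T ω - k * e with hD
  have hDL : MemLp D 2 μ := hTL.sub (memLp_const _)
  have hED : ∫ ω, D ω ∂μ = 0 := by
    rw [hD, integral_sub (hTL.integrable (by norm_num)) (integrable_const _), hET]; simp
  have hD2 : ∫ ω, D ω ^ 2 ∂μ = Var[T; μ] := by
    rw [variance_eq_integral hTL.aestronglyMeasurable.aemeasurable, hET]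
  have heq : ∀ ω, a + c * ∑ j ∈ Finset.range k, (g (ξ i j ω) - e) = a + c * D ω := by
    intro ω
    simp only [hD, hT, Finset.sum_apply, Finset.sum_sub_distrib]
    simp
  simp_rw [heq]
  have hI1 : Integrable D μ := hDL.integrable (by norm_num)
  have hI2 : Integrable (fun ω => D ω ^ 2) μ := hDL.integrable_sq
  have hexp : ∀ ω, (a + c * D ω) ^ 2 = a ^ 2 + 2 * a * c * D ω + c ^ 2 * D ω ^ 2 := fun ω => by ring
  simp_rw [hexp]
  have hI3 : Integrable (fun ω => a ^ 2 + 2 * a * c * D ω) μ :=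
    (integrable_const _).add (hI1.const_mul _)
  have hI4 : Integrable (fun ω => a ^ 2 + 2 * a * c * D ω + c ^ 2 * D ω ^ 2) μ :=
    hI3.add (hI2.const_mul _)
  rw [← ofReal_integral_eq_lintegral_ofReal hI4
    (Eventually.of_forall fun ω => by
      simp only [Pi.zero_apply]
      rw [← hexp]; positivity)]
  rw [integral_add hI3 (hI2.const_mul _), integral_add (integrable_const _) (hI1.const_mul _),
    integral_const_mul, integral_const_mul, hED, hD2]
  have hk : (k : ENNReal) = ENNReal.ofReal k := by simp
  rw [hk, ← ENNReal.ofReal_mul (by positivity), ← ENNReal.ofReal_add (by positivity) (by positivity)]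
  apply ENNReal.ofReal_le_ofReal
  simp only [integral_const, probReal_univ, smul_eq_mul, mul_zero]
  nlinarith [mul_le_mul_of_nonneg_left hVar (sq_nonneg c)]

theorem c4 (h : GW μ ξ Z m) (i : ℕ) {A : Ω → ℝ} (hA : Measurable[Fil ξ i] A)
    (g : ℕ → ℝ) (C : ℝ) (hC : ∀ v, |g v| ≤ C) (c : ℝ) :
    ∫⁻ ω, ENNReal.ofReal ((A ω + c * ∑ j ∈ Finset.range (Z i ω),
        (g (ξ i j ω) - ∫ ω, g (ξ 0 0 ω) ∂μ)) ^ 2) ∂μ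
      ≤ ∫⁻ ω, ENNReal.ofReal (A ω ^ 2) ∂μ
        + ENNReal.ofReal (c ^ 2 * ∫ ω, g (ξ 0 0 ω) ^ 2 ∂μ) * ∫⁻ ω, Z i ω ∂μ := by
  have hX := hA.prodMk (h.Z_fil i)
  set e := ∫ ω, g (ξ 0 0 ω) ∂μ with he
  have hH : Measurable (fun p : (ℝ × ℕ) × (ℕ → ℕ) =>
      ENNReal.ofReal ((p.1.1 + c * ∑ j ∈ Finset.range p.1.2, (g (p.2 j) - e)) ^ 2)) := by
    have h1 : Measurable (fun p : (ℝ × ℕ) × (ℕ → ℕ) => ∑ j ∈ Finset.range p.1.2, (g (p.2 j) - e)) :=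
      (measurable_sm (fun v => g v - e)).comp (measurable_fst.snd.prodMk measurable_snd)
    fun_prop
  have := h.master i hX hH
  simp only at this
  have hAm := hA.mono (h.fil_le i) le_rfl
  have hZm : Measurable (fun ω => (Z i ω : ENNReal)) := (measurable_of_countable _).comp (h.Z_meas i)
  rw [this, ← lintegral_const_mul _ hZm, ← lintegral_add_left (by fun_prop)]
  exact lintegral_mono fun ω => h.e4 i _ g C hC _ _

end GW

open MeasureTheory Filter ProbabilityTheory
set_option linter.unusedSectionVars false

namespace GW
variable {Ω : Type*} [mΩ : MeasurableSpace Ω] {μ : Measure Ω} [IsProbabilityMeasure μ]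
    {ξ : ℕ → ℕ → Ω → ℕ} {Z : ℕ → Ω → ℕ} {m : ℝ}

theorem ex_id (h : GW μ ξ Z m) : Ex μ ξ (fun v => (v : ENNReal)) = ENNReal.ofReal m := by
  unfold Ex
  rw [h.mean, ofReal_integral_eq_lintegral_ofReal h.int (Eventually.of_forall fun _ => by positivity)]
  simp

theorem Zc_fil (h : GW μ ξ Z m) (i : ℕ) {k : ℕ} (hik : i ≤ k) :
    Measurable[Fil ξ k] (fun ω => (Z i ω : ENNReal)) :=
  (measurable_of_countable (fun v : ℕ => (v : ENNReal))).comp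
    ((h.Z_fil i).mono (fil_mono hik) le_rfl)

theorem Zc_meas (h : GW μ ξ Z m) (i : ℕ) : Measurable (fun ω => (Z i ω : ENNReal)) :=
  (measurable_of_countable (fun v : ℕ => (v : ENNReal))).comp (h.Z_meas i)

/-- one-step martingale property -/
theorem step (h : GW μ ξ Z m) (i : ℕ) {f : Ω → ENNReal} (hf : Measurable[Fil ξ i] f) :
    ∫⁻ ω, f ω * Z (i+1) ω ∂μ = ENNReal.ofReal m * ∫⁻ ω, f ω * Z i ω ∂μ := by
  have := h.c1 i hf (fun v => (v : ENNReal))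
  rw [h.ex_id] at this
  rw [← this]
  refine lintegral_congr fun ω => ?_
  rw [h.Zrec]; push_cast; rfl

theorem EZ (h : GW μ ξ Z m) (i : ℕ) : ∫⁻ ω, (Z i ω : ENNReal) ∂μ = ENNReal.ofReal m ^ i := by
  induction i with
  | zero => simp [h.Z0]
  | succ i ih =>
    have := h.step i (f := fun _ => 1) (@measurable_const _ _ _ (Fil ξ i) _)
    simp only [one_mul] at this
    rw [this, ih]; ring

open Classical in
/-- truncated count -/
noncomputable def cnt (ξ : ℕ → ℕ → Ω → ℕ) (Z : ℕ → Ω → ℕ) (G : ℕ → Set ℕ) (b : ℕ → ℕ → ℕ)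
    (i : ℕ) (ω : Ω) : ℕ :=
  (if Z i ω ∈ G i then 1 else 0) * ∑ j ∈ Finset.range (Z i ω), b i (ξ i j ω)

noncomputable def tot (ξ : ℕ → ℕ → Ω → ℕ) (Z : ℕ → Ω → ℕ) (G : ℕ → Set ℕ) (b : ℕ → ℕ → ℕ)
    (n : ℕ) (ω : Ω) : ℕ := ∑ i ∈ Finset.range n, cnt ξ Z G b i ω

variable {G : ℕ → Set ℕ} {b : ℕ → ℕ → ℕ}

open Classical in
theorem ind_fil (h : GW μ ξ Z m) (i : ℕ) :
    Measurable[Fil ξ i] (fun ω => ((if Z i ω ∈ G i then 1 else 0 : ℕ) : ENNReal)) :=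
  (measurable_of_countable (fun v : ℕ => ((if v ∈ G i then 1 else 0 : ℕ) : ENNReal))).comp (h.Z_fil i)

open Classical in
theorem cnt_fil (h : GW μ ξ Z m) (i : ℕ) {k : ℕ} (hik : i + 1 ≤ k) :
    Measurable[Fil ξ k] (cnt ξ Z G b i) := by
  have h1 : Measurable[Fil ξ k] (fun ω => (if Z i ω ∈ G i then 1 else 0 : ℕ)) :=
    ((measurable_of_countable (fun v : ℕ => (if v ∈ G i then 1 else 0 : ℕ))).comp (h.Z_fil i)).mono
      (fil_mono (by omega)) le_rfl
  have h2 : Measurable[Fil ξ k] (fun ω => ∑ j ∈ Finset.range (Z i ω), b i (ξ i j ω)) :=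
    (sm_fil (h.Z_fil i) (b i)).mono (fil_mono hik) le_rfl
  exact h1.mul h2

theorem tot_fil (h : GW μ ξ Z m) (n : ℕ) : Measurable[Fil ξ n] (tot ξ Z G b n) := by
  unfold tot
  refine @Finset.measurable_fun_sum _ _ _ _ _ _ (Fil ξ n) _ _ fun i hi => ?_
  exact h.cnt_fil i (by simpa using hi)

theorem totc_fil (h : GW μ ξ Z m) (n : ℕ) :
    Measurable[Fil ξ n] (fun ω => (tot ξ Z G b n ω : ENNReal)) :=
  (measurable_of_countable (fun v : ℕ => (v : ENNReal))).comp (h.tot_fil n)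

theorem totc_meas (h : GW μ ξ Z m) (n : ℕ) :
    Measurable (fun ω => (tot ξ Z G b n ω : ENNReal)) :=
  (h.totc_fil n).mono (h.fil_le n) le_rfl

theorem cntc_meas (h : GW μ ξ Z m) (n : ℕ) :
    Measurable (fun ω => (cnt ξ Z G b n ω : ENNReal)) :=
  (measurable_of_countable (fun v : ℕ => (v : ENNReal))).comp
    ((h.cnt_fil n le_rfl).mono (h.fil_le (n+1)) le_rfl)

noncomputable def qq (μ : Measure Ω) (ξ : ℕ → ℕ → Ω → ℕ) (b : ℕ → ℕ → ℕ) (i : ℕ) : ENNReal :=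
  Ex μ ξ (fun v => (b i v : ENNReal))

noncomputable def ss (μ : Measure Ω) (ξ : ℕ → ℕ → Ω → ℕ) (b : ℕ → ℕ → ℕ) (m : ℝ) (n : ℕ) : ENNReal :=
  ∑ i ∈ Finset.range n, ENNReal.ofReal m ^ i * qq μ ξ b i

open Classical in
theorem cnt_mul (h : GW μ ξ Z m) (i : ℕ) {f : Ω → ENNReal} (hf : Measurable[Fil ξ i] f) :
    ∫⁻ ω, f ω * cnt ξ Z G b i ω ∂μ
      = qq μ ξ b i * ∫⁻ ω, f ω * ((if Z i ω ∈ G i then 1 else 0 : ℕ) : ENNReal) * Z i ω ∂μ := by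
  have := h.c1 i (hf.mul (h.ind_fil (G := G) i)) (fun v => (b i v : ENNReal))
  simp only [Pi.mul_apply] at this
  unfold qq
  rw [← this]
  refine lintegral_congr fun ω => ?_
  unfold cnt
  push_cast
  ring

theorem cnt_mul_le (h : GW μ ξ Z m) (i : ℕ) {f : Ω → ENNReal} (hf : Measurable[Fil ξ i] f) :
    ∫⁻ ω, f ω * cnt ξ Z G b i ω ∂μ ≤ qq μ ξ b i * ∫⁻ ω, f ω * Z i ω ∂μ := by
  classical
  rw [h.cnt_mul i hf]
  gcongr with ω
  split_ifs <;> simp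

open Classical in
theorem indZ2 (h : GW μ ξ Z m) {X : ENNReal}
    (hG : ∀ i, ∀ v ∈ G i, (v : ENNReal) ≤ X * ENNReal.ofReal m ^ i) (i : ℕ) (f : Ω → ENNReal) :
    ∫⁻ ω, f ω * ((if Z i ω ∈ G i then 1 else 0 : ℕ) : ENNReal) * Z i ω ∂μ
      ≤ ∫⁻ ω, X * ENNReal.ofReal m ^ i * f ω ∂μ := by
  refine lintegral_mono fun ω => ?_
  simp only
  split_ifs with hz
  · have := hG i _ hz
    simp only [Nat.cast_one, mul_one]
    rw [mul_comm]
    gcongr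
  · simp

open Classical in
theorem indZ3 (h : GW μ ξ Z m) {X : ENNReal}
    (hG : ∀ i, ∀ v ∈ G i, (v : ENNReal) ≤ X * ENNReal.ofReal m ^ i) (i : ℕ) :
    ∫⁻ ω, ((if Z i ω ∈ G i then 1 else 0 : ℕ) : ENNReal) * (Z i ω) ^ 2 ∂μ
      ≤ X * ENNReal.ofReal m ^ i * ENNReal.ofReal m ^ i := by
  have := h.indZ2 hG i (fun ω => (Z i ω : ENNReal))
  rw [lintegral_const_mul _ (h.Zc_meas i), h.EZ] at this
  refine le_trans (le_of_eq ?_) this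
  refine lintegral_congr fun ω => ?_
  ring

theorem cnt_Z (h : GW μ ξ Z m) {X L : ENNReal}
    (hG : ∀ i, ∀ v ∈ G i, (v : ENNReal) ≤ X * ENNReal.ofReal m ^ i)
    (hbL : ∀ i v, (b i v : ENNReal) * v ≤ b i v * (L * ENNReal.ofReal m ^ (i+1))) (i : ℕ) :
    ∫⁻ ω, (cnt ξ Z G b i ω : ENNReal) * Z (i+1) ω ∂μ
      ≤ (L + X) * ENNReal.ofReal m ^ (i+1) * (ENNReal.ofReal m ^ i * qq μ ξ b i) := by
  classical
  have h2 := h.c2 i (h.ind_fil (G := G) i) (fun v => (b i v : ENNReal)) (fun v => (v : ENNReal))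
  have h3 : ∫⁻ ω, (cnt ξ Z G b i ω : ENNReal) * Z (i+1) ω ∂μ =
    ∫⁻ ω, ((if Z i ω ∈ G i then 1 else 0 : ℕ) : ENNReal) *
      ((∑ j ∈ Finset.range (Z i ω), (b i (ξ i j ω) : ENNReal)) *
        ∑ j ∈ Finset.range (Z i ω), (ξ i j ω : ENNReal)) ∂μ := by
    refine lintegral_congr fun ω => ?_
    unfold cnt
    rw [h.Zrec]
    push_cast
    ring
  rw [h3]
  refine h2.trans ?_
  rw [h.ex_id]
  have h4 : Ex μ ξ (fun v => (b i v : ENNReal) * v) ≤ qq μ ξ b i * (L * ENNReal.ofReal m ^ (i+1)) := by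
    unfold qq Ex
    rw [← lintegral_mul_const]
    · exact lintegral_mono fun ω => hbL i _
    · exact h.gmeas 0 0 (fun v => (b i v : ENNReal))
  have h5 : ∫⁻ ω, ((if Z i ω ∈ G i then 1 else 0 : ℕ) : ENNReal) * Z i ω ∂μ ≤ ENNReal.ofReal m ^ i := by
    rw [← h.EZ i]
    refine lintegral_mono fun ω => ?_
    simp only
    split_ifs <;> simp
  calc _ ≤ qq μ ξ b i * (L * ENNReal.ofReal m ^ (i+1)) * ENNReal.ofReal m ^ i
        + qq μ ξ b i * ENNReal.ofReal m * (X * ENNReal.ofReal m ^ i * ENNReal.ofReal m ^ i) := by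
        gcongr
        · rfl
        · exact h.indZ3 hG i
    _ = _ := by ring

theorem tot_succ (n : ℕ) (ω : Ω) : tot ξ Z G b (n+1) ω = tot ξ Z G b n ω + cnt ξ Z G b n ω := by
  unfold tot; rw [Finset.sum_range_succ]

theorem tot_Z (h : GW μ ξ Z m) {X L : ENNReal}
    (hG : ∀ i, ∀ v ∈ G i, (v : ENNReal) ≤ X * ENNReal.ofReal m ^ i)
    (hbL : ∀ i v, (b i v : ENNReal) * v ≤ b i v * (L * ENNReal.ofReal m ^ (i+1))) (n : ℕ) :
    ∫⁻ ω, (tot ξ Z G b n ω : ENNReal) * Z n ω ∂μ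
      ≤ (L + X) * ENNReal.ofReal m ^ n * ss μ ξ b m n := by
  induction n with
  | zero => simp [tot]
  | succ n ih =>
    have : ∀ ω, (tot ξ Z G b (n+1) ω : ENNReal) * Z (n+1) ω =
      tot ξ Z G b n ω * Z (n+1) ω + cnt ξ Z G b n ω * Z (n+1) ω := fun ω => by
        rw [tot_succ]; push_cast; ring
    simp_rw [this]
    have mz : Measurable fun ω => (tot ξ Z G b n ω : ENNReal) * Z (n+1) ω :=
      (h.totc_meas n).mul (h.Zc_meas (n+1))
    rw [lintegral_add_left mz, h.step n (h.totc_fil n)]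
    calc _ ≤ ENNReal.ofReal m * ((L + X) * ENNReal.ofReal m ^ n * ss μ ξ b m n) +
        (L + X) * ENNReal.ofReal m ^ (n+1) * (ENNReal.ofReal m ^ n * qq μ ξ b n) := by
          gcongr
          exact h.cnt_Z hG hbL n
      _ = _ := by unfold ss; rw [Finset.sum_range_succ]; ring

theorem pairs (h : GW μ ξ Z m) {X L : ENNReal}
    (hG : ∀ i, ∀ v ∈ G i, (v : ENNReal) ≤ X * ENNReal.ofReal m ^ i)
    (hbL : ∀ i v, (b i v : ENNReal) * v ≤ b i v * (L * ENNReal.ofReal m ^ (i+1)))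
    (hb : ∀ i v, b i v ≤ 1) (n : ℕ) :
    ∫⁻ ω, ((tot ξ Z G b n ω * (tot ξ Z G b n ω - 1) : ℕ) : ENNReal) ∂μ
      ≤ (L + X) * ss μ ξ b m n ^ 2 := by
  classical
  induction n with
  | zero => simp [tot]
  | succ n ih =>
    have key : ∀ s t : ℕ, (s + t) * (s + t - 1) = s * (s - 1) + (2 * (s * t) + t * (t - 1)) := by
      intro s t
      rcases s with _ | s
      · simp
      rcases t with _ | t
      · simp
      simp only [Nat.add_sub_cancel, show s + 1 + (t + 1) - 1 = s + t + 1 by omega]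
      ring
    have h1 : ∀ ω, ((tot ξ Z G b (n+1) ω * (tot ξ Z G b (n+1) ω - 1) : ℕ) : ENNReal)
      = ((tot ξ Z G b n ω * (tot ξ Z G b n ω - 1) : ℕ) : ENNReal) +
        (2 * ((tot ξ Z G b n ω : ENNReal) * cnt ξ Z G b n ω) +
          ((cnt ξ Z G b n ω * (cnt ξ Z G b n ω - 1) : ℕ) : ENNReal)) := by
      intro ω
      rw [tot_succ, key]; push_cast; ring
    have h2 : ∀ ω, ((cnt ξ Z G b n ω * (cnt ξ Z G b n ω - 1) : ℕ) : ENNReal)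
      = ((if Z n ω ∈ G n then 1 else 0 : ℕ) : ENNReal) *
        (((∑ j ∈ Finset.range (Z n ω), b n (ξ n j ω)) *
          ((∑ j ∈ Finset.range (Z n ω), b n (ξ n j ω)) - 1) : ℕ) : ENNReal) := by
      intro ω
      unfold cnt
      split_ifs <;> simp
    have hc := h.c3 n (h.ind_fil (G := G) n) (b n) (hb n)
    simp_rw [← h2] at hc
    have hd := h.cnt_mul_le (G := G) (b := b) n (h.totc_fil (G := G) (b := b) n)
    have hz := h.tot_Z hG hbL n
    simp_rw [h1]
    have mt : Measurable fun ω => ((tot ξ Z G b n ω * (tot ξ Z G b n ω - 1) : ℕ) : ENNReal) :=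
      (measurable_of_countable (fun s : ℕ => ((s * (s - 1) : ℕ) : ENNReal))).comp
        ((h.tot_fil n).mono (h.fil_le n) le_rfl)
    have mp : Measurable fun ω => ((tot ξ Z G b n ω : ENNReal) * cnt ξ Z G b n ω) :=
      (h.totc_meas n).mul (h.cntc_meas n)
    rw [lintegral_add_left mt, lintegral_add_left (mp.const_mul 2), lintegral_const_mul _ mp]
    calc _ ≤ (L + X) * ss μ ξ b m n ^ 2 +
          (2 * (qq μ ξ b n * ((L + X) * ENNReal.ofReal m ^ n * ss μ ξ b m n)) +
            qq μ ξ b n ^ 2 * (X * ENNReal.ofReal m ^ n * ENNReal.ofReal m ^ n)) := by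
          gcongr
          · exact hd.trans (by gcongr)
          · refine hc.trans ?_
            unfold qq
            gcongr
            exact h.indZ3 hG n
      _ ≤ (L + X) * ss μ ξ b m n ^ 2 +
          (2 * (qq μ ξ b n * ((L + X) * ENNReal.ofReal m ^ n * ss μ ξ b m n)) +
            qq μ ξ b n ^ 2 * ((L + X) * ENNReal.ofReal m ^ n * ENNReal.ofReal m ^ n)) := by
          gcongr; exact le_add_self
      _ = _ := by unfold ss; rw [Finset.sum_range_succ]; ring

/-- weighted sum of generation sizes -/
noncomputable def rr (Z : ℕ → Ω → ℕ) (w : ℕ → ENNReal) (n : ℕ) (ω : Ω) : ENNReal :=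
  ∑ i ∈ Finset.range n, w i * Z i ω

noncomputable def rho (m : ℝ) (w : ℕ → ENNReal) (n : ℕ) : ENNReal :=
  ∑ i ∈ Finset.range n, w i * ENNReal.ofReal m ^ i

theorem rr_meas (h : GW μ ξ Z m) (w : ℕ → ENNReal) (n : ℕ) : Measurable (rr Z w n) :=
  Finset.measurable_fun_sum _ fun i _ => (h.Zc_meas i).const_mul _

theorem rr_fil (h : GW μ ξ Z m) (w : ℕ → ENNReal) {n k : ℕ} (hnk : n ≤ k + 1) :
    Measurable[Fil ξ k] (rr Z w n) := by
  refine @Finset.measurable_fun_sum _ _ _ _ _ _ (Fil ξ k) _ _ fun i hi => ?_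
  refine Measurable.const_mul (h.Zc_fil i ?_) (w i)
  have := Finset.mem_range.1 hi
  omega

theorem E_rr (h : GW μ ξ Z m) (w : ℕ → ENNReal) (n : ℕ) : ∫⁻ ω, rr Z w n ω ∂μ = rho m w n := by
  unfold rr rho
  rw [lintegral_finsetSum _ fun i _ => (h.Zc_meas i).const_mul _]
  refine Finset.sum_congr rfl fun i _ => ?_
  rw [lintegral_const_mul _ (h.Zc_meas i), h.EZ]

theorem tot_rr (h : GW μ ξ Z m) {X L : ENNReal}
    (hG : ∀ i, ∀ v ∈ G i, (v : ENNReal) ≤ X * ENNReal.ofReal m ^ i)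
    (hbL : ∀ i v, (b i v : ENNReal) * v ≤ b i v * (L * ENNReal.ofReal m ^ (i+1)))
    (w : ℕ → ENNReal) (n : ℕ) :
    ∫⁻ ω, (tot ξ Z G b n ω : ENNReal) * rr Z w n ω ∂μ
      ≤ (L + X) * ss μ ξ b m n * rho m w n := by
  classical
  induction n with
  | zero => simp [tot]
  | succ n ih =>
    have h1 : ∀ ω, (tot ξ Z G b (n+1) ω : ENNReal) * rr Z w (n+1) ω
      = tot ξ Z G b n ω * rr Z w n ω +
        (w n * (tot ξ Z G b n ω * Z n ω) + rr Z w (n+1) ω * cnt ξ Z G b n ω) := by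
      intro ω
      rw [tot_succ, rr, Finset.sum_range_succ, ← rr]; push_cast; ring
    simp_rw [h1]
    have mtz : Measurable fun ω => (tot ξ Z G b n ω : ENNReal) * Z n ω :=
      (h.totc_meas (G := G) (b := b) n).mul (h.Zc_meas n)
    have mtr : Measurable fun ω => (tot ξ Z G b n ω : ENNReal) * rr Z w n ω :=
      (h.totc_meas n).mul (h.rr_meas w n)
    rw [lintegral_add_left mtr,
      lintegral_add_left (mtz.const_mul (w n))]
    have e1 : ∫⁻ ω, w n * (tot ξ Z G b n ω * Z n ω) ∂μ ≤ w n * ((L + X) * ENNReal.ofReal m ^ n * ss μ ξ b m n) := by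
      rw [lintegral_const_mul _ mtz]
      gcongr
      exact h.tot_Z hG hbL n
    have e2 : ∫⁻ ω, rr Z w (n+1) ω * cnt ξ Z G b n ω ∂μ ≤ qq μ ξ b n * (X * ENNReal.ofReal m ^ n * rho m w (n+1)) := by
      rw [h.cnt_mul n (h.rr_fil w le_rfl)]
      gcongr
      refine (h.indZ2 hG n _).trans ?_
      rw [lintegral_const_mul _ (h.rr_meas w _), h.E_rr]
    calc _ ≤ (L + X) * ss μ ξ b m n * rho m w n + (w n * ((L + X) * ENNReal.ofReal m ^ n * ss μ ξ b m n)
          + qq μ ξ b n * (X * ENNReal.ofReal m ^ n * rho m w (n+1))) := by gcongr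
      _ ≤ (L + X) * ss μ ξ b m n * rho m w n + (w n * ((L + X) * ENNReal.ofReal m ^ n * ss μ ξ b m n)
          + qq μ ξ b n * ((L + X) * ENNReal.ofReal m ^ n * rho m w (n+1))) := by
          gcongr; exact le_add_self
      _ = _ := by
          unfold ss rho
          rw [Finset.sum_range_succ, Finset.sum_range_succ]; ring

end GW

open MeasureTheory Filter ProbabilityTheory
set_option linter.unusedSectionVars false
set_option linter.unusedVariables false

namespace GW
variable {Ω : Type*} [mΩ : MeasurableSpace Ω] {μ : Measure Ω} [IsProbabilityMeasure μ]
    {ξ : ℕ → ℕ → Ω → ℕ} {Z : ℕ → Ω → ℕ} {m : ℝ}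

open Classical in
noncomputable def lowp (t : ℝ) (v : ℕ) : ℝ := if (v : ℝ) ≤ t then v else 0
open Classical in
noncomputable def highp (t : ℝ) (v : ℕ) : ℝ := if (v : ℝ) ≤ t then 0 else v

noncomputable def V2 (μ : Measure Ω) (ξ : ℕ → ℕ → Ω → ℕ) (t : ℝ) : ℝ :=
  ∫ ω, lowp t (ξ 0 0 ω) ^ 2 ∂μ
noncomputable def T1 (μ : Measure Ω) (ξ : ℕ → ℕ → Ω → ℕ) (t : ℝ) : ℝ :=
  ∫ ω, highp t (ξ 0 0 ω) ∂μ
noncomputable def Fb (μ : Measure Ω) (ξ : ℕ → ℕ → Ω → ℕ) (t : ℝ) : ℝ :=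
  (μ {ω | t < (ξ 0 0 ω : ℝ)}).toReal

noncomputable def MM (μ : Measure Ω) (ξ : ℕ → ℕ → Ω → ℕ) (Z : ℕ → Ω → ℕ) (m y : ℝ) (n : ℕ) (ω : Ω) : ℝ :=
  ∑ i ∈ Finset.range n, (m ^ (i+1))⁻¹ * ∑ j ∈ Finset.range (Z i ω),
    (lowp (m ^ (i+1) * y) (ξ i j ω) - ∫ ω, lowp (m ^ (i+1) * y) (ξ 0 0 ω) ∂μ)
noncomputable def JJ (ξ : ℕ → ℕ → Ω → ℕ) (Z : ℕ → Ω → ℕ) (m y : ℝ) (n : ℕ) (ω : Ω) : ℝ :=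
  ∑ i ∈ Finset.range n, (m ^ (i+1))⁻¹ * ∑ j ∈ Finset.range (Z i ω),
    highp (m ^ (i+1) * y) (ξ i j ω)
noncomputable def RR (μ : Measure Ω) (ξ : ℕ → ℕ → Ω → ℕ) (Z : ℕ → Ω → ℕ) (m y : ℝ) (n : ℕ) (ω : Ω) : ℝ :=
  ∑ i ∈ Finset.range n, (m ^ (i+1))⁻¹ * T1 μ ξ (m ^ (i+1) * y) * Z i ω

noncomputable def VV (μ : Measure Ω) (ξ : ℕ → ℕ → Ω → ℕ) (m y : ℝ) (n : ℕ) : ℝ :=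
  ∑ i ∈ Finset.range n, ((m ^ (i+1))⁻¹) ^ 2 * V2 μ ξ (m ^ (i+1) * y) * m ^ i
noncomputable def PP (μ : Measure Ω) (ξ : ℕ → ℕ → Ω → ℕ) (m y : ℝ) (n : ℕ) : ℝ :=
  ∑ i ∈ Finset.range n, (m ^ (i+1))⁻¹ * T1 μ ξ (m ^ (i+1) * y) * m ^ i
noncomputable def SS (μ : Measure Ω) (ξ : ℕ → ℕ → Ω → ℕ) (m y : ℝ) (n : ℕ) : ℝ :=
  ∑ i ∈ Finset.range n, m ^ i * Fb μ ξ (m ^ (i+1) * y)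

theorem lowp_nonneg (t : ℝ) (v : ℕ) : 0 ≤ lowp t v := by unfold lowp; split_ifs <;> positivity
theorem highp_nonneg (t : ℝ) (v : ℕ) : 0 ≤ highp t v := by unfold highp; split_ifs <;> positivity
theorem low_add_high (t : ℝ) (v : ℕ) : lowp t v + highp t v = v := by
  unfold lowp highp; split_ifs <;> simp
theorem lowp_le (t : ℝ) (v : ℕ) : lowp t v ≤ v := by
  have := low_add_high t v; have := highp_nonneg t v; linarith
theorem highp_le (t : ℝ) (v : ℕ) : highp t v ≤ v := by
  have := low_add_high t v; have := lowp_nonneg t v; linarith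
theorem lowp_abs (t : ℝ) (v : ℕ) : |lowp t v| ≤ |t| := by
  unfold lowp; split_ifs with hv
  · exact abs_le_abs_of_nonneg (by positivity) hv
  · simp

theorem mpos (h : GW μ ξ Z m) : 0 < m := by have := h.one_lt; linarith

theorem low_int (h : GW μ ξ Z m) (t : ℝ) : Integrable (fun ω => lowp t (ξ 0 0 ω)) μ :=
  h.int.mono' (h.gmeas 0 0 (lowp t)).aestronglyMeasurable (Eventually.of_forall fun ω => by
    rw [Real.norm_of_nonneg (lowp_nonneg _ _)]; exact lowp_le _ _)
theorem high_int (h : GW μ ξ Z m) (t : ℝ) : Integrable (fun ω => highp t (ξ 0 0 ω)) μ :=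
  h.int.mono' (h.gmeas 0 0 (highp t)).aestronglyMeasurable (Eventually.of_forall fun ω => by
    rw [Real.norm_of_nonneg (highp_nonneg _ _)]; exact highp_le _ _)

theorem V2_nonneg (t : ℝ) : 0 ≤ V2 μ ξ t := integral_nonneg fun _ => sq_nonneg _
theorem T1_nonneg (t : ℝ) : 0 ≤ T1 μ ξ t := integral_nonneg fun _ => highp_nonneg _ _
theorem Fb_nonneg (t : ℝ) : 0 ≤ Fb μ ξ t := ENNReal.toReal_nonneg

theorem VV_nonneg (h : GW μ ξ Z m) (y : ℝ) (n : ℕ) : 0 ≤ VV μ ξ m y n :=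
  Finset.sum_nonneg fun i _ => mul_nonneg (mul_nonneg (sq_nonneg _) (V2_nonneg _)) (pow_nonneg h.mpos.le _)
theorem PP_nonneg (h : GW μ ξ Z m) (y : ℝ) (n : ℕ) : 0 ≤ PP μ ξ m y n :=
  Finset.sum_nonneg fun i _ => mul_nonneg (mul_nonneg (inv_nonneg.2 (pow_nonneg h.mpos.le _))
    (T1_nonneg _)) (pow_nonneg h.mpos.le _)
theorem SS_nonneg (h : GW μ ξ Z m) (y : ℝ) (n : ℕ) : 0 ≤ SS μ ξ m y n :=
  Finset.sum_nonneg fun i _ => mul_nonneg (pow_nonneg h.mpos.le _) (Fb_nonneg _)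

theorem VV_mono (h : GW μ ξ Z m) (y : ℝ) {i n : ℕ} (hin : i ≤ n) : VV μ ξ m y i ≤ VV μ ξ m y n :=
  Finset.sum_le_sum_of_subset_of_nonneg (Finset.range_mono hin) fun i _ _ =>
    mul_nonneg (mul_nonneg (sq_nonneg _) (V2_nonneg _)) (pow_nonneg h.mpos.le _)
theorem PP_mono (h : GW μ ξ Z m) (y : ℝ) {i n : ℕ} (hin : i ≤ n) : PP μ ξ m y i ≤ PP μ ξ m y n :=
  Finset.sum_le_sum_of_subset_of_nonneg (Finset.range_mono hin) fun i _ _ =>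
    mul_nonneg (mul_nonneg (inv_nonneg.2 (pow_nonneg h.mpos.le _)) (T1_nonneg _)) (pow_nonneg h.mpos.le _)

theorem decomp (h : GW μ ξ Z m) (y : ℝ) (n : ℕ) (ω : Ω) :
    (Z n ω : ℝ) / m ^ n = 1 + MM μ ξ Z m y n ω + JJ ξ Z m y n ω - RR μ ξ Z m y n ω := by
  have hm := h.mpos
  induction n with
  | zero => simp [h.Z0, MM, JJ, RR]
  | succ n ih =>
    have e1 : ∫ ω, lowp (m ^ (n+1) * y) (ξ 0 0 ω) ∂μ = m - T1 μ ξ (m ^ (n+1) * y) := by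
      rw [h.mean]; unfold T1
      rw [← integral_sub h.int (h.high_int _)]
      refine integral_congr_ae (Eventually.of_forall fun ω => ?_)
      simp only
      rw [← low_add_high ((∫ ω, (ξ 0 0 ω : ℝ) ∂μ) ^ (n+1) * y) (ξ 0 0 ω)]; ring
    have e2 : (Z (n+1) ω : ℝ) = ∑ j ∈ Finset.range (Z n ω), (lowp (m ^ (n+1) * y) (ξ n j ω)
        + highp (m ^ (n+1) * y) (ξ n j ω)) := by
      rw [h.Zrec]; push_cast
      exact Finset.sum_congr rfl fun j _ => (low_add_high _ _).symm
    have e3 : (Z (n+1) ω : ℝ) / m ^ (n+1) = Z n ω / m ^ n + (m ^ (n+1))⁻¹ * (Z (n+1) ω - m * Z n ω) := by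
      field_simp; ring
    rw [e3, ih, e2]
    unfold MM JJ RR
    rw [Finset.sum_range_succ, Finset.sum_range_succ, Finset.sum_range_succ, e1]
    simp only [Finset.sum_add_distrib, Finset.sum_sub_distrib, Finset.sum_const, Finset.card_range,
      nsmul_eq_mul]
    ring

theorem MM_fil (h : GW μ ξ Z m) (y : ℝ) (n : ℕ) : Measurable[Fil ξ n] (MM μ ξ Z m y n) := by
  refine @Finset.measurable_fun_sum _ _ _ _ _ _ (Fil ξ n) _ _ fun i hi => ?_
  refine Measurable.const_mul ?_ _
  exact (sm_fil (h.Z_fil i) (fun v => lowp (m ^ (i+1) * y) v -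
    ∫ ω, lowp (m ^ (i+1) * y) (ξ 0 0 ω) ∂μ)).mono (fil_mono (by simpa using hi)) le_rfl

theorem MM_meas (h : GW μ ξ Z m) (y : ℝ) (n : ℕ) : Measurable (MM μ ξ Z m y n) :=
  (h.MM_fil y n).mono (h.fil_le n) le_rfl

theorem MM_sq (h : GW μ ξ Z m) (y : ℝ) (n : ℕ) :
    ∫⁻ ω, ENNReal.ofReal (MM μ ξ Z m y n ω ^ 2) ∂μ ≤ ENNReal.ofReal (VV μ ξ m y n) := by
  have hm := h.mpos
  induction n with
  | zero => simp [MM]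
  | succ n ih =>
    have := h.c4 n (h.MM_fil y n) (lowp (m ^ (n+1) * y)) _ (lowp_abs _) ((m ^ (n+1))⁻¹)
    have e : ∀ ω, MM μ ξ Z m y (n+1) ω = MM μ ξ Z m y n ω + (m ^ (n+1))⁻¹ *
      ∑ j ∈ Finset.range (Z n ω),
    (lowp (m ^ (n+1) * y) (ξ n j ω) - ∫ ω, lowp (m ^ (n+1) * y) (ξ 0 0 ω) ∂μ) := by
      intro ω; unfold MM; rw [Finset.sum_range_succ]
    simp_rw [e]
    refine this.trans ?_
    have hV : 0 ≤ (m ^ (n+1))⁻¹ ^ 2 * ∫ ω, lowp (m ^ (n+1) * y) (ξ 0 0 ω) ^ 2 ∂μ :=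
      mul_nonneg (sq_nonneg _) (V2_nonneg _)
    rw [h.EZ, ← ENNReal.ofReal_pow hm.le, ← ENNReal.ofReal_mul hV]
    have eV : VV μ ξ m y (n+1) = VV μ ξ m y n + ((m ^ (n+1))⁻¹) ^ 2 * V2 μ ξ (m ^ (n+1) * y) * m ^ n := by
      unfold VV; rw [Finset.sum_range_succ]
    rw [eV, ENNReal.ofReal_add (h.VV_nonneg y n)
      (mul_nonneg (mul_nonneg (sq_nonneg _) (V2_nonneg _)) (pow_nonneg h.mpos.le _))]
    exact add_le_add ih le_rfl

theorem JJ_meas (h : GW μ ξ Z m) (y : ℝ) (n : ℕ) : Measurable (JJ ξ Z m y n) := by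
  refine Finset.measurable_fun_sum _ fun i hi => ?_
  refine Measurable.const_mul ?_ _
  exact (sm_fil (h.Z_fil i) (highp (m ^ (i+1) * y))).mono (h.fil_le _) le_rfl

theorem JJ_term_nonneg (h : GW μ ξ Z m) (y : ℝ) (i : ℕ) (ω : Ω) : 0 ≤ (m ^ (i+1))⁻¹ * ∑ j ∈ Finset.range (Z i ω),
    highp (m ^ (i+1) * y) (ξ i j ω) :=
  mul_nonneg (inv_nonneg.2 (pow_nonneg h.mpos.le _)) (Finset.sum_nonneg fun _ _ => highp_nonneg _ _)

theorem JJ_nonneg (h : GW μ ξ Z m) (y : ℝ) (n : ℕ) (ω : Ω) : 0 ≤ JJ ξ Z m y n ω :=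
  Finset.sum_nonneg fun i _ => h.JJ_term_nonneg y i ω

theorem JJ_mean (h : GW μ ξ Z m) (y : ℝ) (n : ℕ) :
    ∫⁻ ω, ENNReal.ofReal (JJ ξ Z m y n ω) ∂μ = ENNReal.ofReal (PP μ ξ m y n) := by
  have hm := h.mpos
  have e : ∀ ω, ENNReal.ofReal (JJ ξ Z m y n ω) = ∑ i ∈ Finset.range n, ENNReal.ofReal ((m ^ (i+1))⁻¹) *
      (1 * ∑ j ∈ Finset.range (Z i ω), ENNReal.ofReal (highp (m ^ (i+1) * y) (ξ i j ω))) := by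
    intro ω
    unfold JJ
    rw [ENNReal.ofReal_sum_of_nonneg fun i _ => h.JJ_term_nonneg y i ω]
    refine Finset.sum_congr rfl fun i _ => ?_
    rw [ENNReal.ofReal_mul (by positivity), ENNReal.ofReal_sum_of_nonneg fun _ _ => highp_nonneg _ _,
      one_mul]
  simp_rw [e]
  have hms : ∀ i, Measurable fun ω => (1 : ENNReal) * ∑ j ∈ Finset.range (Z i ω),
      ENNReal.ofReal (highp (m ^ (i+1) * y) (ξ i j ω)) := fun i =>
    ((sm_fil (h.Z_fil i) (fun v => ENNReal.ofReal (highp (m ^ (i+1) * y) v))).mono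
      (h.fil_le _) le_rfl).const_mul 1
  rw [lintegral_finsetSum _ fun i _ => (hms i).const_mul _]
  unfold PP
  rw [ENNReal.ofReal_sum_of_nonneg fun i _ => mul_nonneg (mul_nonneg (inv_nonneg.2 (pow_nonneg h.mpos.le _))
    (T1_nonneg _)) (pow_nonneg h.mpos.le _)]
  refine Finset.sum_congr rfl fun i _ => ?_
  rw [lintegral_const_mul _ (hms i), h.c1 i (f := fun _ => 1) (@measurable_const _ _ _ (Fil ξ i) _)
    (fun v => ENNReal.ofReal (highp (m ^ (i+1) * y) v))]
  simp only [one_mul]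
  rw [h.EZ, mul_assoc, ENNReal.ofReal_mul (by positivity), ENNReal.ofReal_mul (T1_nonneg _),
    ENNReal.ofReal_pow hm.le]
  congr 2
  unfold Ex T1
  rw [ofReal_integral_eq_lintegral_ofReal (h.high_int _) (Eventually.of_forall fun _ => highp_nonneg _ _)]

noncomputable def ww (μ : Measure Ω) (ξ : ℕ → ℕ → Ω → ℕ) (m y : ℝ) (i : ℕ) : ENNReal :=
  ENNReal.ofReal ((m ^ (i+1))⁻¹ * T1 μ ξ (m ^ (i+1) * y))

theorem RR_rr (h : GW μ ξ Z m) (y : ℝ) (n : ℕ) (ω : Ω) :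
    ENNReal.ofReal (RR μ ξ Z m y n ω) = rr Z (ww μ ξ m y) n ω := by
  have hm := h.mpos
  have hp : ∀ i : ℕ, 0 ≤ (m ^ (i+1))⁻¹ * T1 μ ξ (m ^ (i+1) * y) := fun i =>
    mul_nonneg (by positivity) (T1_nonneg _)
  unfold RR rr ww
  rw [ENNReal.ofReal_sum_of_nonneg fun i _ => mul_nonneg (hp i) (by positivity)]
  refine Finset.sum_congr rfl fun i _ => ?_
  rw [ENNReal.ofReal_mul (hp i)]; simp

theorem RR_nonneg (h : GW μ ξ Z m) (y : ℝ) (n : ℕ) (ω : Ω) : 0 ≤ RR μ ξ Z m y n ω := by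
  have hm := h.mpos
  exact Finset.sum_nonneg fun i _ => mul_nonneg (mul_nonneg (by positivity) (T1_nonneg _)) (by positivity)

theorem rho_PP (h : GW μ ξ Z m) (y : ℝ) (n : ℕ) :
    rho m (ww μ ξ m y) n = ENNReal.ofReal (PP μ ξ m y n) := by
  have hm := h.mpos
  have hp : ∀ i : ℕ, 0 ≤ (m ^ (i+1))⁻¹ * T1 μ ξ (m ^ (i+1) * y) := fun i =>
    mul_nonneg (by positivity) (T1_nonneg _)
  unfold PP rho ww
  rw [ENNReal.ofReal_sum_of_nonneg fun i _ => mul_nonneg (hp i) (by positivity)]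
  refine Finset.sum_congr rfl fun i _ => ?_
  rw [ENNReal.ofReal_mul (hp i), ENNReal.ofReal_pow hm.le]

open Classical in
noncomputable def bb (m lo hi : ℝ) (i v : ℕ) : ℕ :=
  if m ^ (i+1) * lo < v ∧ (v : ℝ) ≤ m ^ (i+1) * hi then 1 else 0

def GG (m x : ℝ) (i : ℕ) : Set ℕ := {v | (v : ℝ) ≤ x * m ^ i}

theorem bb_le (lo hi : ℝ) (i v : ℕ) : bb m lo hi i v ≤ 1 := by unfold bb; split_ifs <;> simp

theorem GG_prop (h : GW μ ξ Z m) {x : ℝ} (hx : 0 ≤ x) :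
    ∀ i, ∀ v ∈ GG m x i, (v : ENNReal) ≤ ENNReal.ofReal x * ENNReal.ofReal m ^ i := by
  intro i v hv
  have hm := h.mpos
  rw [← ENNReal.ofReal_pow hm.le, ← ENNReal.ofReal_mul hx, ← ENNReal.ofReal_natCast]
  exact ENNReal.ofReal_le_ofReal hv

theorem bb_prop (h : GW μ ξ Z m) (lo : ℝ) {hi : ℝ} (hhi : 0 ≤ hi) :
    ∀ i v, (bb m lo hi i v : ENNReal) * v ≤ bb m lo hi i v * (ENNReal.ofReal hi * ENNReal.ofReal m ^ (i+1)) := by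
  intro i v
  have hm := h.mpos
  unfold bb
  split_ifs with hv
  · simp only [Nat.cast_one, one_mul]
    rw [← ENNReal.ofReal_pow hm.le, ← ENNReal.ofReal_mul hhi, ← ENNReal.ofReal_natCast, mul_comm hi]
    exact ENNReal.ofReal_le_ofReal hv.2
  · simp

theorem qq_add (h : GW μ ξ Z m) {lo hi : ℝ} (hlh : lo ≤ hi) (i : ℕ) :
    qq μ ξ (bb m lo hi) i + ENNReal.ofReal (Fb μ ξ (m ^ (i+1) * hi))
      = ENNReal.ofReal (Fb μ ξ (m ^ (i+1) * lo)) := by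
  classical
  have hm := h.mpos
  have hle : m ^ (i+1) * lo ≤ m ^ (i+1) * hi := by gcongr
  unfold Fb
  rw [ENNReal.ofReal_toReal (measure_ne_top _ _), ENNReal.ofReal_toReal (measure_ne_top _ _)]
  have hms : ∀ t : ℝ, MeasurableSet {ω | t < (ξ 0 0 ω : ℝ)} := fun t =>
    measurableSet_lt measurable_const (h.gmeas 0 0 (fun v => (v : ℝ)))
  rw [← lintegral_indicator_one (hms _), ← lintegral_indicator_one (hms _)]
  unfold qq Ex
  rw [← lintegral_add_left (h.gmeas 0 0 (fun v => (bb m lo hi i v : ENNReal)))]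
  refine lintegral_congr fun ω => ?_
  unfold bb
  simp only [Set.indicator_apply, Set.mem_ofPred_eq, Pi.one_apply]
  by_cases h1 : m ^ (i+1) * lo < (ξ 0 0 ω : ℝ) <;> by_cases h2 : (ξ 0 0 ω : ℝ) ≤ m ^ (i+1) * hi
  · simp [h1, h2, not_lt.2 h2]
  · simp [h1, h2, not_le.1 h2]
  · simp [h1, not_lt.2 h2]
  · exact absurd (lt_of_le_of_lt hle (not_le.1 h2)) h1

theorem ofReal_SS (h : GW μ ξ Z m) (y : ℝ) (n : ℕ) : ENNReal.ofReal (SS μ ξ m y n)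
    = ∑ i ∈ Finset.range n, ENNReal.ofReal m ^ i * ENNReal.ofReal (Fb μ ξ (m ^ (i+1) * y)) := by
  have hm := h.mpos
  unfold SS
  rw [ENNReal.ofReal_sum_of_nonneg fun i _ => mul_nonneg (pow_nonneg h.mpos.le _) (Fb_nonneg _)]
  refine Finset.sum_congr rfl fun i _ => ?_
  rw [ENNReal.ofReal_mul (by positivity), ENNReal.ofReal_pow hm.le]

theorem ss_add (h : GW μ ξ Z m) {lo hi : ℝ} (hlh : lo ≤ hi) (n : ℕ) :
    ss μ ξ (bb m lo hi) m n + ENNReal.ofReal (SS μ ξ m hi n) = ENNReal.ofReal (SS μ ξ m lo n) := by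
  rw [h.ofReal_SS, h.ofReal_SS]
  unfold ss
  rw [← Finset.sum_add_distrib]
  refine Finset.sum_congr rfl fun i _ => ?_
  rw [← mul_add, h.qq_add hlh]

theorem ss_le (h : GW μ ξ Z m) {lo hi : ℝ} (hlh : lo ≤ hi) (n : ℕ) :
    ss μ ξ (bb m lo hi) m n ≤ ENNReal.ofReal (SS μ ξ m lo n) := by
  rw [← h.ss_add hlh]; exact le_self_add

noncomputable def ui (μ : Measure Ω) (ξ : ℕ → ℕ → Ω → ℕ) (m x : ℝ) (n : ℕ) : ℝ :=
  2 * VV μ ξ m x n / x + 2 * PP μ ξ m x n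

theorem ui_nonneg (h : GW μ ξ Z m) {x : ℝ} (hx : 0 < x) (n : ℕ) : 0 ≤ ui μ ξ m x n := by
  have := h.VV_nonneg x n
  have := h.PP_nonneg x n
  unfold ui; positivity

open Classical in
theorem UI (h : GW μ ξ Z m) {x : ℝ} (hx : 4 ≤ x) {i n : ℕ} (hin : i ≤ n) :
    ∫⁻ ω, (if Z i ω ∈ GG m x i then 0 else (Z i ω : ENNReal)) ∂μ
      ≤ ENNReal.ofReal m ^ i * ENNReal.ofReal (ui μ ξ m x n) := by
  have hm := h.mpos
  have hx0 : 0 < x := by linarith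
  have hpt : ∀ ω, (if Z i ω ∈ GG m x i then 0 else (Z i ω : ENNReal)) ≤
      ENNReal.ofReal m ^ i * (ENNReal.ofReal (2 / x) * ENNReal.ofReal (MM μ ξ Z m x i ω ^ 2) +
        2 * ENNReal.ofReal (JJ ξ Z m x i ω)) := by
    intro ω
    split_ifs with hz
    · simp
    · have hz' : x * m ^ i < Z i ω := not_le.1 hz
      have hd := h.decomp x i ω
      have hR := h.RR_nonneg x i ω
      have hJ := h.JJ_nonneg x i ω
      set M := MM μ ξ Z m x i ω
      set J := JJ ξ Z m x i ω
      have hw : x < (Z i ω : ℝ) / m ^ i := by rwa [lt_div_iff₀ (by positivity)]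
      have e2 : (2 : ENNReal) = ENNReal.ofReal 2 := by simp
      rw [e2, ← ENNReal.ofReal_mul (by positivity), ← ENNReal.ofReal_mul (by positivity),
        ← ENNReal.ofReal_add (by positivity) (by positivity), ← ENNReal.ofReal_pow hm.le,
        ← ENNReal.ofReal_mul (by positivity), ← ENNReal.ofReal_natCast]
      apply ENNReal.ofReal_le_ofReal
      have : (Z i ω : ℝ) / m ^ i ≤ 2 / x * M ^ 2 + 2 * J := by
        have h1 : M - x / 4 ≤ M ^ 2 / x := by
          rw [le_div_iff₀ hx0]; nlinarith [sq_nonneg (M - x/2)]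
        have h2 : 2 / x * M ^ 2 = 2 * (M ^ 2 / x) := by ring
        rw [h2]
        linarith
      rw [div_le_iff₀ (by positivity)] at this
      linarith
  refine (lintegral_mono hpt).trans ?_
  have m1 : Measurable fun ω => ENNReal.ofReal (MM μ ξ Z m x i ω ^ 2) :=
    ((h.MM_meas x i).pow_const 2).ennreal_ofReal
  have m2 : Measurable fun ω => ENNReal.ofReal (JJ ξ Z m x i ω) := (h.JJ_meas x i).ennreal_ofReal
  have m3 : Measurable fun ω => ENNReal.ofReal (2/x) * ENNReal.ofReal (MM μ ξ Z m x i ω ^ 2) +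
      2 * ENNReal.ofReal (JJ ξ Z m x i ω) := (m1.const_mul _).add (m2.const_mul _)
  rw [lintegral_const_mul _ m3, lintegral_add_left (m1.const_mul _),
    lintegral_const_mul _ m1, lintegral_const_mul _ m2, h.JJ_mean]
  gcongr
  calc _ ≤ ENNReal.ofReal (2/x) * ENNReal.ofReal (VV μ ξ m x n) + 2 * ENNReal.ofReal (PP μ ξ m x n) := by
        gcongr
        · exact (h.MM_sq x i).trans (ENNReal.ofReal_le_ofReal (h.VV_mono x hin))
        · exact h.PP_mono x hin
    _ = _ := by
        have e2 : (2 : ENNReal) = ENNReal.ofReal 2 := by simp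
        have := h.VV_nonneg x n
        have := h.PP_nonneg x n
        rw [e2, ← ENNReal.ofReal_mul (by positivity), ← ENNReal.ofReal_mul (by positivity),
          ← ENNReal.ofReal_add (by positivity) (by positivity)]
        unfold ui
        congr 1; ring

end GW

open MeasureTheory Filter ProbabilityTheory
set_option linter.unusedSectionVars false
set_option linter.unusedVariables false

namespace GW
variable {Ω : Type*} [mΩ : MeasurableSpace Ω] {μ : Measure Ω} [IsProbabilityMeasure μ]
    {ξ : ℕ → ℕ → Ω → ℕ} {Z : ℕ → Ω → ℕ} {m : ℝ}

open Classical in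
noncomputable def off (ξ : ℕ → ℕ → Ω → ℕ) (Z : ℕ → Ω → ℕ) (G : ℕ → Set ℕ) (b : ℕ → ℕ → ℕ)
    (i : ℕ) (ω : Ω) : ℕ :=
  (if Z i ω ∈ G i then 0 else 1) * ∑ j ∈ Finset.range (Z i ω), b i (ξ i j ω)

noncomputable def offs (ξ : ℕ → ℕ → Ω → ℕ) (Z : ℕ → Ω → ℕ) (G : ℕ → Set ℕ) (b : ℕ → ℕ → ℕ)
    (n : ℕ) (ω : Ω) : ℕ := ∑ i ∈ Finset.range n, off ξ Z G b i ω

variable {G : ℕ → Set ℕ} {b : ℕ → ℕ → ℕ}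

theorem cnt_off (i : ℕ) (ω : Ω) :
    cnt ξ Z G b i ω + off ξ Z G b i ω = ∑ j ∈ Finset.range (Z i ω), b i (ξ i j ω) := by
  unfold cnt off
  split_ifs <;> simp

theorem tot_offs (n : ℕ) (ω : Ω) :
    tot ξ Z G b n ω + offs ξ Z G b n ω = ∑ i ∈ Finset.range n, ∑ j ∈ Finset.range (Z i ω), b i (ξ i j ω) := by
  unfold tot offs
  rw [← Finset.sum_add_distrib]
  exact Finset.sum_congr rfl fun i _ => cnt_off i ω

theorem sumb_meas (h : GW μ ξ Z m) (i : ℕ) :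
    Measurable fun ω => ∑ j ∈ Finset.range (Z i ω), (b i (ξ i j ω) : ENNReal) :=
  (sm_fil (h.Z_fil i) (fun v => (b i v : ENNReal))).mono (h.fil_le _) le_rfl

theorem sumb_mean (h : GW μ ξ Z m) (n : ℕ) :
    ∫⁻ ω, ((∑ i ∈ Finset.range n, ∑ j ∈ Finset.range (Z i ω), b i (ξ i j ω) : ℕ) : ENNReal) ∂μ
      = ss μ ξ b m n := by
  push_cast
  rw [lintegral_finsetSum _ fun i _ => h.sumb_meas i]
  unfold ss
  refine Finset.sum_congr rfl fun i _ => ?_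
  have := h.c1 i (f := fun _ => 1) (@measurable_const _ _ _ (Fil ξ i) _) (fun v => (b i v : ENNReal))
  simp only [one_mul] at this
  rw [this, h.EZ, mul_comm]; rfl

theorem offc_meas (h : GW μ ξ Z m) (i : ℕ) : Measurable fun ω => (off ξ Z G b i ω : ENNReal) := by
  classical
  have h1 : Measurable (fun ω => (if Z i ω ∈ G i then 0 else 1 : ENNReal)) :=
    ((measurable_of_countable (fun v : ℕ => (if v ∈ G i then 0 else 1 : ENNReal))).comp (h.Z_meas i))
  have h2 := h1.mul (h.sumb_meas (b := b) i)
  have e : (fun ω => (off ξ Z G b i ω : ENNReal)) = (fun ω => (if Z i ω ∈ G i then 0 else 1 : ENNReal)) *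
      fun ω => ∑ j ∈ Finset.range (Z i ω), (b i (ξ i j ω) : ENNReal) := by
    funext ω
    unfold off
    simp only [Pi.mul_apply]
    split_ifs <;> simp
  rw [e]; exact h2

theorem offsc_meas (h : GW μ ξ Z m) (n : ℕ) : Measurable fun ω => (offs ξ Z G b n ω : ENNReal) := by
  unfold offs; push_cast
  exact Finset.measurable_fun_sum _ fun i _ => h.offc_meas i

theorem offs_mean (h : GW μ ξ Z m) {x : ℝ} (hx : 4 ≤ x) (n : ℕ) :
    ∫⁻ ω, (offs ξ Z (GG m x) b n ω : ENNReal) ∂μ ≤ ss μ ξ b m n * ENNReal.ofReal (ui μ ξ m x n) := by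
  classical
  unfold offs; push_cast
  rw [lintegral_finsetSum _ fun i _ => h.offc_meas i]
  unfold ss
  rw [Finset.sum_mul]
  refine Finset.sum_le_sum fun i hi => ?_
  have hf : Measurable[Fil ξ i] (fun ω => (if Z i ω ∈ GG m x i then 0 else 1 : ENNReal)) :=
    ((measurable_of_countable (fun v : ℕ => (if v ∈ GG m x i then 0 else 1 : ENNReal))).comp (h.Z_fil i))
  have h1 := h.c1 i hf (fun v => (b i v : ENNReal))
  have h2 : ∫⁻ ω, (off ξ Z (GG m x) b i ω : ENNReal) ∂μ
      = qq μ ξ b i * ∫⁻ ω, (if Z i ω ∈ GG m x i then 0 else (Z i ω : ENNReal)) ∂μ := by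
    unfold qq
    rw [show (∫⁻ ω, (if Z i ω ∈ GG m x i then 0 else (Z i ω : ENNReal)) ∂μ) =
      ∫⁻ ω, (if Z i ω ∈ GG m x i then 0 else 1 : ENNReal) * Z i ω ∂μ from
      lintegral_congr fun ω => by split_ifs <;> simp]
    rw [← h1]
    refine lintegral_congr fun ω => ?_
    unfold off
    split_ifs <;> simp
  rw [h2]
  have h3 := h.UI hx (i := i) (n := n) (Finset.mem_range.1 hi).le
  calc _ ≤ qq μ ξ b i * (ENNReal.ofReal m ^ i * ENNReal.ofReal (ui μ ξ m x n)) := by gcongr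
    _ = _ := by ring

theorem W_set (h : GW μ ξ Z m) (x : ℝ) (n : ℕ) : MeasurableSet {ω | x < (Z n ω : ℝ) / m ^ n} :=
  measurableSet_lt measurable_const
    ((measurable_of_countable (fun v : ℕ => (v : ℝ) / m ^ n)).comp (h.Z_meas n))

open Classical in
noncomputable def bu (m hi : ℝ) (i v : ℕ) : ℕ := if m ^ (i+1) * hi < v then 1 else 0

theorem ss_bu (h : GW μ ξ Z m) (hi : ℝ) (n : ℕ) :
    ss μ ξ (bu m hi) m n = ENNReal.ofReal (SS μ ξ m hi n) := by
  classical
  rw [h.ofReal_SS]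
  unfold ss
  refine Finset.sum_congr rfl fun i _ => ?_
  congr 1
  unfold qq Ex Fb
  rw [ENNReal.ofReal_toReal (measure_ne_top _ _)]
  have hms : ∀ t : ℝ, MeasurableSet {ω | t < (ξ 0 0 ω : ℝ)} := fun t =>
    measurableSet_lt measurable_const (h.gmeas 0 0 (fun v => (v : ℝ)))
  rw [← lintegral_indicator_one (hms _)]
  refine lintegral_congr fun ω => ?_
  unfold bu
  simp only [Set.indicator_apply, Set.mem_ofPred_eq, Pi.one_apply]
  split_ifs <;> simp

theorem upper_pt (h : GW μ ξ Z m) {x δ κ θ : ℝ} (hx : 4 ≤ x) (hδ : 0 < δ) (hδx : 2 ≤ δ * x)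
    (hκ : κ = 1 - δ) (hθ : 0 < θ) (hθκ : θ ≤ κ) (n : ℕ) (ω : Ω)
    (hW : x < (Z n ω : ℝ) / m ^ n)
    (hA : ∑ i ∈ Finset.range n, ∑ j ∈ Finset.range (Z i ω), bu m (κ * x) i (ξ i j ω) = 0)
    (hB : offs ξ Z (GG m x) (bb m (θ * x) (κ * x)) n ω = 0)
    (hT : tot ξ Z (GG m x) (bb m (θ * x) (κ * x)) n ω ≤ 1) :
    δ * x / 2 < MM μ ξ Z m (θ * x) n ω := by
  have hm := h.mpos
  have hd := h.decomp (θ * x) n ω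
  have hR := h.RR_nonneg (θ * x) n ω
  have hto := tot_offs (ξ := ξ) (Z := Z) (G := GG m x) (b := bb m (θ * x) (κ * x)) n ω
  have hJ : JJ ξ Z m (θ * x) n ω ≤ κ * x := by
    have h1 : JJ ξ Z m (θ * x) n ω ≤ ∑ i ∈ Finset.range n, (m ^ (i+1))⁻¹ * ∑ j ∈ Finset.range (Z i ω),
        κ * x * m ^ (i+1) * (bb m (θ * x) (κ * x) i (ξ i j ω) : ℝ) := by
      unfold JJ
      refine Finset.sum_le_sum fun i hi => ?_
      gcongr with j hj
      rw [Finset.sum_eq_zero_iff] at hA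
      have h2 := hA i hi
      rw [Finset.sum_eq_zero_iff] at h2
      have h3 := h2 j hj
      unfold bu at h3
      split_ifs at h3 with h4
      push Not at h4
      unfold highp bb
      split_ifs with h5 h6 h6
      · have : 0 < κ * x := mul_pos (by linarith) (by linarith)
        positivity
      · simp
      · push_cast; linarith
      · exact absurd ⟨not_le.1 h5, h4⟩ h6
    have h2 : ∑ i ∈ Finset.range n, (m ^ (i+1))⁻¹ * ∑ j ∈ Finset.range (Z i ω),
        κ * x * m ^ (i+1) * (bb m (θ * x) (κ * x) i (ξ i j ω) : ℝ) = κ * x *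
          ((∑ i ∈ Finset.range n, ∑ j ∈ Finset.range (Z i ω), bb m (θ * x) (κ * x) i (ξ i j ω) : ℕ) : ℝ) := by
      push_cast
      rw [Finset.mul_sum]
      refine Finset.sum_congr rfl fun i _ => ?_
      rw [← Finset.mul_sum]
      field_simp
    rw [h2, ← hto, hB, add_zero] at h1
    have hT' : (tot ξ Z (GG m x) (bb m (θ * x) (κ * x)) n ω : ℝ) ≤ 1 := by exact_mod_cast hT
    refine h1.trans ?_
    have : 0 ≤ κ * x := mul_nonneg (by linarith) (by linarith)
    nlinarith
  subst hκ
  linarith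

theorem upper (h : GW μ ξ Z m) {x δ κ θ : ℝ} (hx : 4 ≤ x) (hδ : 0 < δ) (hδx : 2 ≤ δ * x)
    (hκ : κ = 1 - δ) (hθ : 0 < θ) (hθκ : θ ≤ κ) (n : ℕ) :
    (μ {ω | x < (Z n ω : ℝ) / m ^ n}).toReal ≤ SS μ ξ m (κ * x) n + SS μ ξ m (θ * x) n * ui μ ξ m x n
      + 4 / (δ * x) ^ 2 * VV μ ξ m (θ * x) n + 2 * x * SS μ ξ m (θ * x) n ^ 2 := by
  classical
  have hm := h.mpos
  have hx0 : 0 < x := by linarith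
  set B := bb m (θ * x) (κ * x) with hBdef
  set S := SS μ ξ m (θ * x) n
  have hS : 0 ≤ S := h.SS_nonneg _ _
  have hS' := h.SS_nonneg (κ * x) n
  have hV := h.VV_nonneg (θ * x) n
  have hu := h.ui_nonneg hx0 n
  apply ENNReal.toReal_le_of_le_ofReal (by positivity)
  have hpt : ∀ ω, Set.indicator {ω | x < (Z n ω : ℝ) / m ^ n} 1 ω ≤
      ((∑ i ∈ Finset.range n, ∑ j ∈ Finset.range (Z i ω), bu m (κ * x) i (ξ i j ω) : ℕ) : ENNReal)
      + (offs ξ Z (GG m x) B n ω : ENNReal)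
      + ENNReal.ofReal (4 / (δ * x) ^ 2) * ENNReal.ofReal (MM μ ξ Z m (θ * x) n ω ^ 2)
      + ((tot ξ Z (GG m x) B n ω * (tot ξ Z (GG m x) B n ω - 1) : ℕ) : ENNReal) := by
    intro ω
    simp only [Set.indicator_apply, Set.mem_ofPred_eq, Pi.one_apply]
    split_ifs with hW
    swap
    · exact zero_le
    have hone : ∀ k : ℕ, k ≠ 0 → (1 : ENNReal) ≤ (k : ENNReal) := fun k hk => by
      exact_mod_cast Nat.one_le_iff_ne_zero.2 hk
    by_cases hA : ∑ i ∈ Finset.range n, ∑ j ∈ Finset.range (Z i ω), bu m (κ * x) i (ξ i j ω) = 0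
    swap
    · rw [add_assoc, add_assoc]; exact (hone _ hA).trans le_self_add
    by_cases hB : offs ξ Z (GG m x) B n ω = 0
    swap
    · rw [add_assoc]; exact ((hone _ hB).trans le_add_self).trans le_self_add
    by_cases hT : tot ξ Z (GG m x) B n ω ≤ 1
    swap
    · refine (hone _ ?_).trans le_add_self
      apply mul_ne_zero <;> omega
    have := h.upper_pt hx hδ hδx hκ hθ hθκ n ω hW hA hB hT
    refine le_trans ?_ (le_self_add.trans' le_add_self)
    rw [← ENNReal.ofReal_mul (by positivity), ENNReal.one_le_ofReal, div_mul_eq_mul_div,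
      one_le_div (by positivity)]
    nlinarith
  rw [← lintegral_indicator_one (h.W_set x n)]
  refine (lintegral_mono hpt).trans ?_
  have m1 : Measurable fun ω => ((∑ i ∈ Finset.range n, ∑ j ∈ Finset.range (Z i ω),
      bu m (κ * x) i (ξ i j ω) : ℕ) : ENNReal) := by
    push_cast; exact Finset.measurable_fun_sum _ fun i _ => h.sumb_meas i
  have m2 : Measurable fun ω => (offs ξ Z (GG m x) B n ω : ENNReal) := h.offsc_meas n
  have m3 : Measurable fun ω => ENNReal.ofReal (MM μ ξ Z m (θ * x) n ω ^ 2) :=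
    ((h.MM_meas _ n).pow_const 2).ennreal_ofReal
  have m4 : Measurable fun ω => ENNReal.ofReal (4 / (δ * x) ^ 2) * ENNReal.ofReal (MM μ ξ Z m (θ * x) n ω ^ 2) :=
    m3.const_mul _
  have m5 : Measurable fun ω => ((∑ i ∈ Finset.range n, ∑ j ∈ Finset.range (Z i ω),
      bu m (κ * x) i (ξ i j ω) : ℕ) : ENNReal) + (offs ξ Z (GG m x) B n ω : ENNReal) := m1.add m2
  have m6 : Measurable fun ω => ((∑ i ∈ Finset.range n, ∑ j ∈ Finset.range (Z i ω),
      bu m (κ * x) i (ξ i j ω) : ℕ) : ENNReal) + (offs ξ Z (GG m x) B n ω : ENNReal) +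
      ENNReal.ofReal (4 / (δ * x) ^ 2) * ENNReal.ofReal (MM μ ξ Z m (θ * x) n ω ^ 2) := m5.add m4
  rw [lintegral_add_left m6, lintegral_add_left m5, lintegral_add_left m1, lintegral_const_mul _ m3,
    h.sumb_mean, h.ss_bu]
  have hlh : θ * x ≤ κ * x := by gcongr
  have hκ1 : κ ≤ 1 := by linarith
  have hκx : 0 ≤ κ * x := mul_nonneg (by linarith) hx0.le
  have hss : ss μ ξ B m n ≤ ENNReal.ofReal S := h.ss_le hlh n
  have hp := h.pairs (h.GG_prop hx0.le) (h.bb_prop (θ * x) hκx) (bb_le (m := m) (θ * x) (κ * x)) n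
  rw [ENNReal.ofReal_add (by positivity) (by positivity), ENNReal.ofReal_add (by positivity) (by positivity),
    ENNReal.ofReal_add (by positivity) (by positivity)]
  refine add_le_add (add_le_add (add_le_add le_rfl ?_) ?_) ?_
  · refine (h.offs_mean hx n).trans ?_
    rw [ENNReal.ofReal_mul hS]
    gcongr
  · rw [ENNReal.ofReal_mul (by positivity)]
    gcongr
    exact h.MM_sq _ _
  · refine hp.trans ?_
    rw [ENNReal.ofReal_mul (p := 2 * x) (by positivity), ENNReal.ofReal_pow hS, ← ENNReal.ofReal_add hκx hx0.le]
    gcongr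
    nlinarith

theorem lower_pt (h : GW μ ξ Z m) {x δ a K θ : ℝ} (hx : 4 ≤ x) (hδ : 0 < δ)
    (ha : a = 1 + 2 * δ) (hθ : 0 < θ) (hθ1 : θ ≤ 1) (n : ℕ) (ω : Ω)
    (hT : tot ξ Z (GG m x) (bb m (a * x) (K * x)) n ω ≠ 0)
    (hR : RR μ ξ Z m (θ * x) n ω ≤ δ * x) (hM : - (δ * x) ≤ MM μ ξ Z m (θ * x) n ω) :
    x < (Z n ω : ℝ) / m ^ n := by
  have hm := h.mpos
  have hx0 : 0 < x := by linarith
  have hd := h.decomp (θ * x) n ω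
  obtain ⟨i, hi, hc⟩ := Finset.exists_ne_zero_of_sum_ne_zero hT
  have hc2 : ∑ j ∈ Finset.range (Z i ω), bb m (a * x) (K * x) i (ξ i j ω) ≠ 0 := by
    rw [← cnt_off (G := GG m x)]; omega
  obtain ⟨j, hj, hb⟩ := Finset.exists_ne_zero_of_sum_ne_zero hc2
  unfold bb at hb
  have hb2 : m ^ (i+1) * (a * x) < ξ i j ω := by
    by_contra hcon
    exact hb (if_neg fun hh => hcon hh.1)
  have hJ : a * x ≤ JJ ξ Z m (θ * x) n ω := by
    unfold JJ
    refine le_trans ?_ (Finset.single_le_sum (fun i _ => h.JJ_term_nonneg (θ * x) i ω) hi)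
    rw [inv_mul_eq_div, le_div_iff₀ (by positivity)]
    refine le_trans ?_ (Finset.single_le_sum (fun j _ => highp_nonneg (m ^ (i+1) * (θ * x)) (ξ i j ω)) hj)
    have : m ^ (i+1) * (θ * x) ≤ m ^ (i+1) * (a * x) := by
      gcongr; linarith
    unfold highp
    rw [if_neg (by linarith)]
    linarith
  subst ha
  linarith

theorem lower (h : GW μ ξ Z m) {x δ a K θ : ℝ} (hx : 4 ≤ x) (hδ : 0 < δ)
    (ha : a = 1 + 2 * δ) (haK : a ≤ K) (hθ : 0 < θ) (hθ1 : θ ≤ 1) (n : ℕ) :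
    SS μ ξ m (a * x) n ≤ (μ {ω | x < (Z n ω : ℝ) / m ^ n}).toReal + SS μ ξ m (K * x) n
      + SS μ ξ m (a * x) n * ui μ ξ m x n + (K + 1) * x * SS μ ξ m (a * x) n ^ 2
      + 1 / (δ * x) * ((K + 1) * x * SS μ ξ m (a * x) n * PP μ ξ m (θ * x) n)
      + 1 / (δ * x) ^ 2 * VV μ ξ m (θ * x) n := by
  classical
  have hm := h.mpos
  have hx0 : 0 < x := by linarith
  set B := bb m (a * x) (K * x) with hBdef
  set S := SS μ ξ m (a * x) n
  have hS : 0 ≤ S := h.SS_nonneg _ _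
  have hS' := h.SS_nonneg (K * x) n
  have hV := h.VV_nonneg (θ * x) n
  have hP := h.PP_nonneg (θ * x) n
  have hu := h.ui_nonneg hx0 n
  have hK0 : 0 < K := by linarith
  have hlh : a * x ≤ K * x := by gcongr
  have hss : ss μ ξ B m n ≤ ENNReal.ofReal S := h.ss_le hlh n
  have hpt : ∀ ω, (tot ξ Z (GG m x) B n ω : ENNReal) ≤
      Set.indicator {ω | x < (Z n ω : ℝ) / m ^ n} 1 ω
      + ((tot ξ Z (GG m x) B n ω * (tot ξ Z (GG m x) B n ω - 1) : ℕ) : ENNReal)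
      + ENNReal.ofReal (1 / (δ * x)) * ((tot ξ Z (GG m x) B n ω : ENNReal) * rr Z (ww μ ξ m (θ * x)) n ω)
      + ENNReal.ofReal (1 / (δ * x) ^ 2) * ENNReal.ofReal (MM μ ξ Z m (θ * x) n ω ^ 2) := by
    intro ω
    set T := tot ξ Z (GG m x) B n ω with hTd
    by_cases hT : T = 0
    · rw [hT]; simp
    have hTle : (T : ENNReal) ≤ 1 + ((T * (T - 1) : ℕ) : ENNReal) := by
      have : T ≤ 1 + T * (T - 1) := by
        obtain ⟨k, hk⟩ : ∃ k, T = k + 1 := ⟨T - 1, by omega⟩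
        rw [hk]; simp; nlinarith
      exact_mod_cast this
    by_cases hR : RR μ ξ Z m (θ * x) n ω ≤ δ * x
    swap
    · refine le_trans ?_ (le_self_add.trans' le_add_self)
      rw [← h.RR_rr, mul_left_comm, ← ENNReal.ofReal_mul (by positivity)]
      refine le_mul_of_one_le_right' ?_
      rw [ENNReal.one_le_ofReal, div_mul_eq_mul_div, one_le_div (by positivity)]
      push Not at hR
      linarith
    by_cases hM : - (δ * x) ≤ MM μ ξ Z m (θ * x) n ω
    · have := h.lower_pt hx hδ ha hθ hθ1 n ω hT hR hM
      rw [Set.indicator_of_mem (show ω ∈ {ω | x < (Z n ω : ℝ) / m ^ n} from this)]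
      exact (hTle.trans le_self_add).trans le_self_add
    · push Not at hM
      have h1 : (1 : ENNReal) ≤ ENNReal.ofReal (1 / (δ * x) ^ 2) * ENNReal.ofReal (MM μ ξ Z m (θ * x) n ω ^ 2) := by
        rw [← ENNReal.ofReal_mul (by positivity), ENNReal.one_le_ofReal, div_mul_eq_mul_div,
          one_le_div (by positivity)]
        have : 0 < δ * x := by positivity
        nlinarith
      calc (T : ENNReal) ≤ ((T * (T - 1) : ℕ) : ENNReal) + 1 := by rw [add_comm]; exact hTle
        _ ≤ _ := add_le_add (le_self_add.trans' le_add_self) h1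
  have e0 : (∫⁻ ω, (tot ξ Z (GG m x) B n ω : ENNReal) ∂μ) + ∫⁻ ω, (offs ξ Z (GG m x) B n ω : ENNReal) ∂μ
      = ss μ ξ B m n := by
    rw [← lintegral_add_left (h.totc_meas n), ← h.sumb_mean]
    refine lintegral_congr fun ω => ?_
    rw [← tot_offs (G := GG m x)]; push_cast; rfl
  have hKx : 0 ≤ K * x := by positivity
  have hp := h.pairs (h.GG_prop hx0.le) (h.bb_prop (a * x) hKx) (bb_le (m := m) (a * x) (K * x)) n
  have hr := h.tot_rr (h.GG_prop hx0.le) (h.bb_prop (a * x) hKx) (ww μ ξ m (θ * x)) n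
  rw [h.rho_PP] at hr
  have m1 : Measurable (Set.indicator {ω | x < (Z n ω : ℝ) / m ^ n} (1 : Ω → ENNReal)) :=
    measurable_one.indicator (h.W_set x n)
  have m2 : Measurable fun ω => ((tot ξ Z (GG m x) B n ω * (tot ξ Z (GG m x) B n ω - 1) : ℕ) : ENNReal) :=
    (measurable_of_countable (fun v : ℕ => ((v * (v - 1) : ℕ) : ENNReal))).comp
      ((h.tot_fil n).mono (h.fil_le n) le_rfl)
  have m3 : Measurable fun ω => (tot ξ Z (GG m x) B n ω : ENNReal) * rr Z (ww μ ξ m (θ * x)) n ω :=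
    (h.totc_meas n).mul (h.rr_meas _ n)
  have m4 : Measurable fun ω => ENNReal.ofReal (MM μ ξ Z m (θ * x) n ω ^ 2) :=
    ((h.MM_meas _ n).pow_const 2).ennreal_ofReal
  have m5 : Measurable fun ω => Set.indicator {ω | x < (Z n ω : ℝ) / m ^ n} (1 : Ω → ENNReal) ω
      + ((tot ξ Z (GG m x) B n ω * (tot ξ Z (GG m x) B n ω - 1) : ℕ) : ENNReal) := m1.add m2
  have m6 : Measurable fun ω => Set.indicator {ω | x < (Z n ω : ℝ) / m ^ n} (1 : Ω → ENNReal) ω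
      + ((tot ξ Z (GG m x) B n ω * (tot ξ Z (GG m x) B n ω - 1) : ℕ) : ENNReal)
      + ENNReal.ofReal (1 / (δ * x)) * ((tot ξ Z (GG m x) B n ω : ENNReal) * rr Z (ww μ ξ m (θ * x)) n ω) :=
    m5.add (m3.const_mul _)
  have hE := lintegral_mono hpt (μ := μ)
  rw [lintegral_add_left m6, lintegral_add_left m5, lintegral_add_left m1, lintegral_const_mul _ m3,
    lintegral_const_mul _ m4, lintegral_indicator_one (h.W_set x n)] at hE
  have hoff := h.offs_mean (b := B) hx n
  set P := μ {ω | x < (Z n ω : ℝ) / m ^ n} with hPd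
  have hPt : P ≠ ⊤ := measure_ne_top _ _
  have key : ENNReal.ofReal S ≤ ENNReal.ofReal (P.toReal + SS μ ξ m (K * x) n
      + S * ui μ ξ m x n + (K + 1) * x * S ^ 2
      + 1 / (δ * x) * ((K + 1) * x * S * PP μ ξ m (θ * x) n)
      + 1 / (δ * x) ^ 2 * VV μ ξ m (θ * x) n) := by
    have hP0 : 0 ≤ P.toReal := ENNReal.toReal_nonneg
    have q1 : ENNReal.ofReal S = ss μ ξ B m n + ENNReal.ofReal (SS μ ξ m (K * x) n) := (h.ss_add hlh n).symm
    have a1 : ∫⁻ ω, (offs ξ Z (GG m x) B n ω : ENNReal) ∂μ ≤ ENNReal.ofReal (S * ui μ ξ m x n) := by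
      refine hoff.trans ?_
      rw [ENNReal.ofReal_mul hS]; gcongr
    have hKK : ENNReal.ofReal (K * x) + ENNReal.ofReal x = ENNReal.ofReal ((K + 1) * x) := by
      rw [← ENNReal.ofReal_add hKx hx0.le]; congr 1; ring
    have a2 : ∫⁻ ω, ((tot ξ Z (GG m x) B n ω * (tot ξ Z (GG m x) B n ω - 1) : ℕ) : ENNReal) ∂μ
        ≤ ENNReal.ofReal ((K + 1) * x * S ^ 2) := by
      refine hp.trans ?_
      rw [hKK, ENNReal.ofReal_mul (p := (K + 1) * x) (q := S ^ 2) (by positivity), ENNReal.ofReal_pow hS]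
      gcongr
    have a3 : ENNReal.ofReal (1 / (δ * x)) * ∫⁻ ω, (tot ξ Z (GG m x) B n ω : ENNReal) * rr Z (ww μ ξ m (θ * x)) n ω ∂μ
        ≤ ENNReal.ofReal (1 / (δ * x) * ((K + 1) * x * S * PP μ ξ m (θ * x) n)) := by
      rw [ENNReal.ofReal_mul (by positivity)]
      gcongr
      refine hr.trans ?_
      rw [hKK, ENNReal.ofReal_mul (p := (K + 1) * x * S) (by positivity),
        ENNReal.ofReal_mul (p := (K + 1) * x) (q := S) (by positivity)]
      gcongr
    have a4 : ENNReal.ofReal (1 / (δ * x) ^ 2) * ∫⁻ ω, ENNReal.ofReal (MM μ ξ Z m (θ * x) n ω ^ 2) ∂μ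
        ≤ ENNReal.ofReal (1 / (δ * x) ^ 2 * VV μ ξ m (θ * x) n) := by
      rw [ENNReal.ofReal_mul (by positivity)]
      gcongr
      exact h.MM_sq _ _
    rw [ENNReal.ofReal_add (by positivity) (by positivity), ENNReal.ofReal_add (by positivity) (by positivity),
      ENNReal.ofReal_add (by positivity) (by positivity), ENNReal.ofReal_add (by positivity) (by positivity),
      ENNReal.ofReal_add (by positivity) (by positivity), ENNReal.ofReal_toReal hPt, q1, ← e0]
    calc _ ≤ (P + ENNReal.ofReal ((K + 1) * x * S ^ 2)
          + ENNReal.ofReal (1 / (δ * x) * ((K + 1) * x * S * PP μ ξ m (θ * x) n))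
          + ENNReal.ofReal (1 / (δ * x) ^ 2 * VV μ ξ m (θ * x) n)) + ENNReal.ofReal (S * ui μ ξ m x n)
          + ENNReal.ofReal (SS μ ξ m (K * x) n) := by
          refine add_le_add (add_le_add (hE.trans ?_) a1) le_rfl
          exact add_le_add (add_le_add (add_le_add le_rfl a2) a3) a4
      _ = _ := by ring
  have hP0 : 0 ≤ P.toReal := ENNReal.toReal_nonneg
  exact (ENNReal.ofReal_le_ofReal_iff (by positivity)).1 key

end GW

open MeasureTheory Filter ProbabilityTheory
set_option linter.unusedSectionVars false
set_option linter.unusedVariables false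

namespace GW
variable {Ω : Type*} [mΩ : MeasurableSpace Ω] {μ : Measure Ω} [IsProbabilityMeasure μ]
    {ξ : ℕ → ℕ → Ω → ℕ} {Z : ℕ → Ω → ℕ} {m : ℝ}

theorem Fb_anti : Antitone (Fb μ ξ) := by
  intro s t hst
  unfold Fb
  exact ENNReal.toReal_mono (measure_ne_top _ _) (measure_mono fun ω hω => lt_of_le_of_lt hst hω)

def RVm (μ : Measure Ω) (ξ : ℕ → ℕ → Ω → ℕ) : Prop := ∀ lam > (0 : ℝ),
      Tendsto (fun x => Fb μ ξ (lam * x) / Fb μ ξ x) atTop (nhds (lam⁻¹))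

theorem Fb_pos (hRV : RVm μ ξ) (t : ℝ) : 0 < Fb μ ξ t := by
  rcases (Fb_nonneg (μ := μ) (ξ := ξ) t).lt_or_eq with h | h
  · exact h
  exfalso
  have h1 := hRV 1 one_pos
  have h2 : Tendsto (fun x => Fb μ ξ (1 * x) / Fb μ ξ x) atTop (nhds 0) := by
    refine tendsto_const_nhds.congr' ?_
    filter_upwards [eventually_ge_atTop t] with x hx
    have : Fb μ ξ x = 0 := le_antisymm (h ▸ Fb_anti hx) (Fb_nonneg _)
    rw [this]; simp
  have := tendsto_nhds_unique h1 h2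
  norm_num at this

theorem Fb_ratio (hRV : RVm μ ξ) {c η : ℝ} (hc : 0 < c) (hη : 0 < η) :
    ∃ x0 : ℝ, 1 ≤ x0 ∧ ∀ x ≥ x0, (c⁻¹ - η) * Fb μ ξ x ≤ Fb μ ξ (c * x) ∧
      Fb μ ξ (c * x) ≤ (c⁻¹ + η) * Fb μ ξ x := by
  have h1 := (Metric.tendsto_atTop.1 (hRV c hc)) η hη
  obtain ⟨N, hN⟩ := h1
  refine ⟨max N 1, le_max_right _ _, fun x hx => ?_⟩
  have h2 := hN x (le_trans (le_max_left _ _) hx)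
  rw [Real.dist_eq, abs_lt] at h2
  have hp := Fb_pos hRV x
  constructor
  · rw [← le_div_iff₀ hp]; linarith
  · rw [← div_le_iff₀ hp]; linarith

theorem SS_ratio (h : GW μ ξ Z m) (hRV : RVm μ ξ) {c η : ℝ} (hc : 0 < c) (hη : 0 < η) :
    ∃ x0 : ℝ, 1 ≤ x0 ∧ ∀ x ≥ x0, ∀ n, (c⁻¹ - η) * SS μ ξ m x n ≤ SS μ ξ m (c * x) n ∧
      SS μ ξ m (c * x) n ≤ (c⁻¹ + η) * SS μ ξ m x n := by
  have hm := h.mpos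
  obtain ⟨x0, hx0, H⟩ := Fb_ratio hRV hc hη
  refine ⟨x0, hx0, fun x hx n => ?_⟩
  have key : ∀ i : ℕ, x0 ≤ m ^ (i+1) * x := fun i => by
    have : 1 ≤ m ^ (i+1) := one_le_pow₀ h.one_lt.le
    nlinarith
  unfold SS
  rw [Finset.mul_sum, Finset.mul_sum]
  constructor
  · refine Finset.sum_le_sum fun i _ => ?_
    have := (H _ (key i)).1
    rw [mul_left_comm, mul_left_comm (m ^ (i+1)) c x]
    gcongr
  · refine Finset.sum_le_sum fun i _ => ?_
    have := (H _ (key i)).2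
    rw [mul_left_comm (c⁻¹ + η), mul_left_comm (m ^ (i+1)) c x]
    gcongr

theorem SS_anti (h : GW μ ξ Z m) {x y : ℝ} (hxy : x ≤ y) (n : ℕ) : SS μ ξ m y n ≤ SS μ ξ m x n := by
  have hm := h.mpos
  unfold SS
  gcongr with i hi
  apply Fb_anti
  gcongr

theorem SS_pos (h : GW μ ξ Z m) (hRV : RVm μ ξ) (x : ℝ) {n : ℕ} (hn : 1 ≤ n) : 0 < SS μ ξ m x n := by
  have hm := h.mpos
  unfold SS
  refine Finset.sum_pos (fun i _ => mul_pos (by positivity) (Fb_pos hRV _)) ?_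
  simp; omega

theorem Fb_set (h : GW μ ξ Z m) (t : ℝ) : MeasurableSet {ω | t < (ξ 0 0 ω : ℝ)} :=
  measurableSet_lt measurable_const (h.gmeas 0 0 (fun v => (v : ℝ)))

theorem low_sq_int (h : GW μ ξ Z m) (t : ℝ) : Integrable (fun ω => lowp t (ξ 0 0 ω) ^ 2) μ := by
  refine Integrable.of_bound (C := |t| ^ 2) (h.gmeas 0 0 (fun v => lowp t v ^ 2)).aestronglyMeasurable
    (Eventually.of_forall fun ω => ?_)
  rw [norm_pow, Real.norm_eq_abs]
  exact pow_le_pow_left₀ (abs_nonneg _) (lowp_abs _ _) 2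

theorem V2_le_sq (h : GW μ ξ Z m) (t : ℝ) : V2 μ ξ t ≤ t ^ 2 := by
  unfold V2
  have : ∫ ω, lowp t (ξ 0 0 ω) ^ 2 ∂μ ≤ ∫ ω, t ^ 2 ∂μ := by
    refine integral_mono (h.low_sq_int t) (integrable_const _) fun ω => ?_
    exact sq_le_sq.2 (lowp_abs _ _)
  simpa using this

theorem Fb_integral (h : GW μ ξ Z m) (t c : ℝ) :
    ∫ ω, Set.indicator {ω | t < (ξ 0 0 ω : ℝ)} (fun _ => c) ω ∂μ = c * Fb μ ξ t := by
  rw [integral_indicator_const _ (h.Fb_set t)]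
  unfold Fb Measure.real
  rw [smul_eq_mul, mul_comm]

theorem V2_double (h : GW μ ξ Z m) {y : ℝ} (hy : 0 ≤ y) :
    V2 μ ξ (2 * y) ≤ V2 μ ξ y + 4 * y ^ 2 * Fb μ ξ y := by
  classical
  rw [← h.Fb_integral]
  unfold V2
  rw [← integral_add (h.low_sq_int y) ((integrable_const _).indicator (h.Fb_set y))]
  refine integral_mono (h.low_sq_int _) ((h.low_sq_int y).add ((integrable_const _).indicator (h.Fb_set y)))
    fun ω => ?_
  simp only [Set.indicator_apply, Set.mem_ofPred_eq]
  unfold lowp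
  by_cases h1 : (ξ 0 0 ω : ℝ) ≤ y
  · have h2 : (ξ 0 0 ω : ℝ) ≤ 2 * y := by linarith
    simp [h1, h2, not_lt.2 h1]
  · have h3 := not_le.1 h1
    simp only [h1, h3, if_true, if_false]
    split_ifs with h4
    · have : (0 : ℝ) ≤ ξ 0 0 ω := by positivity
      nlinarith
    · have := sq_nonneg y
      simpa using this

theorem T1_ge (h : GW μ ξ Z m) {t : ℝ} (ht : 0 ≤ t) : t * Fb μ ξ t ≤ T1 μ ξ t := by
  classical
  rw [← h.Fb_integral]
  unfold T1
  refine integral_mono ((integrable_const _).indicator (h.Fb_set t)) (h.high_int t) fun ω => ?_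
  simp only [Set.indicator_apply, Set.mem_ofPred_eq]
  unfold highp
  split_ifs <;> linarith

theorem SS_le_PP (h : GW μ ξ Z m) {y : ℝ} (hy : 0 ≤ y) (n : ℕ) : y * SS μ ξ m y n ≤ PP μ ξ m y n := by
  have hm := h.mpos
  unfold SS PP
  rw [Finset.mul_sum]
  refine Finset.sum_le_sum fun i _ => ?_
  have := h.T1_ge (t := m ^ (i+1) * y) (by positivity)
  calc y * (m ^ i * Fb μ ξ (m ^ (i+1) * y))
      = (m ^ (i+1))⁻¹ * (m ^ (i+1) * y * Fb μ ξ (m ^ (i+1) * y)) * m ^ i := by field_simp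
    _ ≤ _ := by gcongr

theorem V2_bound (h : GW μ ξ Z m) (hRV : RVm μ ξ) :
    ∃ C z0 : ℝ, 0 < C ∧ 1 ≤ z0 ∧ ∀ y ≥ z0, V2 μ ξ y ≤ C * y ^ 2 * Fb μ ξ y := by
  obtain ⟨z0, hz0, H⟩ := Fb_ratio hRV (c := 2) (η := 1/6) (by norm_num) (by norm_num)
  set C := max 12 (1 / Fb μ ξ (2 * z0)) with hC
  have hC12 : 12 ≤ C := le_max_left _ _
  have hF0 := Fb_pos hRV (2 * z0)
  have hCF : 1 ≤ C * Fb μ ξ (2 * z0) := by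
    rw [← div_le_iff₀ hF0]; exact le_max_right _ _
  refine ⟨C, z0, by linarith, hz0, ?_⟩
  have ind : ∀ k : ℕ, ∀ y, z0 ≤ y → y ≤ 2 ^ k * (2 * z0) → V2 μ ξ y ≤ C * y ^ 2 * Fb μ ξ y := by
    intro k
    have base : ∀ y, z0 ≤ y → y ≤ 2 * z0 → V2 μ ξ y ≤ C * y ^ 2 * Fb μ ξ y := by
      intro y h1 h2
      have h3 : Fb μ ξ (2 * z0) ≤ Fb μ ξ y := Fb_anti h2
      have h4 := h.V2_le_sq y
      have h5 : 1 ≤ C * Fb μ ξ y := hCF.trans (by gcongr)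
      nlinarith [sq_nonneg y]
    induction k with
    | zero => intro y h1 h2; exact base y h1 (by simpa using h2)
    | succ k ih =>
      intro y h1 h2
      by_cases h3 : y ≤ 2 * z0
      · exact base y h1 h3
      push Not at h3
      obtain ⟨w, rfl⟩ : ∃ w, y = 2 * w := ⟨y / 2, by ring⟩
      have hw : z0 ≤ w := by linarith
      have h4 := ih w hw (by rw [pow_succ] at h2; linarith)
      have h5 := h.V2_double (y := w) (by linarith)
      have h6 := (H w hw).1
      have hFw := Fb_nonneg (μ := μ) (ξ := ξ) w
      have h7 : Fb μ ξ w ≤ 3 * Fb μ ξ (2 * w) := by linarith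
      have hF2 := Fb_nonneg (μ := μ) (ξ := ξ) (2 * w)
      calc V2 μ ξ (2 * w) ≤ (C + 4) * w ^ 2 * Fb μ ξ w := by linarith
        _ ≤ (C + 4) * w ^ 2 * (3 * Fb μ ξ (2 * w)) := by gcongr
        _ = (3 * (C + 4)) * (w ^ 2 * Fb μ ξ (2 * w)) := by ring
        _ ≤ (4 * C) * (w ^ 2 * Fb μ ξ (2 * w)) :=
          mul_le_mul_of_nonneg_right (by linarith) (by positivity)
        _ = _ := by ring
  intro y hy
  obtain ⟨k, hk⟩ := pow_unbounded_of_one_lt (y / (2 * z0)) (one_lt_two (α := ℝ))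
  refine ind k y hy ?_
  rw [div_lt_iff₀ (by linarith)] at hk
  exact hk.le

theorem VV_bound (h : GW μ ξ Z m) (hRV : RVm μ ξ) :
    ∃ C z0 : ℝ, 0 < C ∧ 1 ≤ z0 ∧ ∀ y ≥ z0, ∀ n, VV μ ξ m y n ≤ C * y ^ 2 * SS μ ξ m y n := by
  have hm := h.mpos
  obtain ⟨C, z0, hC, hz0, H⟩ := h.V2_bound hRV
  refine ⟨C, z0, hC, hz0, fun y hy n => ?_⟩
  unfold VV SS
  rw [Finset.mul_sum]
  refine Finset.sum_le_sum fun i _ => ?_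
  have h1 : 1 ≤ m ^ (i+1) := one_le_pow₀ h.one_lt.le
  have := H (m ^ (i+1) * y) (by nlinarith)
  calc _ ≤ ((m ^ (i+1))⁻¹) ^ 2 * (C * (m ^ (i+1) * y) ^ 2 * Fb μ ξ (m ^ (i+1) * y)) * m ^ i := by gcongr
    _ = _ := by field_simp

theorem high_sum (h : GW μ ξ Z m) {y : ℝ} (hy : 1 ≤ y) (n v : ℕ) :
    ∑ i ∈ Finset.range n, highp (m ^ (i+1) * y) v ≤ highp y v * Real.log v / Real.log m := by
  classical
  have hm := h.mpos
  have hlm : 0 < Real.log m := Real.log_pos h.one_lt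
  have hge : ∀ i : ℕ, y ≤ m ^ (i+1) * y := fun i => by
    have h1 : 1 ≤ m ^ (i+1) := one_le_pow₀ h.one_lt.le
    nlinarith
  by_cases hv : (v : ℝ) ≤ y
  · have e : ∀ i : ℕ, highp (m ^ (i+1) * y) v = 0 := fun i => if_pos (hv.trans (hge i))
    have e2 : highp y v = 0 := if_pos hv
    simp [e, e2]
  · have hv' := not_le.1 hv
    have hv1 : (1 : ℝ) < v := by linarith
    have e2 : highp y v = v := if_neg hv
    have hL : 0 ≤ Real.log v / Real.log m := div_nonneg (Real.log_nonneg hv1.le) hlm.le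
    have e3 : ∑ i ∈ Finset.range n, highp (m ^ (i+1) * y) v
        ≤ ∑ i ∈ Finset.range n, (if i < ⌊Real.log v / Real.log m⌋₊ then (v : ℝ) else 0) := by
      refine Finset.sum_le_sum fun i _ => ?_
      unfold highp
      split_ifs with h1 h2 h2
      · positivity
      · rfl
      · rfl
      · exfalso
        apply h2
        rw [Nat.lt_iff_add_one_le, Nat.le_floor_iff hL, le_div_iff₀ hlm]
        have h3 : m ^ (i+1) ≤ v := by
          have := not_le.1 h1
          have : m ^ (i+1) ≤ m ^ (i+1) * y := le_mul_of_one_le_right (by positivity) hy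
          linarith
        have := Real.log_le_log (by positivity) h3
        rwa [Real.log_pow] at this
    refine e3.trans ?_
    rw [← Finset.sum_filter, Finset.sum_const, e2, nsmul_eq_mul, mul_div_assoc, mul_comm]
    gcongr
    refine le_trans ?_ (Nat.floor_le hL)
    have : (Finset.filter (fun i => i < ⌊Real.log v / Real.log m⌋₊) (Finset.range n)).card
        ≤ (Finset.range ⌊Real.log v / Real.log m⌋₊).card :=
      Finset.card_le_card fun i hi => by simp at hi ⊢; exact hi.2
    simp only [Finset.card_range] at this
    exact_mod_cast this

theorem PP_small (h : GW μ ξ Z m)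
    (hml : Integrable (fun ω => (ξ 0 0 ω : ℝ) * Real.log (ξ 0 0 ω : ℝ)) μ) {η : ℝ} (hη : 0 < η) :
    ∃ y0 : ℝ, 1 ≤ y0 ∧ ∀ y ≥ y0, ∀ n, PP μ ξ m y n ≤ η := by
  have hm := h.mpos
  have hlm : 0 < Real.log m := Real.log_pos h.one_lt
  have hlog : ∀ v : ℕ, 0 ≤ Real.log (v : ℝ) := fun v => Real.log_natCast_nonneg v
  have hbd : ∀ (y : ℝ) (v : ℕ), ‖highp y v * Real.log v‖ ≤ v * Real.log v := fun y v => by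
    rw [Real.norm_of_nonneg (mul_nonneg (highp_nonneg _ _) (hlog v))]
    have := highp_le y v
    have := hlog v
    gcongr
  have hms : ∀ y : ℝ, AEStronglyMeasurable (fun ω => highp y (ξ 0 0 ω) * Real.log (ξ 0 0 ω : ℝ)) μ := fun y =>
    (h.gmeas 0 0 (fun v => highp y v * Real.log (v : ℝ))).aestronglyMeasurable
  have hT : Tendsto (fun y : ℝ => ∫ ω, highp y (ξ 0 0 ω) * Real.log (ξ 0 0 ω : ℝ) ∂μ) atTop
      (nhds (∫ ω, (0 : ℝ) ∂μ)) := by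
    refine tendsto_integral_filter_of_dominated_convergence _ (Eventually.of_forall hms)
      (Eventually.of_forall fun y => Eventually.of_forall fun ω => hbd y _) hml
      (Eventually.of_forall fun ω => ?_)
    refine tendsto_const_nhds.congr' ?_
    filter_upwards [eventually_ge_atTop (ξ 0 0 ω : ℝ)] with y hy
    unfold highp
    rw [if_pos hy, zero_mul]
  rw [integral_zero] at hT
  obtain ⟨y0, H⟩ := eventually_atTop.1 (hT.eventually (ge_mem_nhds (show (0:ℝ) < η * m * Real.log m by positivity)))
  refine ⟨max y0 1, le_max_right _ _, fun y hy n => ?_⟩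
  have hy1 : 1 ≤ y := le_trans (le_max_right _ _) hy
  have h1 := H y (le_trans (le_max_left _ _) hy)
  have e : PP μ ξ m y n = m⁻¹ * ∫ ω, ∑ i ∈ Finset.range n, highp (m ^ (i+1) * y) (ξ 0 0 ω) ∂μ := by
    rw [integral_finsetSum _ fun i _ => h.high_int _, Finset.mul_sum]
    unfold PP
    refine Finset.sum_congr rfl fun i _ => ?_
    rw [show (∫ ω, highp (m ^ (i+1) * y) (ξ 0 0 ω) ∂μ) = T1 μ ξ (m ^ (i+1) * y) from rfl, pow_succ]
    field_simp
  have hI : Integrable (fun ω => highp y (ξ 0 0 ω) * Real.log (ξ 0 0 ω : ℝ)) μ :=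
    hml.mono' (hms y) (Eventually.of_forall fun ω => hbd y _)
  have h2 : ∫ ω, ∑ i ∈ Finset.range n, highp (m ^ (i+1) * y) (ξ 0 0 ω) ∂μ ≤
      ∫ ω, highp y (ξ 0 0 ω) * Real.log (ξ 0 0 ω : ℝ) / Real.log m ∂μ :=
    integral_mono (integrable_finsetSum _ fun i _ => h.high_int _) (hI.div_const _)
      fun ω => h.high_sum hy1 n _
  rw [integral_div, le_div_iff₀ hlm] at h2
  rw [e, inv_mul_le_iff₀ hm]
  have h3 := h2.trans h1
  have : η * m * Real.log m = (m * η) * Real.log m := by ring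
  rw [this] at h3
  exact le_of_mul_le_mul_right h3 hlm

theorem int_ratio (h : GW μ ξ Z m) (hRV : RVm μ ξ) {η : ℝ} (hη : 0 < η) :
    ∃ x0 : ℝ, 1 ≤ x0 ∧ ∀ y ≥ x0,
      |(∫ u in y..(m * y), Fb μ ξ u) - m * Real.log m * (y * Fb μ ξ (m * y))| ≤ η * (y * Fb μ ξ (m * y)) := by
  have hm := h.mpos
  have h1m := h.one_lt
  have hmeas : Measurable (Fb μ ξ) := Fb_anti.measurable
  have t1 : Tendsto (fun y : ℝ => ∫ t in (1:ℝ)..m, Fb μ ξ (t * y) / Fb μ ξ y) atTop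
      (nhds (∫ t in (1:ℝ)..m, t⁻¹)) := by
    refine intervalIntegral.tendsto_integral_filter_of_dominated_convergence (fun _ => 1) ?_ ?_ ?_ ?_
    · exact Eventually.of_forall fun y =>
        ((hmeas.comp (measurable_id.mul_const y)).div_const _).aestronglyMeasurable
    · filter_upwards [eventually_ge_atTop (1:ℝ)] with y hy
      refine Eventually.of_forall fun t ht => ?_
      rw [Set.uIoc_of_le h1m.le] at ht
      rw [Real.norm_of_nonneg (div_nonneg (Fb_nonneg _) (Fb_nonneg _)), div_le_one (Fb_pos hRV _)]
      apply Fb_anti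
      nlinarith [ht.1]
    · exact intervalIntegrable_const
    · refine Eventually.of_forall fun t ht => ?_
      rw [Set.uIoc_of_le h1m.le] at ht
      exact hRV t (by linarith [ht.1])
  rw [integral_inv_of_pos one_pos hm, div_one] at t1
  have t2 := (hRV m hm).inv₀ (by positivity)
  have t3 := t1.mul t2
  rw [inv_inv] at t3
  obtain ⟨N, hN⟩ := Metric.tendsto_atTop.1 t3 η hη
  refine ⟨max N 1, le_max_right _ _, fun y hy => ?_⟩
  have h2 := hN y (le_trans (le_max_left _ _) hy)
  have hy0 : 0 < y := lt_of_lt_of_le one_pos (le_trans (le_max_right _ _) hy)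
  rw [Real.dist_eq] at h2
  have p1 := Fb_pos hRV y
  have p2 := Fb_pos hRV (m * y)
  have e1 : ∫ u in y..(m * y), Fb μ ξ u = y * ∫ t in (1:ℝ)..m, Fb μ ξ (t * y) := by
    rw [intervalIntegral.mul_integral_comp_mul_right]; simp
  rw [intervalIntegral.integral_div, inv_div, div_mul_div_comm, mul_comm (Fb μ ξ y) (Fb μ ξ (m * y)),
    mul_div_mul_right _ _ p1.ne'] at h2
  rw [e1]
  set I := ∫ t in (1:ℝ)..m, Fb μ ξ (t * y)
  have e2 : y * I - m * Real.log m * (y * Fb μ ξ (m * y))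
      = (I / Fb μ ξ (m * y) - Real.log m * m) * (y * Fb μ ξ (m * y)) := by
    have e3 : I = I / Fb μ ξ (m * y) * Fb μ ξ (m * y) := (div_mul_cancel₀ _ p2.ne').symm
    nth_rewrite 1 [e3]; ring
  rw [e2, abs_mul, abs_of_pos (show 0 < y * Fb μ ξ (m * y) by positivity)]
  gcongr

theorem int_sum (h : GW μ ξ Z m) (hRV : RVm μ ξ) {η : ℝ} (hη : 0 < η) :
    ∃ x0 : ℝ, 1 ≤ x0 ∧ ∀ x ≥ x0, ∀ n,
      |(∫ u in x..(m ^ n * x), Fb μ ξ u) - m * Real.log m * (x * SS μ ξ m x n)| ≤ η * (x * SS μ ξ m x n) := by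
  have hm := h.mpos
  obtain ⟨x0, hx0, H⟩ := h.int_ratio hRV hη
  refine ⟨x0, hx0, fun x hx n => ?_⟩
  have e1 : ∫ u in x..(m ^ n * x), Fb μ ξ u = ∑ i ∈ Finset.range n, ∫ u in (m ^ i * x)..(m ^ (i+1) * x), Fb μ ξ u := by
    rw [intervalIntegral.sum_integral_adjacent_intervals (a := fun i => m ^ i * x)]
    · simp
    · intro i _
      exact Fb_anti.intervalIntegrable
  have e2 : x * SS μ ξ m x n = ∑ i ∈ Finset.range n, m ^ i * x * Fb μ ξ (m * (m ^ i * x)) := by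
    unfold SS
    rw [Finset.mul_sum]
    refine Finset.sum_congr rfl fun i _ => ?_
    rw [pow_succ, mul_comm (m ^ i) m, mul_assoc m]; ring
  rw [e1, e2, Finset.mul_sum, Finset.mul_sum, ← Finset.sum_sub_distrib]
  refine (Finset.abs_sum_le_sum_abs _ _).trans (Finset.sum_le_sum fun i _ => ?_)
  have h1 : 1 ≤ m ^ i := one_le_pow₀ h.one_lt.le
  have := H (m ^ i * x) (by nlinarith)
  rw [show m ^ (i+1) * x = m * (m ^ i * x) by ring]
  exact this

end GW

open MeasureTheory Filter ProbabilityTheory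
set_option linter.unusedSectionVars false
set_option linter.unusedVariables false

namespace GW
variable {Ω : Type*} [mΩ : MeasurableSpace Ω] {μ : Measure Ω} [IsProbabilityMeasure μ]
    {ξ : ℕ → ℕ → Ω → ℕ} {Z : ℕ → Ω → ℕ} {m : ℝ}

theorem second (h : GW μ ξ Z m) (hRV : RVm μ ξ) {ε : ℝ} (hε : 0 < ε) :
    ∃ x0 : ℝ, ∀ x ≥ x0, ∀ n : ℕ, 1 ≤ n →
      |SS μ ξ m x n / (1 / (m * Real.log m) * x⁻¹ * ∫ u in x..(m ^ n * x), Fb μ ξ u) - 1| < ε := by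
  have hm := h.mpos
  have hlm : 0 < Real.log m := Real.log_pos h.one_lt
  set c := m * Real.log m with hc
  have hc0 : 0 < c := by positivity
  set η := min (1/2) (ε/3) with hη
  have hη0 : 0 < η := by positivity
  have hη1 : η ≤ 1/2 := min_le_left _ _
  have hη2 : η ≤ ε/3 := min_le_right _ _
  obtain ⟨x0, hx0, H⟩ := h.int_sum hRV (η := η * c) (by positivity)
  refine ⟨x0, fun x hx n hn => ?_⟩
  have h1 := H x hx n
  have hx1 : 0 < x := by linarith
  have hS := h.SS_pos hRV x hn
  set S := SS μ ξ m x n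
  set I := ∫ u in x..(m ^ n * x), Fb μ ξ u
  rw [abs_le] at h1
  have hA : 0 < c * (x * S) := by positivity
  have hI : (1/2) * (c * (x * S)) ≤ I := by nlinarith
  have hI0 : 0 < I := by linarith
  have e : S / (1 / c * x⁻¹ * I) - 1 = (c * (x * S) - I) / I := by
    field_simp
  rw [e, abs_div, abs_of_pos hI0, div_lt_iff₀ hI0]
  have : |c * (x * S) - I| ≤ η * (c * (x * S)) := by
    rw [abs_le]; constructor <;> linarith [h1.1, h1.2]
  refine lt_of_le_of_lt this ?_
  calc η * (c * (x * S)) ≤ ε / 3 * (2 * I) := by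
        apply mul_le_mul hη2 (by linarith) hA.le (by positivity)
    _ < ε * I := by nlinarith [mul_pos hε hI0]

set_option maxHeartbeats 1600000 in
theorem first (h : GW μ ξ Z m) (hRV : RVm μ ξ)
    (hml : Integrable (fun ω => (ξ 0 0 ω : ℝ) * Real.log (ξ 0 0 ω : ℝ)) μ) {ε : ℝ} (hε : 0 < ε) :
    ∃ x0 : ℝ, ∀ x ≥ x0, ∀ n : ℕ, 1 ≤ n →
      |(μ {ω | x < (Z n ω : ℝ) / m ^ n}).toReal / SS μ ξ m x n - 1| < ε := by
  have hm := h.mpos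
  obtain ⟨C, z0, hC, hz0, HV⟩ := h.VV_bound hRV
  set δ := min (1/2) (ε/20) with hδd
  have hδ : 0 < δ := by positivity
  have hδ1 : δ ≤ 1/2 := min_le_left _ _
  have hδ2 : δ ≤ ε/20 := min_le_right _ _
  set κ := 1 - δ with hκ
  have hκ0 : 1/2 ≤ κ := by linarith
  set a := 1 + 2 * δ with ha
  have ha0 : 0 < a := by linarith
  have k1 : 1 ≤ (1 + ε / 10) * κ := by
    have : (1 + 2 * δ) * κ ≤ (1 + ε / 10) * κ := by gcongr; linarith
    have : 1 ≤ (1 + 2 * δ) * κ := by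
      have : 0 ≤ δ * (1 - 2 * δ) := mul_nonneg hδ.le (by linarith)
      rw [hκ]; linarith
    linarith
  have k2 : (1 - ε / 10) * a ≤ 1 := by
    have : (1 - ε / 10) * a ≤ (1 - 2 * δ) * a := by gcongr; linarith
    have : (1 - 2 * δ) * a ≤ 1 := by
      have : 0 ≤ δ ^ 2 := sq_nonneg _
      rw [ha]; linarith
    linarith
  set θ := min (1/2) (ε * δ ^ 2 / (80 * C)) with hθd
  have hθ : 0 < θ := by positivity
  have hθ1 : θ ≤ 1/2 := min_le_left _ _
  have hθ2 : 8 * C * θ / δ ^ 2 ≤ ε / 10 := by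
    have : θ ≤ ε * δ ^ 2 / (80 * C) := min_le_right _ _
    rw [le_div_iff₀ (by positivity)] at this
    rw [div_le_iff₀ (by positivity)]
    linarith
  set K := max 2 (20 / ε) with hKd
  have hK2 : 2 ≤ K := le_max_left _ _
  have hK0 : 0 < K := by linarith
  have hK3 : 2 * K⁻¹ ≤ ε / 10 := by
    have : 20 / ε ≤ K := le_max_right _ _
    rw [div_le_iff₀ hε] at this
    rw [← div_eq_mul_inv, div_le_iff₀ hK0]; linarith
  set D := (2 / θ) * (2 * C + 2) + 8 / θ ^ 2 + (2 * C + 2) + (K + 1) + (K + 1) / δ with hD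
  have hD0 : 0 < D := by positivity
  obtain ⟨y0, hy0, HP⟩ := h.PP_small hml (η := ε / (10 * D)) (by positivity)
  obtain ⟨x1, hx1, H1⟩ := h.SS_ratio hRV (c := κ) (η := ε/10) (by linarith) (by positivity)
  obtain ⟨x2, hx2, H2⟩ := h.SS_ratio hRV (c := θ) (η := θ⁻¹) hθ (by positivity)
  obtain ⟨x3, hx3, H3⟩ := h.SS_ratio hRV (c := a) (η := ε/10) ha0 (by positivity)
  obtain ⟨x4, hx4, H4⟩ := h.SS_ratio hRV (c := K) (η := K⁻¹) hK0 (by positivity)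
  refine ⟨4 + 2 / δ + z0 / θ + y0 / θ + z0 + y0 + x1 + x2 + x3 + x4, fun x hx n hn => ?_⟩
  have q1 : 0 < 2 / δ := by positivity
  have q2 : 0 < z0 / θ := by positivity
  have q3 : 0 < y0 / θ := by positivity
  have hx0 : 4 ≤ x := by linarith
  have hxp : 0 < x := by linarith
  have hδx : 2 ≤ δ * x := by
    have : 2 / δ ≤ x := by linarith
    rw [div_le_iff₀ hδ] at this; linarith
  have hzθ : z0 ≤ θ * x := by
    have : z0 / θ ≤ x := by linarith
    rw [div_le_iff₀ hθ] at this; linarith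
  have hyθ : y0 ≤ θ * x := by
    have : y0 / θ ≤ x := by linarith
    rw [div_le_iff₀ hθ] at this; linarith
  have u := h.upper (κ := κ) (θ := θ) hx0 hδ hδx hκ hθ (by linarith) n
  have l := h.lower (a := a) (K := K) (θ := θ) hx0 hδ ha (by linarith) hθ (by linarith) n
  have s1 := (H1 x (by linarith) n).2
  have s2 := (H2 x (by linarith) n).2
  have s3 := (H3 x (by linarith) n).1
  have s4 := (H4 x (by linarith) n).2
  have v1 := HV x (by linarith) n
  have v2 := HV (θ * x) hzθ n
  have p1 := HP x (by linarith) n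
  have p2 := HP (θ * x) hyθ n
  have p3 := h.SS_le_PP hxp.le n
  have s5 := h.SS_anti (x := x) (y := a * x) (le_mul_of_one_le_left hxp.le (by linarith)) n
  have hS := h.SS_pos hRV x hn
  have hSθ := h.SS_nonneg (θ * x) n
  have hSa := h.SS_nonneg (a * x) n
  have hPθ := h.PP_nonneg (θ * x) n
  have hu0 := h.ui_nonneg hxp n
  set S := SS μ ξ m x n
  set P := (μ {ω | x < (Z n ω : ℝ) / m ^ n}).toReal
  set p := ε / (10 * D) with hp
  have hp0 : 0 < p := by positivity
  have hpD : p * D = ε / 10 := by rw [hp]; field_simp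
  have hxS : x * S ≤ p := p3.trans p1
  have hui : ui μ ξ m x n ≤ (2 * C + 2) * p := by
    unfold ui
    have : 2 * VV μ ξ m x n / x ≤ 2 * C * (x * S) := by
      rw [div_le_iff₀ hxp]; linarith
    have : 2 * C * (x * S) ≤ 2 * C * p := by gcongr
    linarith
  have hs2 : SS μ ξ m (θ * x) n ≤ 2 / θ * S := by
    have : 2 / θ * S = (θ⁻¹ + θ⁻¹) * S := by ring
    linarith
  have hv2 : VV μ ξ m (θ * x) n ≤ 2 * C * θ * x ^ 2 * S := by
    calc _ ≤ C * (θ * x) ^ 2 * SS μ ξ m (θ * x) n := v2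
      _ ≤ C * (θ * x) ^ 2 * (2 / θ * S) := by gcongr
      _ = _ := by field_simp
  have hCD : p * ((2 / θ) * (2 * C + 2)) + p * (8 / θ ^ 2) + p * (2 * C + 2) + p * (K + 1) + p * ((K + 1) / δ)
      = ε / 10 := by rw [← hpD, hD]; ring
  have n1 : 0 < p * ((2 / θ) * (2 * C + 2)) := by positivity
  have n2 : 0 < p * (8 / θ ^ 2) := by positivity
  have n3 : 0 < p * (2 * C + 2) := by positivity
  have n4 : 0 < p * (K + 1) := by positivity
  have n5 : 0 < p * ((K + 1) / δ) := by positivity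
  have hP0 : 0 ≤ P := ENNReal.toReal_nonneg
  -- upper
  have U : P ≤ (1 + ε / 2) * S := by
    have t2 : SS μ ξ m (θ * x) n * ui μ ξ m x n ≤ p * ((2 / θ) * (2 * C + 2)) * S := by
      calc _ ≤ (2 / θ * S) * ((2 * C + 2) * p) := by gcongr
        _ = _ := by ring
    have t3 : 4 / (δ * x) ^ 2 * VV μ ξ m (θ * x) n ≤ ε / 10 * S := by
      calc _ ≤ 4 / (δ * x) ^ 2 * (2 * C * θ * x ^ 2 * S) := by gcongr
        _ = 8 * C * θ / δ ^ 2 * S := by field_simp; ring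
        _ ≤ _ := by gcongr
    have t4 : 2 * x * SS μ ξ m (θ * x) n ^ 2 ≤ p * (8 / θ ^ 2) * S := by
      calc _ ≤ 2 * x * (2 / θ * S) ^ 2 := by gcongr
        _ = 8 / θ ^ 2 * (x * S) * S := by field_simp; ring
        _ ≤ 8 / θ ^ 2 * p * S := by gcongr
        _ = _ := by ring
    have t1 : SS μ ξ m (κ * x) n ≤ (1 + ε / 10 + ε / 10) * S := by
      refine s1.trans ?_
      gcongr
      rw [inv_le_iff_one_le_mul₀ (by linarith)]
      linarith
    have t5 : (p * ((2 / θ) * (2 * C + 2)) + p * (8 / θ ^ 2)) * S ≤ ε / 10 * S := by gcongr; linarith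
    have := mul_pos hε hS
    linarith
  -- lower
  have Lo : (1 - ε * (7 / 10)) * S ≤ P := by
    have t1 : (1 - ε / 10 - ε / 10) * S ≤ SS μ ξ m (a * x) n := by
      refine le_trans ?_ s3
      gcongr
      rw [← one_div, le_div_iff₀ ha0]
      exact k2
    have t2 : SS μ ξ m (K * x) n ≤ ε / 10 * S := by
      refine s4.trans ?_
      gcongr; linarith
    have t3 : SS μ ξ m (a * x) n * ui μ ξ m x n ≤ p * (2 * C + 2) * S := by
      calc _ ≤ S * ((2 * C + 2) * p) := by gcongr
        _ = _ := by ring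
    have t4 : (K + 1) * x * SS μ ξ m (a * x) n ^ 2 ≤ p * (K + 1) * S := by
      calc _ ≤ (K + 1) * x * S ^ 2 := by gcongr
        _ = (K + 1) * (x * S) * S := by ring
        _ ≤ (K + 1) * p * S := by gcongr
        _ = _ := by ring
    have t5 : 1 / (δ * x) * ((K + 1) * x * SS μ ξ m (a * x) n * PP μ ξ m (θ * x) n) ≤ p * ((K + 1) / δ) * S := by
      calc _ ≤ 1 / (δ * x) * ((K + 1) * x * S * p) := by gcongr
        _ = _ := by field_simp
    have t6 : 1 / (δ * x) ^ 2 * VV μ ξ m (θ * x) n ≤ ε / 10 * S := by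
      calc _ ≤ 1 / (δ * x) ^ 2 * (2 * C * θ * x ^ 2 * S) := by gcongr
        _ = 8 * C * θ / δ ^ 2 * (S / 4) := by field_simp; ring
        _ ≤ ε / 10 * (S / 4) := by gcongr
        _ ≤ _ := by have := mul_pos hε hS; linarith
    have t7 : (p * (2 * C + 2) + p * (K + 1) + p * ((K + 1) / δ)) * S ≤ ε / 10 * S := by gcongr; linarith
    have := mul_pos hε hS
    linarith
  rw [abs_lt]
  constructor
  · rw [lt_sub_iff_add_lt, lt_div_iff₀ hS]; have := mul_pos hε hS; linarith
  · rw [sub_lt_iff_lt_add, div_lt_iff₀ hS]; have := mul_pos hε hS; linarith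

end GW

theorem gw_regvar_index_neg_one_uniform
    {Ω : Type*} [MeasurableSpace Ω] (μ : Measure Ω) [IsProbabilityMeasure μ]
    (ξ : ℕ → ℕ → Ω → ℕ)
    (hmeas : ∀ n i, Measurable (ξ n i))
    (hindep : iIndepFun
      (fun p : ℕ × ℕ => ξ p.1 p.2) μ)
    (hident : ∀ n i, Measure.map (ξ n i) μ = Measure.map (ξ 0 0) μ)
    (hint : Integrable (fun ω => (ξ 0 0 ω : ℝ)) μ)
    (m : ℝ) (hm : m = ∫ ω, (ξ 0 0 ω : ℝ) ∂μ) (hm1 : 1 < m)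
    (Z : ℕ → Ω → ℕ)
    (hZ0 : ∀ ω, Z 0 ω = 1)
    (hZrec : ∀ n ω, Z (n + 1) ω = ∑ i ∈ Finset.range (Z n ω), ξ n i ω)
    (W : ℕ → Ω → ℝ) (hW : ∀ n ω, W n ω = (Z n ω : ℝ) / m ^ n)
    (Fbar : ℝ → ℝ) (hFbar : ∀ x, Fbar x = (μ {ω | x < (ξ 0 0 ω : ℝ)}).toReal)
    -- `E(ξ log ξ) < ∞`
    (hmomlog : Integrable (fun ω => (ξ 0 0 ω : ℝ) * Real.log (ξ 0 0 ω : ℝ)) μ)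
    -- `F̄` is regularly varying with index `-1`
    (hRV : ∀ lam > (0 : ℝ),
      Tendsto (fun x => Fbar (lam * x) / Fbar x) atTop (nhds (lam ^ (-1 : ℝ)))) :
    ∀ ε > (0 : ℝ), ∃ x₀ : ℝ, ∀ x ≥ x₀, ∀ n : ℕ, 1 ≤ n →
      |(μ {ω | x < W n ω}).toReal /
          (∑ i ∈ Finset.range n, m ^ i * Fbar (m ^ (i + 1) * x)) - 1| < ε ∧
      |(∑ i ∈ Finset.range n, m ^ i * Fbar (m ^ (i + 1) * x)) /
          (1 / (m * Real.log m) * x⁻¹ * ∫ u in x..(m ^ n * x), Fbar u) - 1| < ε := by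
  intro ε hε
  have hG : GW μ ξ Z m := ⟨hmeas, hindep, hident, hint, hm, hm1, hZ0, hZrec⟩
  have hF : Fbar = GW.Fb μ ξ := funext hFbar
  subst hF
  have hWW : W = fun n ω => (Z n ω : ℝ) / m ^ n := funext fun n => funext fun ω => hW n ω
  subst hWW
  have hRV' : GW.RVm μ ξ := fun lam hl => by
    have := hRV lam hl
    rwa [Real.rpow_neg_one] at this
  obtain ⟨x1, H1⟩ := hG.first hRV' hmomlog hε
  obtain ⟨x2, H2⟩ := hG.second hRV' hε
  exact ⟨max x1 x2, fun x hx n hn => ⟨H1 x (le_trans (le_max_left _ _) hx) n hn,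
    H2 x (le_trans (le_max_right _ _) hx) n hn⟩⟩
end

section
/- Assume σ² := Var(ξ) < ∞. Then, for every A > 0, P{W_n > x} ≥ (1 − σ²/((m²−m)A²) + o(1))·Σ_{i=0}^{n-1} m^i·F̄(m^{i+1}x + A·√(m^{i+1}x)) as x → ∞, uniformly in n ≥ 1. In particular, if in addition F is √x-insensitive, then P{W_n > x} ≥ (1 + o(1))·Σ_{i=0}^{n-1} m^i·F̄(m^{i+1}x) as x → ∞, uniformly in n ≥ 1. -/
set_option linter.unusedSectionVars false

open MeasureTheory Filter ProbabilityTheory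

structure GWData {Ω : Type*} [MeasurableSpace Ω] (μ : Measure Ω)
    (ξ : ℕ → ℕ → Ω → ℕ) (m σ2 : ℝ) (Z : ℕ → Ω → ℕ) : Prop where
  hmeas : ∀ n i, Measurable (ξ n i)
  hindep : iIndepFun (fun p : ℕ × ℕ => ξ p.1 p.2) μ
  hident : ∀ n i, Measure.map (ξ n i) μ = Measure.map (ξ 0 0) μ
  hint : Integrable (fun ω => (ξ 0 0 ω : ℝ)) μ
  hm : m = ∫ ω, (ξ 0 0 ω : ℝ) ∂μ
  hm1 : 1 < m
  hZ0 : ∀ ω, Z 0 ω = 1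
  hZrec : ∀ n ω, Z (n + 1) ω = ∑ i ∈ Finset.range (Z n ω), ξ n i ω
  hmom2 : Integrable (fun ω => ((ξ 0 0 ω : ℝ)) ^ 2) μ
  hσ2 : σ2 = ∫ ω, ((ξ 0 0 ω : ℝ) - m) ^ 2 ∂μ

/-- sigma-algebra generated by a set of offspring variables -/
def sigS {Ω : Type*} (ξ : ℕ → ℕ → Ω → ℕ) (S : Set (ℕ × ℕ)) : MeasurableSpace Ω :=
  ⨆ p ∈ S, MeasurableSpace.comap (ξ p.1 p.2) inferInstance

/-- past -/
def sigG {Ω : Type*} (ξ : ℕ → ℕ → Ω → ℕ) (n : ℕ) : MeasurableSpace Ω :=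
  sigS ξ {p | p.1 < n}

/-- present -/
def sigH {Ω : Type*} (ξ : ℕ → ℕ → Ω → ℕ) (n : ℕ) : MeasurableSpace Ω :=
  sigS ξ {p | p.1 = n}

lemma meas_aux {Ω β ι : Type*} [MeasurableSpace Ω] [MeasurableSpace β] [MeasurableSpace ι]
    [Countable ι] [MeasurableSingletonClass ι]
    (N : Ω → ι) (hN : Measurable N) (f : ι → Ω → β) (hf : ∀ k, Measurable (f k)) :
    Measurable (fun ω => f (N ω) ω) := by
  have : Measurable (fun p : ι × Ω => f p.1 p.2) :=
    measurable_from_prod_countable_right (fun x => hf x)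
  exact this.comp (hN.prodMk measurable_id)

lemma meas_sigS {Ω : Type*} (ξ : ℕ → ℕ → Ω → ℕ) (S : Set (ℕ × ℕ)) (p : ℕ × ℕ) (hp : p ∈ S) :
    Measurable[sigS ξ S] (ξ p.1 p.2) := by
  have h1 : MeasurableSpace.comap (ξ p.1 p.2) inferInstance ≤ sigS ξ S :=
    le_iSup₂_of_le (f := fun (p : ℕ × ℕ) (_ : p ∈ S) =>
      MeasurableSpace.comap (ξ p.1 p.2) inferInstance) p hp le_rfl
  exact measurable_iff_comap_le.2 h1

lemma meas_sigG {Ω : Type*} (ξ : ℕ → ℕ → Ω → ℕ) (n k j : ℕ) (h : k < n) :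
    Measurable[sigG ξ n] (ξ k j) := meas_sigS ξ _ (k, j) h

lemma meas_sigH {Ω : Type*} (ξ : ℕ → ℕ → Ω → ℕ) (n j : ℕ) :
    Measurable[sigH ξ n] (ξ n j) := meas_sigS ξ _ (n, j) rfl

lemma sigG_mono {Ω : Type*} (ξ : ℕ → ℕ → Ω → ℕ) {k n : ℕ} (h : k ≤ n) :
    sigG ξ k ≤ sigG ξ n := by
  refine iSup₂_le fun p hp => ?_
  exact measurable_iff_comap_le.1 (meas_sigG ξ n p.1 p.2 (lt_of_lt_of_le hp h))

namespace GWData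

variable {Ω : Type*} [mΩ : MeasurableSpace Ω] {μ : Measure Ω} [IsProbabilityMeasure μ]
    {ξ : ℕ → ℕ → Ω → ℕ} {m σ2 : ℝ} {Z : ℕ → Ω → ℕ}

lemma sigS_le (h : GWData μ ξ m σ2 Z) (S : Set (ℕ × ℕ)) : sigS ξ S ≤ mΩ :=
  iSup₂_le fun p _ => measurable_iff_comap_le.1 (h.hmeas p.1 p.2)

lemma sigG_le (h : GWData μ ξ m σ2 Z) (n : ℕ) : sigG ξ n ≤ mΩ := h.sigS_le _
lemma sigH_le (h : GWData μ ξ m σ2 Z) (n : ℕ) : sigH ξ n ≤ mΩ := h.sigS_le _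

lemma indepGH (h : GWData μ ξ m σ2 Z) (n : ℕ) : Indep (sigG ξ n) (sigH ξ n) μ := by
  have hd : Disjoint {p : ℕ × ℕ | p.1 < n} {p : ℕ × ℕ | p.1 = n} := by
    rw [Set.disjoint_left]
    intro p hp hp'
    simp only [Set.mem_setOf_eq] at hp hp'
    omega
  have hi := (iIndepFun_iff_iIndep _ _ _).1 h.hindep
  unfold sigG sigH sigS
  exact indep_iSup_of_disjoint
    (m := fun p : ℕ × ℕ => MeasurableSpace.comap (ξ p.1 p.2) inferInstance)
    (fun p => measurable_iff_comap_le.1 (h.hmeas p.1 p.2)) hi hd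

lemma measZ (h : GWData μ ξ m σ2 Z) (n : ℕ) : Measurable[sigG ξ n] (Z n) := by
  induction n with
  | zero =>
    have : Z 0 = fun _ => 1 := funext h.hZ0
    rw [this]; exact @measurable_const _ _ _ (sigG ξ 0) _
  | succ n ih =>
    have : Z (n+1) = fun ω => ∑ i ∈ Finset.range (Z n ω), ξ n i ω := funext (h.hZrec n)
    rw [this]
    refine @meas_aux _ _ _ (sigG ξ (n+1)) _ _ _ _ (Z n) (ih.mono (sigG_mono ξ n.le_succ) le_rfl)
      (fun N ω => ∑ i ∈ Finset.range N, ξ n i ω) (fun N => ?_)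
    exact @Finset.measurable_fun_sum _ _ _ _ _ _ (sigG ξ (n+1)) _ _
      (fun i _ => meas_sigG ξ (n+1) n i n.lt_succ_self)

lemma measZ' (h : GWData μ ξ m σ2 Z) {k n : ℕ} (hk : k ≤ n) : Measurable[sigG ξ n] (Z k) :=
  (h.measZ k).mono (sigG_mono ξ hk) le_rfl

lemma measZ0 (h : GWData μ ξ m σ2 Z) (n : ℕ) : Measurable (Z n) :=
  (h.measZ n).mono (h.sigG_le n) le_rfl

lemma step (h : GWData μ ξ m σ2 Z) (n : ℕ) {ι : Type*} [MeasurableSpace ι] [Countable ι]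
    [MeasurableSingletonClass ι] (T : Ω → ι) (hT : Measurable[sigG ξ n] T)
    (φ : Ω → ENNReal) (hφ : Measurable[sigG ξ n] φ)
    (f : ι → Ω → ENNReal) (hf : ∀ N, Measurable[sigH ξ n] (f N)) :
    ∫⁻ ω, φ ω * f (T ω) ω ∂μ = ∫⁻ ω, φ ω * (∫⁻ ω', f (T ω) ω' ∂μ) ∂μ := by
  classical
  have key : ∀ g : ι → Ω → ENNReal, (∀ N, Measurable (g N)) →
      ∫⁻ ω, φ ω * g (T ω) ω ∂μ
        = ∑' N, ∫⁻ ω, ((T ⁻¹' {N}).indicator φ ω) * g N ω ∂μ := by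
    intro g hg
    rw [← lintegral_tsum]
    · congr 1
      ext ω
      rw [tsum_eq_single (T ω)]
      · simp
      · intro N hN
        rw [Set.indicator_of_notMem, zero_mul]
        simpa using hN.symm
    · intro N
      refine Measurable.aemeasurable ?_
      refine Measurable.mul ?_ (hg N)
      exact (hφ.mono (h.sigG_le n) le_rfl).indicator
        ((hT.mono (h.sigG_le n) le_rfl) (measurableSet_singleton N))
  rw [key f (fun N => (hf N).mono (h.sigH_le n) le_rfl),
    key (fun N _ => ∫⁻ ω', f N ω' ∂μ) (fun N => measurable_const)]
  congr 1
  ext N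
  rw [lintegral_mul_eq_lintegral_mul_lintegral_of_independent_measurableSpace (h.sigG_le n)
    (h.sigH_le n) (h.indepGH n) ?_ (hf N), lintegral_mul_const]
  · exact (hφ.mono (h.sigG_le n) le_rfl).indicator
        ((hT.mono (h.sigG_le n) le_rfl) (measurableSet_singleton N))
  · have hs : MeasurableSet[sigG ξ n] (T ⁻¹' {N}) := hT (measurableSet_singleton N)
    exact hφ.indicator hs

lemma identR (h : GWData μ ξ m σ2 Z) (n i : ℕ) :
    IdentDistrib (fun ω => (ξ n i ω : ℝ)) (fun ω => (ξ 0 0 ω : ℝ)) μ μ :=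
  (IdentDistrib.mk (h.hmeas n i).aemeasurable (h.hmeas 0 0).aemeasurable (h.hident n i)).comp
    (u := fun k : ℕ => (k : ℝ)) (measurable_of_countable _)

lemma memLp0 (h : GWData μ ξ m σ2 Z) : MemLp (fun ω => (ξ 0 0 ω : ℝ)) 2 μ :=
  (memLp_two_iff_integrable_sq h.hint.aestronglyMeasurable).2 h.hmom2

lemma memLp (h : GWData μ ξ m σ2 Z) (n i : ℕ) : MemLp (fun ω => (ξ n i ω : ℝ)) 2 μ :=
  (h.identR n i).memLp_iff.2 h.memLp0

lemma mean (h : GWData μ ξ m σ2 Z) (n i : ℕ) : ∫ ω, (ξ n i ω : ℝ) ∂μ = m := by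
  rw [(h.identR n i).integral_eq, h.hm]

lemma var (h : GWData μ ξ m σ2 Z) (n i : ℕ) : variance (fun ω => (ξ n i ω : ℝ)) μ = σ2 := by
  rw [(h.identR n i).variance_eq, variance_eq_integral h.memLp0.aemeasurable, h.hσ2, ← h.hm]

lemma σ2_nonneg (h : GWData μ ξ m σ2 Z) : 0 ≤ σ2 := by
  rw [← h.var 0 0]; exact variance_nonneg _ _

lemma sum_memLp (h : GWData μ ξ m σ2 Z) (n N : ℕ) :
    MemLp (fun ω => ∑ i ∈ Finset.range N, (ξ n i ω : ℝ)) 2 μ :=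
  memLp_finsetSum _ (fun i _ => h.memLp n i)

lemma sum_mean (h : GWData μ ξ m σ2 Z) (n N : ℕ) :
    ∫ ω, ∑ i ∈ Finset.range N, (ξ n i ω : ℝ) ∂μ = m * N := by
  rw [integral_finsetSum _ (fun i _ => (h.memLp n i).integrable one_le_two)]
  simp [h.mean, mul_comm]

lemma sum_var (h : GWData μ ξ m σ2 Z) (n N : ℕ) :
    variance (fun ω => ∑ i ∈ Finset.range N, (ξ n i ω : ℝ)) μ = σ2 * N := by
  have e : (fun ω => ∑ i ∈ Finset.range N, (ξ n i ω : ℝ))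
      = ∑ i ∈ Finset.range N, fun ω => (ξ n i ω : ℝ) := by
    ext ω; simp
  rw [e, IndepFun.variance_sum (fun i _ => h.memLp n i)]
  · simp [h.var, mul_comm]
  · intro i _ j _ hij
    have := h.hindep.indepFun (i := (n, i)) (j := (n, j)) (by simpa using hij)
    exact this.comp (φ := fun k : ℕ => (k : ℝ)) (ψ := fun k : ℕ => (k : ℝ))
      (measurable_of_countable _) (measurable_of_countable _)

lemma sum_sq (h : GWData μ ξ m σ2 Z) (n N : ℕ) (a : ℝ) :
    ∫⁻ ω, ENNReal.ofReal ((∑ i ∈ Finset.range N, (ξ n i ω : ℝ) - a) ^ 2) ∂μ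
      = ENNReal.ofReal ((m * N - a) ^ 2 + σ2 * N) := by
  have hM := h.sum_memLp n N
  rw [← ofReal_integral_eq_lintegral_ofReal]
  · congr 1
    have hv := variance_eq_sub hM
    rw [h.sum_var, h.sum_mean] at hv
    have hi := hM.integrable one_le_two
    have hi2 := hM.integrable_sq
    have : ∀ ω, (∑ i ∈ Finset.range N, (ξ n i ω : ℝ) - a) ^ 2
      = (∑ i ∈ Finset.range N, (ξ n i ω : ℝ))^2 - (2 * a) * (∑ i ∈ Finset.range N, (ξ n i ω : ℝ))
        + a^2 := fun ω => by ring
    simp_rw [this]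
    have hi3 : Integrable (fun ω => (∑ i ∈ Finset.range N, (ξ n i ω : ℝ))^2
        - (2 * a) * (∑ i ∈ Finset.range N, (ξ n i ω : ℝ))) μ := hi2.sub (hi.const_mul _)
    rw [integral_add hi3 (integrable_const _), integral_sub hi2 (hi.const_mul _), integral_const_mul, h.sum_mean]
    simp only [Pi.pow_apply] at hv
    simp
    linarith
  · exact (hM.sub (memLp_const a)).integrable_sq
  · exact ae_of_all _ fun ω => sq_nonneg _

lemma sum_lin (h : GWData μ ξ m σ2 Z) (n N : ℕ) :
    ∫⁻ ω, ENNReal.ofReal (∑ i ∈ Finset.range N, (ξ n i ω : ℝ)) ∂μ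
      = ENNReal.ofReal (m * N) := by
  rw [← ofReal_integral_eq_lintegral_ofReal, h.sum_mean]
  · exact (h.sum_memLp n N).integrable one_le_two
  · exact ae_of_all _ fun ω => Finset.sum_nonneg fun i _ => Nat.cast_nonneg _

lemma m_pos (h : GWData μ ξ m σ2 Z) : 0 < m := by linarith [h.hm1]

lemma meas_sumH (ξ : ℕ → ℕ → Ω → ℕ) (n N : ℕ) :
    Measurable[sigH ξ n] (fun ω => ∑ i ∈ Finset.range N, (ξ n i ω : ℝ)) := by
  refine @Finset.measurable_fun_sum _ _ _ _ _ _ (sigH ξ n) _ _ (fun i _ => ?_)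
  exact (measurable_of_countable (fun k : ℕ => (k : ℝ))).comp (meas_sigH ξ n i)

lemma Zcast (h : GWData μ ξ m σ2 Z) (n : ℕ) (ω : Ω) :
    (Z (n+1) ω : ℝ) = ∑ i ∈ Finset.range (Z n ω), (ξ n i ω : ℝ) := by
  rw [h.hZrec]; push_cast; rfl

lemma EW_step (h : GWData μ ξ m σ2 Z) (n : ℕ) (φ : Ω → ENNReal) (hφ : Measurable[sigG ξ n] φ) :
    ∫⁻ ω, φ ω * ENNReal.ofReal (Z (n+1) ω / m ^ (n+1)) ∂μ
      = ∫⁻ ω, φ ω * ENNReal.ofReal (Z n ω / m ^ n) ∂μ := by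
  have hmp := h.m_pos
  have := h.step n (Z n) (h.measZ n) φ hφ
    (fun N ω => ENNReal.ofReal ((∑ i ∈ Finset.range N, (ξ n i ω : ℝ)) / m ^ (n+1)))
    (fun N => ENNReal.measurable_ofReal.comp ((meas_sumH ξ n N).div_const _))
  simp_rw [← h.Zcast] at this
  rw [this]
  refine lintegral_congr fun ω => ?_
  congr 1
  have e : ∀ ω', ENNReal.ofReal ((∑ i ∈ Finset.range (Z n ω), (ξ n i ω' : ℝ)) / m ^ (n+1))
      = ENNReal.ofReal (1 / m ^ (n+1)) *
        ENNReal.ofReal (∑ i ∈ Finset.range (Z n ω), (ξ n i ω' : ℝ)) := by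
    intro ω'
    rw [← ENNReal.ofReal_mul (by positivity)]
    congr 1; ring
  simp_rw [e]
  rw [lintegral_const_mul' _ _ ENNReal.ofReal_ne_top, h.sum_lin, ← ENNReal.ofReal_mul (by positivity)]
  congr 1
  field_simp
  ring

lemma EW (h : GWData μ ξ m σ2 Z) (k l : ℕ) (φ : Ω → ENNReal) (hφ : Measurable[sigG ξ k] φ) :
    ∫⁻ ω, φ ω * ENNReal.ofReal (Z (k+l) ω / m ^ (k+l)) ∂μ
      = ∫⁻ ω, φ ω * ENNReal.ofReal (Z k ω / m ^ k) ∂μ := by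
  induction l with
  | zero => rfl
  | succ l ih =>
    rw [← ih]
    exact h.EW_step (k+l) φ (hφ.mono (sigG_mono ξ (by omega)) le_rfl)

lemma measR (h : GWData μ ξ m σ2 Z) (n : ℕ) (g : ℕ → ℝ) : Measurable (fun ω => g (Z n ω)) :=
  (measurable_of_countable g).comp (h.measZ0 n)

lemma EW2_step (h : GWData μ ξ m σ2 Z) (k n : ℕ) (hkn : k ≤ n)
    (φ : Ω → ENNReal) (hφ : Measurable[sigG ξ n] φ) :
    ∫⁻ ω, φ ω * ENNReal.ofReal ((Z (n+1) ω / m ^ (n+1) - Z k ω / m ^ k) ^ 2) ∂μ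
      = ∫⁻ ω, φ ω * ENNReal.ofReal ((Z n ω / m ^ n - Z k ω / m ^ k) ^ 2) ∂μ
        + ENNReal.ofReal (σ2 / m ^ (n+2)) * ∫⁻ ω, φ ω * ENNReal.ofReal (Z n ω / m ^ n) ∂μ := by
  have hmp := h.m_pos
  have hs := h.σ2_nonneg
  have hφ0 : Measurable φ := hφ.mono (h.sigG_le n) le_rfl
  have := h.step n (fun ω => (Z n ω, Z k ω))
    ((h.measZ n).prodMk (h.measZ' hkn)) φ hφ
    (fun N ω => ENNReal.ofReal (((∑ i ∈ Finset.range N.1, (ξ n i ω : ℝ)) / m ^ (n+1)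
      - (N.2 : ℝ) / m ^ k)^2))
    (fun N => ENNReal.measurable_ofReal.comp
      ((((meas_sumH ξ n N.1).div_const _).sub_const _).pow_const 2))
  simp_rw [← h.Zcast] at this
  rw [this, ← lintegral_const_mul' _ _ ENNReal.ofReal_ne_top, ← lintegral_add_left]
  · refine lintegral_congr fun ω => ?_
    have e : ∀ ω', ENNReal.ofReal (((∑ i ∈ Finset.range (Z n ω), (ξ n i ω' : ℝ)) / m ^ (n+1)
        - (Z k ω : ℝ) / m ^ k)^2)
      = ENNReal.ofReal (1 / (m ^ (n+1))^2) *
        ENNReal.ofReal ((∑ i ∈ Finset.range (Z n ω), (ξ n i ω' : ℝ)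
          - m^(n+1) * (Z k ω / m ^ k))^2) := by
      intro ω'
      rw [← ENNReal.ofReal_mul (by positivity)]
      congr 1
      field_simp
    simp_rw [e]
    rw [lintegral_const_mul' _ _ ENNReal.ofReal_ne_top, h.sum_sq,
      ← ENNReal.ofReal_mul (by positivity), mul_left_comm, ← mul_add,
      ← ENNReal.ofReal_mul (by positivity), ← ENNReal.ofReal_add (by positivity) (by positivity)]
    congr 2
    field_simp
    ring
  · refine hφ0.mul (ENNReal.measurable_ofReal.comp ?_)
    exact ((h.measR n (fun x => x / m ^ n)).sub (h.measR k (fun x => x / m ^ k))).pow_const 2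

lemma EW2 (h : GWData μ ξ m σ2 Z) (k l : ℕ) (φ : Ω → ENNReal) (hφ : Measurable[sigG ξ k] φ) :
    ∫⁻ ω, φ ω * ENNReal.ofReal ((Z (k+l) ω / m ^ (k+l) - Z k ω / m ^ k) ^ 2) ∂μ
      = ENNReal.ofReal (σ2 / (m^2 - m) / m ^ k * (1 - 1 / m ^ l))
        * ∫⁻ ω, φ ω * ENNReal.ofReal (Z k ω / m ^ k) ∂μ := by
  have hm1 := h.hm1
  have hmp := h.m_pos
  have hs := h.σ2_nonneg
  have hd : 0 < m ^ 2 - m := by nlinarith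
  induction l with
  | zero => simp
  | succ l ih =>
    have := h.EW2_step k (k+l) (by omega) φ (hφ.mono (sigG_mono ξ (by omega)) le_rfl)
    rw [h.EW k l φ hφ, ih, ← add_mul, ← ENNReal.ofReal_add] at this
    · rw [← add_assoc, this]
      congr 2
      have : m - 1 ≠ 0 := by linarith
      have e : m ^ 2 - m = m * (m - 1) := by ring
      rw [e]
      field_simp
      ring
    · have : 1 / m ^ l ≤ 1 := by
        rw [div_le_one (by positivity)]; exact one_le_pow₀ hm1.le
      have : 0 ≤ 1 - 1 / m ^ l := by linarith
      positivity
    · positivity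

lemma EW2_le (h : GWData μ ξ m σ2 Z) (k n : ℕ) (hkn : k ≤ n)
    (φ : Ω → ENNReal) (hφ : Measurable[sigG ξ k] φ) :
    ∫⁻ ω, φ ω * ENNReal.ofReal ((Z n ω / m ^ n - Z k ω / m ^ k) ^ 2) ∂μ
      ≤ ENNReal.ofReal (σ2 / (m^2 - m) / m ^ k)
        * ∫⁻ ω, φ ω * ENNReal.ofReal (Z k ω / m ^ k) ∂μ := by
  obtain ⟨l, rfl⟩ := Nat.exists_eq_add_of_le hkn
  rw [h.EW2 k l φ hφ]
  have hm1 := h.hm1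
  have hmp := h.m_pos
  have hs := h.σ2_nonneg
  have hd : 0 < m ^ 2 - m := by nlinarith
  gcongr
  refine mul_le_of_le_one_right (by positivity) ?_
  have : 0 ≤ 1 / m ^ l := by positivity
  linarith

lemma EZ (h : GWData μ ξ m σ2 Z) (n : ℕ) : ∫⁻ ω, ENNReal.ofReal (Z n ω / m ^ n) ∂μ = 1 := by
  have := h.EW 0 n (fun _ => 1) (@measurable_const _ _ _ (sigG ξ 0) _)
  simpa [h.hZ0] using this

lemma EZ2 (h : GWData μ ξ m σ2 Z) (n : ℕ) :
    ∫⁻ ω, ENNReal.ofReal ((Z n ω / m ^ n) ^ 2) ∂μ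
      ≤ ENNReal.ofReal (2 + 2 * (σ2 / (m ^ 2 - m))) := by
  have hm1 := h.hm1
  have hs := h.σ2_nonneg
  have hd : 0 < m ^ 2 - m := by nlinarith
  have := h.EW2_le 0 n (Nat.zero_le _) (fun _ => 1) (@measurable_const _ _ _ (sigG ξ 0) _)
  simp [h.hZ0] at this
  calc ∫⁻ ω, ENNReal.ofReal ((Z n ω / m ^ n) ^ 2) ∂μ
      ≤ ∫⁻ ω, (ENNReal.ofReal 2 + ENNReal.ofReal 2 * ENNReal.ofReal ((Z n ω / m ^ n - 1) ^ 2)) ∂μ := by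
        refine lintegral_mono fun ω => ?_
        rw [← ENNReal.ofReal_mul (by norm_num), ← ENNReal.ofReal_add (by norm_num) (by positivity)]
        refine ENNReal.ofReal_le_ofReal ?_
        nlinarith [sq_nonneg ((Z n ω : ℝ) / m ^ n - 2)]
    _ = ENNReal.ofReal 2 + ENNReal.ofReal 2 * ∫⁻ ω, ENNReal.ofReal ((Z n ω / m ^ n - 1) ^ 2) ∂μ := by
        rw [lintegral_add_left measurable_const, lintegral_const_mul' _ _ ENNReal.ofReal_ne_top]
        simp
    _ ≤ ENNReal.ofReal 2 + ENNReal.ofReal 2 * ENNReal.ofReal (σ2 / (m ^ 2 - m)) := by gcongr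
    _ = _ := by
        rw [← ENNReal.ofReal_mul (by norm_num), ← ENNReal.ofReal_add (by norm_num) (by positivity)]

/-- some individual among the first `N` of generation `i` has more than `s` children -/
def bigD (ξ : ℕ → ℕ → Ω → ℕ) (i : ℕ) (s : ℝ) (N : ℕ) : Set Ω :=
  {ω | ∃ j < N, s < (ξ i j ω : ℝ)}

/-- big jump in generation `i` -/
def bigJ (ξ : ℕ → ℕ → Ω → ℕ) (Z : ℕ → Ω → ℕ) (t : ℕ → ℝ) (i : ℕ) : Set Ω :=
  {ω | ∃ j < Z i ω, t i < (ξ i j ω : ℝ)}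

/-- big jump before generation `i` -/
def bigP (ξ : ℕ → ℕ → Ω → ℕ) (Z : ℕ → Ω → ℕ) (t : ℕ → ℝ) (i : ℕ) : Set Ω :=
  ⋃ k ∈ Finset.range i, bigJ ξ Z t k

lemma measD (i : ℕ) (s : ℝ) (N : ℕ) : MeasurableSet[sigH ξ i] (bigD ξ i s N) := by
  have : bigD ξ i s N = ⋃ j ∈ Finset.range N, (ξ i j) ⁻¹' {k : ℕ | s < (k : ℝ)} := by
    ext ω; simp [bigD]
  rw [this]
  refine @Finset.measurableSet_biUnion _ _ (sigH ξ i) _ _ (fun j _ => ?_)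
  exact meas_sigH ξ i j (Set.to_countable _).measurableSet

lemma measJ (h : GWData μ ξ m σ2 Z) (t : ℕ → ℝ) (i n : ℕ) (hin : i < n) :
    MeasurableSet[sigG ξ n] (bigJ ξ Z t i) := by
  have : bigJ ξ Z t i = ⋃ j : ℕ, ((Z i) ⁻¹' {k : ℕ | j < k} ∩ (ξ i j) ⁻¹' {k : ℕ | t i < (k : ℝ)}) := by
    ext ω; simp [bigJ]
  rw [this]
  refine @MeasurableSet.iUnion _ _ (sigG ξ n) _ _ (fun j => ?_)
  refine @MeasurableSet.inter _ (sigG ξ n) _ _ ?_ ?_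
  · exact h.measZ' hin.le (Set.to_countable _).measurableSet
  · exact meas_sigG ξ n i j hin (Set.to_countable _).measurableSet

lemma measP (h : GWData μ ξ m σ2 Z) (t : ℕ → ℝ) (i : ℕ) :
    MeasurableSet[sigG ξ i] (bigP ξ Z t i) := by
  refine @Finset.measurableSet_biUnion _ _ (sigG ξ i) _ _ (fun j hj => ?_)
  exact h.measJ t j i (Finset.mem_range.1 hj)

lemma measureD (h : GWData μ ξ m σ2 Z) (i : ℕ) (s : ℝ) (N : ℕ) :
    μ.real (bigD ξ i s N) = 1 - (1 - μ.real {ω | s < (ξ 0 0 ω : ℝ)}) ^ N := by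
  have hD : MeasurableSet (bigD ξ i s N) := h.sigH_le i _ (measD i s N)
  have hc : (bigD ξ i s N)ᶜ = ⋂ j ∈ Finset.range N, (ξ i j) ⁻¹' {k : ℕ | s < (k : ℝ)}ᶜ := by
    ext ω; simp [bigD]
  have hq : ∀ j, μ.real ((ξ i j) ⁻¹' {k : ℕ | s < (k : ℝ)}ᶜ)
      = 1 - μ.real {ω | s < (ξ 0 0 ω : ℝ)} := by
    intro j
    have h1 : μ.real ((ξ i j) ⁻¹' {k : ℕ | s < (k : ℝ)}ᶜ)
        = μ.real ((ξ 0 0) ⁻¹' {k : ℕ | s < (k : ℝ)}ᶜ) := by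
      have hs : MeasurableSet ({k : ℕ | s < (k : ℝ)}ᶜ) := (Set.to_countable _).measurableSet
      unfold Measure.real
      rw [← Measure.map_apply (h.hmeas i j) hs, ← Measure.map_apply (h.hmeas 0 0) hs, h.hident]
    rw [h1, Set.preimage_compl, probReal_compl_eq_one_sub]
    · rfl
    · exact h.hmeas 0 0 (Set.to_countable _).measurableSet
  have hpr : μ.real ((bigD ξ i s N)ᶜ) = (1 - μ.real {ω | s < (ξ 0 0 ω : ℝ)}) ^ N := by
    have hi : iIndepFun (fun j : ℕ => ξ i j) μ :=
      h.hindep.precomp (g := fun j : ℕ => (i, j)) (fun a b hab => by simpa using hab)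
    rw [hc]
    unfold Measure.real
    rw [hi.measure_inter_preimage_eq_mul _ (fun j _ => (Set.to_countable _).measurableSet),
      ENNReal.toReal_prod]
    unfold Measure.real at hq
    rw [Finset.prod_congr rfl (fun j _ => hq j)]
    simp
  rw [probReal_compl_eq_one_sub hD] at hpr
  linarith

lemma pow_upper (q : ℝ) (h0 : 0 ≤ q) (h1 : q ≤ 1) (N : ℕ) :
    (1 - q) ^ N ≤ 1 - N * q + (N * q) ^ 2 := by
  induction N with
  | zero => simp
  | succ N ih =>
    have hN : (0:ℝ) ≤ N := Nat.cast_nonneg N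
    have := mul_le_mul_of_nonneg_right ih (show 0 ≤ 1 - q by linarith)
    rw [pow_succ]
    refine this.trans ?_
    push_cast
    have h2 : 0 ≤ (N * q) ^ 2 * q := by positivity
    have h3 : 0 ≤ N * q ^ 2 := by positivity
    nlinarith [sq_nonneg q]

lemma measureD_le (h : GWData μ ξ m σ2 Z) (i : ℕ) (s : ℝ) (N : ℕ) :
    μ (bigD ξ i s N) ≤ ENNReal.ofReal (N * μ.real {ω | s < (ξ 0 0 ω : ℝ)}) := by
  rw [← ENNReal.ofReal_toReal (measure_ne_top μ (bigD ξ i s N))]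
  refine ENNReal.ofReal_le_ofReal ?_
  have := h.measureD i s N
  unfold Measure.real at this ⊢
  rw [this]
  have h1 : (μ {ω | s < (ξ 0 0 ω : ℝ)}).toReal ≤ 1 := measureReal_le_one
  have := one_add_mul_le_pow (a := -(μ {ω | s < (ξ 0 0 ω : ℝ)}).toReal) (by linarith) N
  rw [← sub_eq_add_neg] at this
  linarith

lemma le_measureD (h : GWData μ ξ m σ2 Z) (i : ℕ) (s : ℝ) (N : ℕ) :
    ENNReal.ofReal (N * μ.real {ω | s < (ξ 0 0 ω : ℝ)}
      - (N * μ.real {ω | s < (ξ 0 0 ω : ℝ)}) ^ 2) ≤ μ (bigD ξ i s N) := by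
  rw [← ENNReal.ofReal_toReal (measure_ne_top μ (bigD ξ i s N))]
  refine ENNReal.ofReal_le_ofReal ?_
  have := h.measureD i s N
  have h2 := pow_upper (μ.real {ω | s < (ξ 0 0 ω : ℝ)}) measureReal_nonneg measureReal_le_one N
  change _ ≤ μ.real (bigD ξ i s N)
  linarith

/-- measure of jump intersected with a past event -/
lemma measure_inter_J (h : GWData μ ξ m σ2 Z) (t : ℕ → ℝ) (i : ℕ) (B : Set Ω)
    (hB : MeasurableSet[sigG ξ i] B) :
    μ (B ∩ bigJ ξ Z t i) = ∫⁻ ω, B.indicator 1 ω * μ (bigD ξ i (t i) (Z i ω)) ∂μ := by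
  have h1 : Measurable[sigG ξ i] (B.indicator (1 : Ω → ENNReal)) :=
    (@measurable_const _ _ _ (sigG ξ i) (1 : ENNReal)).indicator hB
  have := h.step i (Z i) (h.measZ i) (B.indicator 1) h1
    (fun N => (bigD ξ i (t i) N).indicator 1)
    (fun N => (@measurable_const _ _ _ (sigH ξ i) (1 : ENNReal)).indicator (measD i (t i) N))
  have e : ∀ N, ∫⁻ ω, (bigD ξ i (t i) N).indicator (1 : Ω → ENNReal) ω ∂μ = μ (bigD ξ i (t i) N) :=
    fun N => lintegral_indicator_one (h.sigH_le i _ (measD i (t i) N))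
  simp_rw [e] at this
  rw [← this, ← lintegral_indicator_one]
  · refine lintegral_congr fun ω => ?_
    by_cases h1 : ω ∈ B <;> by_cases h2 : ω ∈ bigJ ξ Z t i
    · have h3 : ω ∈ bigD ξ i (t i) (Z i ω) := h2
      simp [h1, h2, h3]
    · have h3 : ω ∉ bigD ξ i (t i) (Z i ω) := h2
      simp [h2, h3]
    · simp [h1]
    · simp [h1]
  · exact (h.sigG_le i _ hB).inter (h.sigG_le (i+1) _ (h.measJ t i (i+1) (Nat.lt_succ_self i)))

lemma EZq (h : GWData μ ξ m σ2 Z) (i : ℕ) (q : ℝ) (hq : 0 ≤ q) :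
    ∫⁻ ω, ENNReal.ofReal (Z i ω * q) ∂μ = ENNReal.ofReal (m ^ i * q) := by
  have hmp := h.m_pos
  have e : ∀ ω, ENNReal.ofReal (Z i ω * q)
      = ENNReal.ofReal (m ^ i * q) * ENNReal.ofReal (Z i ω / m ^ i) := by
    intro ω
    rw [← ENNReal.ofReal_mul (by positivity)]
    congr 1; field_simp
  simp_rw [e]
  rw [lintegral_const_mul' _ _ ENNReal.ofReal_ne_top, h.EZ, mul_one]

lemma measureJ_le (h : GWData μ ξ m σ2 Z) (t : ℕ → ℝ) (i : ℕ) :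
    μ (bigJ ξ Z t i) ≤ ENNReal.ofReal (m ^ i * μ.real {ω | t i < (ξ 0 0 ω : ℝ)}) := by
  have := h.measure_inter_J t i Set.univ (@MeasurableSet.univ _ (sigG ξ i))
  simp only [Set.univ_inter, Set.indicator_univ, Pi.one_apply, one_mul] at this
  rw [this, ← h.EZq i _ measureReal_nonneg]
  exact lintegral_mono fun ω => h.measureD_le i (t i) (Z i ω)

lemma measureP_le (h : GWData μ ξ m σ2 Z) (t : ℕ → ℝ) (i : ℕ) :
    μ (bigP ξ Z t i)
      ≤ ENNReal.ofReal (∑ k ∈ Finset.range i, m ^ k * μ.real {ω | t k < (ξ 0 0 ω : ℝ)}) := by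
  have hmp := h.m_pos
  rw [ENNReal.ofReal_sum_of_nonneg (fun k _ => by positivity)]
  exact (measure_biUnion_finset_le _ _).trans (Finset.sum_le_sum fun k _ => h.measureJ_le t k)

lemma lowerE (h : GWData μ ξ m σ2 Z) (t : ℕ → ℝ) (i : ℕ) (q δ P C : ℝ)
    (hq : q = μ.real {ω | t i < (ξ 0 0 ω : ℝ)}) (hδ : 0 < δ) (hP0 : 0 ≤ P)
    (hP : μ (bigP ξ Z t i) ≤ ENNReal.ofReal P) (hC : C = 2 + 2 * (σ2 / (m ^ 2 - m))) :
    m ^ i * q * (1 - (δ * C + P / δ + m ^ i * q * C))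
      ≤ μ.real ((bigP ξ Z t i)ᶜ ∩ bigJ ξ Z t i) := by
  have hmp := h.m_pos
  have hm1 := h.hm1
  have hs := h.σ2_nonneg
  have hd : 0 < m ^ 2 - m := by nlinarith
  have hq0 : 0 ≤ q := hq ▸ measureReal_nonneg
  have hC0 : 0 ≤ C := by rw [hC]; positivity
  have hPm : MeasurableSet (bigP ξ Z t i) := h.sigG_le i _ (h.measP t i)
  have hPc : MeasurableSet[sigG ξ i] (bigP ξ Z t i)ᶜ :=
    @MeasurableSet.compl _ _ (sigG ξ i) (h.measP t i)
  have hW2 : Measurable (fun ω => ENNReal.ofReal (((Z i ω : ℝ) / m ^ i) ^ 2)) :=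
    ENNReal.measurable_ofReal.comp (h.measR i (fun z => (z / m ^ i) ^ 2))
  have h2 := h.EZ2 i
  rw [← hC] at h2
  have main : ENNReal.ofReal (m ^ i * q) ≤ μ ((bigP ξ Z t i)ᶜ ∩ bigJ ξ Z t i)
      + (ENNReal.ofReal (m ^ i * q * (1 / δ)) * ENNReal.ofReal P
      + ENNReal.ofReal (m ^ i * q * δ + (m ^ i * q) ^ 2) * ENNReal.ofReal C) := by
    calc ENNReal.ofReal (m ^ i * q) = ∫⁻ ω, ENNReal.ofReal (Z i ω * q) ∂μ := (h.EZq i q hq0).symm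
      _ ≤ ∫⁻ ω, ((bigP ξ Z t i)ᶜ.indicator 1 ω * μ (bigD ξ i (t i) (Z i ω))
          + (ENNReal.ofReal (m ^ i * q * (1 / δ)) * (bigP ξ Z t i).indicator 1 ω
          + ENNReal.ofReal (m ^ i * q * δ + (m ^ i * q) ^ 2)
            * ENNReal.ofReal (((Z i ω : ℝ) / m ^ i) ^ 2))) ∂μ := by
        refine lintegral_mono fun ω => ?_
        have hz : (Z i ω : ℝ) * q = m ^ i * q * (Z i ω / m ^ i) := by field_simp
        set w : ℝ := (Z i ω : ℝ) / m ^ i with hw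
        by_cases hω : ω ∈ bigP ξ Z t i
        · simp only [hω, Set.indicator_of_mem, Set.mem_compl_iff, not_true_eq_false,
            Set.indicator_of_notMem, zero_mul, zero_add, Pi.one_apply, mul_one,
            not_false_eq_true]
          rw [← ENNReal.ofReal_mul (by positivity), ← ENNReal.ofReal_add (by positivity) (by positivity)]
          refine ENNReal.ofReal_le_ofReal ?_
          rw [hz]
          have h3 : w ≤ 1 / δ + δ * w ^ 2 := by
            have : 1 / δ + δ * w ^ 2 - w = (1 / δ) * ((δ * w - 1 / 2) ^ 2 + 3 / 4) := by
              field_simp; ring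
            have h4 : 0 ≤ (1 / δ) * ((δ * w - 1 / 2) ^ 2 + 3 / 4) := by positivity
            linarith
          have h5 := mul_le_mul_of_nonneg_left h3 (show 0 ≤ m ^ i * q by positivity)
          have h6 : 0 ≤ (m ^ i * q) ^ 2 * w ^ 2 := by positivity
          linarith
        · simp only [hω, Set.indicator_of_mem, Set.mem_compl_iff,
            Set.indicator_of_notMem, one_mul, zero_add, Pi.one_apply, mul_zero,
            not_false_eq_true]
          have h3 := h.le_measureD i (t i) (Z i ω)
          rw [← hq] at h3
          refine le_trans ?_ (add_le_add h3 (le_refl _))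
          rw [← ENNReal.ofReal_mul (by positivity)]
          refine le_trans ?_ ENNReal.ofReal_add_le
          refine ENNReal.ofReal_le_ofReal ?_
          rw [hz]
          have h6 : 0 ≤ m ^ i * q * δ * w ^ 2 := by positivity
          nlinarith
      _ = μ ((bigP ξ Z t i)ᶜ ∩ bigJ ξ Z t i)
          + (ENNReal.ofReal (m ^ i * q * (1 / δ)) * μ (bigP ξ Z t i)
          + ENNReal.ofReal (m ^ i * q * δ + (m ^ i * q) ^ 2)
            * ∫⁻ ω, ENNReal.ofReal (((Z i ω : ℝ) / m ^ i) ^ 2) ∂μ) := by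
        rw [lintegral_add_right, lintegral_add_right, lintegral_const_mul' _ _ ENNReal.ofReal_ne_top,
          lintegral_const_mul' _ _ ENNReal.ofReal_ne_top, lintegral_indicator_one hPm,
          h.measure_inter_J t i _ hPc]
        · exact hW2.const_mul _
        · exact ((measurable_const.indicator hPm).const_mul _).add (hW2.const_mul _)
      _ ≤ _ := by gcongr
  rw [← ENNReal.ofReal_mul (by positivity), ← ENNReal.ofReal_mul (by positivity),
    ← ENNReal.ofReal_add (by positivity) (by positivity),
    ← ENNReal.ofReal_toReal (measure_ne_top μ ((bigP ξ Z t i)ᶜ ∩ bigJ ξ Z t i)),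
    ← ENNReal.ofReal_add ENNReal.toReal_nonneg (by positivity),
    ENNReal.ofReal_le_ofReal_iff (add_nonneg ENNReal.toReal_nonneg (by positivity))] at main
  unfold Measure.real
  have e : m ^ i * q * (1 - (δ * C + P / δ + m ^ i * q * C)) =
    m ^ i * q - (m ^ i * q * (1 / δ) * P + (m ^ i * q * δ + (m ^ i * q) ^ 2) * C) := by
    field_simp; ring
  linarith

lemma ratio_bound (A y x z : ℝ) (hA : 0 < A) (hx : 0 < x) (hxy : x ≤ y)
    (hz : y + A * Real.sqrt y < z) :
    z / (z - y) ^ 2 ≤ 1 / A ^ 2 + 1 / (A * Real.sqrt x) := by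
  have hy : 0 < y := hx.trans_le hxy
  have hsx : 0 < Real.sqrt x := Real.sqrt_pos.2 hx
  have hsy : Real.sqrt x ≤ Real.sqrt y := Real.sqrt_le_sqrt hxy
  have hsq : Real.sqrt y ^ 2 = y := Real.sq_sqrt hy.le
  set s := Real.sqrt y
  have hs0 : 0 < s := hsx.trans_le hsy
  have hu : A * s ≤ z - y := by linarith
  have hAs : 0 < A * s := by positivity
  have hu0 : 0 < z - y := hAs.trans_le hu
  have e : z / (z - y) ^ 2 = y / (z - y) ^ 2 + 1 / (z - y) := by
    field_simp; ring
  rw [e]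
  refine add_le_add ?_ ?_
  · rw [div_le_div_iff₀ (by positivity) (by positivity), one_mul]
    have : (A * s) ^ 2 ≤ (z - y) ^ 2 := by gcongr
    rw [mul_pow, hsq] at this
    linarith
  · refine one_div_le_one_div_of_le (by positivity) (le_trans ?_ hu)
    gcongr

lemma cheb (h : GWData μ ξ m σ2 Z) (t : ℕ → ℝ) (i n : ℕ) (hin : i < n) (A x : ℝ) (hA : 0 < A)
    (hx : 0 < x) (ht : t i = m ^ (i+1) * x + A * Real.sqrt (m ^ (i+1) * x))
    (E : Set Ω) (hE : MeasurableSet[sigG ξ (i+1)] E) (hEJ : E ⊆ bigJ ξ Z t i) :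
    (1 - σ2 / (m ^ 2 - m) * (1 / A ^ 2 + 1 / (A * Real.sqrt x))) * μ.real E
      ≤ μ.real (E ∩ {ω | x < (Z n ω : ℝ) / m ^ n}) := by
  have hmp := h.m_pos
  have hm1 := h.hm1
  have hs := h.σ2_nonneg
  have hd : 0 < m ^ 2 - m := by nlinarith
  have hxy : x ≤ m ^ (i+1) * x := le_mul_of_one_le_left hx.le (one_le_pow₀ hm1.le)
  have hZbig : ∀ ω ∈ E, m ^ (i+1) * x + A * Real.sqrt (m ^ (i+1) * x) < Z (i+1) ω := by
    intro ω hω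
    obtain ⟨j, hj, hj'⟩ := hEJ hω
    rw [← ht]
    refine hj'.trans_le ?_
    rw [h.Zcast]
    exact Finset.single_le_sum (f := fun j => (ξ i j ω : ℝ)) (fun _ _ => Nat.cast_nonneg _)
      (Finset.mem_range.2 hj)
  have hE0 : MeasurableSet E := h.sigG_le _ _ hE
  have hS : MeasurableSet {ω | x < (Z n ω : ℝ) / m ^ n} :=
    measurableSet_lt measurable_const (h.measR n (fun z => z / m ^ n))
  set b := σ2 / (m ^ 2 - m) * (1 / A ^ 2 + 1 / (A * Real.sqrt x)) with hb
  have hb0 : 0 ≤ b := by positivity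
  let φ : Ω → ENNReal := E.indicator (fun ω =>
    ENNReal.ofReal (1 / ((Z (i+1) ω : ℝ) / m ^ (i+1) - x) ^ 2))
  have hφ : Measurable[sigG ξ (i+1)] φ := by
    refine Measurable.indicator ?_ hE
    exact (measurable_of_countable (fun z : ℕ =>
      ENNReal.ofReal (1 / ((z : ℝ) / m ^ (i+1) - x) ^ 2))).comp (h.measZ (i+1))
  have key : μ (E \ {ω | x < (Z n ω : ℝ) / m ^ n}) ≤ ENNReal.ofReal b * μ E := by
    calc μ (E \ {ω | x < (Z n ω : ℝ) / m ^ n})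
        = ∫⁻ ω, (E \ {ω | x < (Z n ω : ℝ) / m ^ n}).indicator 1 ω ∂μ :=
          (lintegral_indicator_one (hE0.diff hS)).symm
      _ ≤ ∫⁻ ω, φ ω * ENNReal.ofReal ((Z n ω / m ^ n - Z (i+1) ω / m ^ (i+1)) ^ 2) ∂μ := by
          refine lintegral_mono fun ω => ?_
          by_cases hω : ω ∈ E \ {ω | x < (Z n ω : ℝ) / m ^ n}
          · simp only [hω, Set.indicator_of_mem, Pi.one_apply, φ, hω.1]
            have h1 := hZbig ω hω.1
            have h2 : (Z n ω : ℝ) / m ^ n ≤ x := not_lt.1 hω.2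
            have h3 : x < (Z (i+1) ω : ℝ) / m ^ (i+1) := by
              rw [lt_div_iff₀ (by positivity)]
              have : 0 ≤ A * Real.sqrt (m ^ (i+1) * x) := by positivity
              linarith
            rw [← ENNReal.ofReal_mul (by positivity), ← ENNReal.ofReal_one]
            refine ENNReal.ofReal_le_ofReal ?_
            rw [one_div_mul_eq_div, one_le_div (by nlinarith)]
            nlinarith
          · simp [hω]
      _ ≤ _ := h.EW2_le (i+1) n hin φ hφ
      _ = ∫⁻ ω, ENNReal.ofReal (σ2 / (m^2 - m) / m ^ (i+1)) *
            (φ ω * ENNReal.ofReal (Z (i+1) ω / m ^ (i+1))) ∂μ :=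
          (lintegral_const_mul' _ _ ENNReal.ofReal_ne_top).symm
      _ ≤ ∫⁻ ω, ENNReal.ofReal b * E.indicator 1 ω ∂μ := by
          refine lintegral_mono fun ω => ?_
          by_cases hω : ω ∈ E
          · simp only [hω, Set.indicator_of_mem, Pi.one_apply, φ, mul_one]
            rw [← ENNReal.ofReal_mul (by positivity), ← ENNReal.ofReal_mul (by positivity)]
            refine ENNReal.ofReal_le_ofReal ?_
            have h1 := ratio_bound A (m ^ (i+1) * x) x (Z (i+1) ω) hA hx hxy (hZbig ω hω)
            have h2 := mul_le_mul_of_nonneg_left h1 (show 0 ≤ σ2 / (m ^ 2 - m) by positivity)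
            refine le_trans (le_of_eq ?_) h2
            have h3 : (Z (i+1) ω : ℝ) / m ^ (i+1) - x = (Z (i+1) ω - m ^ (i+1) * x) / m ^ (i+1) := by
              field_simp
            have h4 := hZbig ω hω
            have h5 : 0 ≤ A * Real.sqrt (m ^ (i+1) * x) := by positivity
            have h6 : (Z (i+1) ω : ℝ) - m ^ (i+1) * x ≠ 0 := by
              intro h7; linarith
            rw [h3]
            field_simp
          · simp [hω, φ]
      _ = ENNReal.ofReal b * μ E := by
          rw [lintegral_const_mul' _ _ ENNReal.ofReal_ne_top, lintegral_indicator_one hE0]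
  have key2 : μ.real (E \ {ω | x < (Z n ω : ℝ) / m ^ n}) ≤ b * μ.real E := by
    have := ENNReal.toReal_mono (by finiteness) key
    rwa [ENNReal.toReal_mul, ENNReal.toReal_ofReal hb0] at this
  have := measureReal_inter_add_diff (μ := μ) (s := E) hS
  linarith

lemma tail_bound (h : GWData μ ξ m σ2 Z) (s : ℝ) (hs : 0 < s) :
    μ.real {ω | s < (ξ 0 0 ω : ℝ)} ≤ (∫ ω, ((ξ 0 0 ω : ℝ)) ^ 2 ∂μ) / s ^ 2 := by
  have := mul_meas_ge_le_integral_of_nonneg (μ := μ) (f := fun ω => ((ξ 0 0 ω : ℝ)) ^ 2)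
    (ae_of_all _ fun ω => sq_nonneg _) h.hmom2 (s ^ 2)
  rw [le_div_iff₀ (by positivity), mul_comm]
  refine le_trans ?_ this
  refine mul_le_mul_of_nonneg_left (measureReal_mono ?_) (by positivity)
  intro ω (hω : s < _)
  change s ^ 2 ≤ (ξ 0 0 ω : ℝ) ^ 2
  gcongr

lemma mq_bound (h : GWData μ ξ m σ2 Z) (x s : ℝ) (hx : 0 < x) (k : ℕ) (hs : m ^ (k+1) * x ≤ s) :
    m ^ k * μ.real {ω | s < (ξ 0 0 ω : ℝ)}
      ≤ (∫ ω, ((ξ 0 0 ω : ℝ)) ^ 2 ∂μ) / x ^ 2 * (1 / m) ^ k := by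
  have hmp := h.m_pos
  have hm1 := h.hm1
  set M := ∫ ω, ((ξ 0 0 ω : ℝ)) ^ 2 ∂μ with hM
  have hM0 : 0 ≤ M := integral_nonneg fun ω => sq_nonneg _
  have hp : 0 < m ^ (k+1) * x := by positivity
  have h1 := h.tail_bound s (hp.trans_le hs)
  have h2 : M / s ^ 2 ≤ M / (m ^ k * x) ^ 2 := by
    gcongr
    refine le_trans ?_ hs
    gcongr
    · exact hm1.le
    · omega
  calc m ^ k * μ.real {ω | s < (ξ 0 0 ω : ℝ)} ≤ m ^ k * (M / (m ^ k * x) ^ 2) := by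
        gcongr; exact h1.trans h2
    _ = _ := by rw [one_div, inv_pow]; field_simp

lemma main_bound (h : GWData μ ξ m σ2 Z) : ∃ K : ℝ, 0 ≤ K ∧ ∀ A > 0, ∀ x ≥ 1, ∀ n : ℕ,
    0 ≤ 1 - σ2 / (m ^ 2 - m) * (1 / A ^ 2 + 1 / (A * Real.sqrt x)) →
    (1 - σ2 / (m ^ 2 - m) * (1 / A ^ 2 + 1 / (A * Real.sqrt x))) * (1 - K / x) *
      ∑ i ∈ Finset.range n, m ^ i * μ.real {ω | m ^ (i + 1) * x
        + A * Real.sqrt (m ^ (i + 1) * x) < (ξ 0 0 ω : ℝ)}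
      ≤ μ.real {ω | x < (Z n ω : ℝ) / m ^ n} := by
  have hmp := h.m_pos
  have hm1 := h.hm1
  have hs := h.σ2_nonneg
  have hd : 0 < m ^ 2 - m := by nlinarith
  set M := ∫ ω, ((ξ 0 0 ω : ℝ)) ^ 2 ∂μ with hM
  have hM0 : 0 ≤ M := integral_nonneg fun ω => sq_nonneg _
  obtain ⟨C, hC⟩ : ∃ C : ℝ, C = 2 + 2 * (σ2 / (m ^ 2 - m)) := ⟨_, rfl⟩
  have hC0 : 0 ≤ C := by rw [hC]; positivity
  have hr1 : 1 / m < 1 := by rw [div_lt_one hmp]; exact hm1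
  have hr0 : 0 < 1 / m := by positivity
  have hg : 0 < (1 - 1 / m)⁻¹ := by
    have : 0 < 1 - 1 / m := by linarith
    positivity
  refine ⟨C + M * (1 - 1 / m)⁻¹ + M * C, by positivity, ?_⟩
  intro A hA x hx n hb
  have hx0 : 0 < x := by linarith
  let t : ℕ → ℝ := fun i => m ^ (i + 1) * x + A * Real.sqrt (m ^ (i + 1) * x)
  have htl : ∀ k, m ^ (k+1) * x ≤ t k := fun k => by
    have : 0 ≤ A * Real.sqrt (m ^ (k + 1) * x) := by positivity
    simp only [t]; linarith
  have hmq := fun k => h.mq_bound x (t k) hx0 k (htl k)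
  rw [← hM] at hmq
  let E : ℕ → Set Ω := fun i => (bigP ξ Z t i)ᶜ ∩ bigJ ξ Z t i
  have hEm : ∀ i, MeasurableSet[sigG ξ (i+1)] (E i) := fun i => by
    refine @MeasurableSet.inter _ (sigG ξ (i+1)) _ _ ?_ (h.measJ t i (i+1) (Nat.lt_succ_self i))
    refine @MeasurableSet.compl _ _ (sigG ξ (i+1)) ?_
    exact sigG_mono ξ (Nat.le_succ i) _ (h.measP t i)
  have hE : ∀ i, m ^ i * μ.real {ω | t i < (ξ 0 0 ω : ℝ)}
      * (1 - (C + M * (1 - 1 / m)⁻¹ + M * C) / x) ≤ μ.real (E i) := by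
    intro i
    have hP : μ (bigP ξ Z t i) ≤ ENNReal.ofReal (M / x ^ 2 * (1 - 1 / m)⁻¹) := by
      refine (h.measureP_le t i).trans (ENNReal.ofReal_le_ofReal ?_)
      refine (Finset.sum_le_sum fun k _ => hmq k).trans ?_
      rw [← Finset.mul_sum]
      gcongr
      rw [← tsum_geometric_of_lt_one hr0.le hr1]
      exact (summable_geometric_of_lt_one hr0.le hr1).sum_le_tsum _ (fun _ _ => by positivity)
    have h1 := h.lowerE t i _ (1 / x) _ C rfl (by positivity) (by positivity) hP hC
    refine le_trans ?_ h1
    refine mul_le_mul_of_nonneg_left ?_ (by positivity)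
    have h2 : m ^ i * μ.real {ω | t i < (ξ 0 0 ω : ℝ)} ≤ M / x := by
      refine (hmq i).trans ?_
      have h3 : (1 / m) ^ i ≤ 1 := pow_le_one₀ hr0.le hr1.le
      have h4 : M / x ^ 2 ≤ M / x := by
        gcongr
        nlinarith
      calc M / x ^ 2 * (1 / m) ^ i ≤ M / x ^ 2 * 1 := by gcongr
        _ ≤ M / x := by rw [mul_one]; exact h4
    have h5 := mul_le_mul_of_nonneg_right h2 hC0
    have e : (C + M * (1 - 1 / m)⁻¹ + M * C) / x
        = 1 / x * C + M / x ^ 2 * (1 - 1 / m)⁻¹ / (1 / x) + M / x * C := by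
      generalize (1 - 1 / m)⁻¹ = g
      field_simp
    linarith
  have hdisj : ∀ i j, i < j → Disjoint (E i) (E j) := by
    intro i j hij
    rw [Set.disjoint_left]
    intro ω hi hj
    refine hj.1 ?_
    exact Set.mem_biUnion (Finset.mem_coe.2 (Finset.mem_range.2 hij)) hi.2
  set S := {ω | x < (Z n ω : ℝ) / m ^ n} with hSdef
  have hS : MeasurableSet S :=
    measurableSet_lt measurable_const (h.measR n (fun z => z / m ^ n))
  have hsum : ∑ i ∈ Finset.range n, μ.real (E i ∩ S) ≤ μ.real S := by
    rw [← measureReal_biUnion_finset]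
    · refine measureReal_mono ?_
      exact Set.iUnion₂_subset fun i _ => Set.inter_subset_right
    · intro i _ j _ hij
      rcases lt_or_gt_of_ne hij with hlt | hlt
      · exact (hdisj i j hlt).mono Set.inter_subset_left Set.inter_subset_left
      · exact (hdisj j i hlt).symm.mono Set.inter_subset_left Set.inter_subset_left
    · intro i _
      exact (h.sigG_le _ _ (hEm i)).inter hS
  refine le_trans ?_ hsum
  rw [Finset.mul_sum]
  refine Finset.sum_le_sum fun i hi => ?_
  have h1 := h.cheb t i n (Finset.mem_range.1 hi) A x hA hx0 rfl (E i) (hEm i)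
    Set.inter_subset_right
  refine le_trans ?_ h1
  rw [mul_assoc]
  refine mul_le_mul_of_nonneg_left ?_ hb
  rw [mul_comm]
  exact hE i

end GWData

lemma insens_iter (F : ℝ → ℝ) (hanti : Antitone F) (h0 : ∀ x, 0 ≤ F x)
    (hF : Tendsto (fun x : ℝ => F (x + Real.sqrt x) / F x) atTop (nhds 1)) (K : ℕ) :
    ∀ δ > 0, ∃ y0 : ℝ, ∀ y ≥ y0, (1 - δ) * F y ≤ F (y + K * Real.sqrt y) := by
  have hg : Tendsto (fun x : ℝ => x + Real.sqrt x) atTop atTop :=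
    tendsto_atTop_mono (fun x => le_add_of_nonneg_right (Real.sqrt_nonneg x)) tendsto_id
  have key : ∀ δ > 0, ∀ᶠ y in atTop, 0 ≤ y ∧ ∃ z, y + K * Real.sqrt y ≤ z ∧ y ≤ z ∧
      (1 - δ) * F y ≤ F z := by
    induction K with
    | zero =>
      intro δ hδ
      filter_upwards [eventually_ge_atTop 0] with y hy
      exact ⟨hy, y, by simp, le_rfl, by nlinarith [h0 y]⟩
    | succ K ih =>
      intro δ hδ
      obtain ⟨δ', hδ', hδ1, hδ2⟩ : ∃ δ' > 0, δ' ≤ 1 ∧ 2 * δ' ≤ δ :=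
        ⟨min 1 (δ / 2), by positivity, min_le_left _ _, by
          have := min_le_right 1 (δ / 2); linarith⟩
      have h1 : ∀ᶠ x in atTop, 1 - δ' < F (x + Real.sqrt x) / F x :=
        hF.eventually (lt_mem_nhds (by linarith))
      obtain ⟨b, hb⟩ := eventually_atTop.1 h1
      filter_upwards [ih δ' hδ', eventually_ge_atTop b] with y ⟨hy, z, hz1, hz2, hz3⟩ hyb
      refine ⟨hy, z + Real.sqrt z, ?_, ?_, ?_⟩
      · have := Real.sqrt_le_sqrt hz2
        push_cast
        linarith
      · have := Real.sqrt_nonneg z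
        linarith
      · have h2 := hb z (le_trans hyb hz2)
        have h3 : (1 - δ') * F z ≤ F (z + Real.sqrt z) := by
          rcases (h0 z).eq_or_lt with h4 | h4
          · rw [← h4]; simpa using h0 _
          · exact ((lt_div_iff₀ h4).1 h2).le
        have h5 := mul_le_mul_of_nonneg_left hz3 (show 0 ≤ 1 - δ' by linarith)
        have h6 : (1 - δ) * F y ≤ (1 - δ') * ((1 - δ') * F y) := by
          have : 1 - δ ≤ (1 - δ') * (1 - δ') := by nlinarith
          have := mul_le_mul_of_nonneg_right this (h0 y)
          linarith
        linarith
  intro δ hδ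
  obtain ⟨y0, hy0⟩ := eventually_atTop.1 (key δ hδ)
  refine ⟨y0, fun y hy => ?_⟩
  obtain ⟨_, z, hz1, _, hz3⟩ := hy0 y hy
  exact hz3.trans (hanti hz1)



/-- If `σ² := Var(ξ) < ∞`, then for every `A > 0`,
`ℙ(W_n > x) ≥ (1 - σ²/((m²-m)A²) + o(1)) ∑_{i=0}^{n-1} m^i F̄(m^{i+1}x + A√(m^{i+1}x))`
as `x → ∞` uniformly in `n ≥ 1`; if moreover `F` is `√x`-insensitive, then
`ℙ(W_n > x) ≥ (1+o(1)) ∑_{i=0}^{n-1} m^i F̄(m^{i+1}x)` as `x → ∞`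
uniformly in `n ≥ 1`. -/
theorem gw_lower_bound_finite_variance
    {Ω : Type*} [MeasurableSpace Ω] (μ : Measure Ω) [IsProbabilityMeasure μ]
    (ξ : ℕ → ℕ → Ω → ℕ)
    (hmeas : ∀ n i, Measurable (ξ n i))
    (hindep : iIndepFun
      (fun p : ℕ × ℕ => ξ p.1 p.2) μ)
    (hident : ∀ n i, Measure.map (ξ n i) μ = Measure.map (ξ 0 0) μ)
    (hint : Integrable (fun ω => (ξ 0 0 ω : ℝ)) μ)
    (m : ℝ) (hm : m = ∫ ω, (ξ 0 0 ω : ℝ) ∂μ) (hm1 : 1 < m)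
    (Z : ℕ → Ω → ℕ)
    (hZ0 : ∀ ω, Z 0 ω = 1)
    (hZrec : ∀ n ω, Z (n + 1) ω = ∑ i ∈ Finset.range (Z n ω), ξ n i ω)
    (W : ℕ → Ω → ℝ) (hW : ∀ n ω, W n ω = (Z n ω : ℝ) / m ^ n)
    (Fbar : ℝ → ℝ) (hFbar : ∀ x, Fbar x = (μ {ω | x < (ξ 0 0 ω : ℝ)}).toReal)
    -- finite variance
    (hmom2 : Integrable (fun ω => ((ξ 0 0 ω : ℝ)) ^ 2) μ)
    (σ2 : ℝ) (hσ2 : σ2 = ∫ ω, ((ξ 0 0 ω : ℝ) - m) ^ 2 ∂μ) :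
    (∀ A > (0 : ℝ), ∀ ε' > (0 : ℝ), ∃ x₀ : ℝ, ∀ x ≥ x₀, ∀ n : ℕ, 1 ≤ n →
        (1 - σ2 / ((m ^ 2 - m) * A ^ 2) - ε') *
            ∑ i ∈ Finset.range n,
              m ^ i * Fbar (m ^ (i + 1) * x + A * Real.sqrt (m ^ (i + 1) * x)) ≤
          (μ {ω | x < W n ω}).toReal) ∧
    ((Tendsto (fun x : ℝ => Fbar (x + Real.sqrt x) / Fbar x) atTop (nhds 1)) →
      ∀ ε' > (0 : ℝ), ∃ x₀ : ℝ, ∀ x ≥ x₀, ∀ n : ℕ, 1 ≤ n →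
        (1 - ε') * ∑ i ∈ Finset.range n, m ^ i * Fbar (m ^ (i + 1) * x) ≤
          (μ {ω | x < W n ω}).toReal) := by
  have hmp : 0 < m := by linarith
  have hd : 0 < m ^ 2 - m := by nlinarith
  have h : GWData μ ξ m σ2 Z :=
    ⟨hmeas, hindep, hident, hint, hm, hm1, hZ0, hZrec, hmom2, hσ2⟩
  have hs := h.σ2_nonneg
  obtain ⟨K, hK0, hK⟩ := h.main_bound
  have hF0 : ∀ x, 0 ≤ Fbar x := fun x => by rw [hFbar]; exact ENNReal.toReal_nonneg
  have hanti : Antitone Fbar := by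
    intro a b hab
    rw [hFbar, hFbar]
    exact measureReal_mono (μ := μ) fun ω (hω : b < _) => lt_of_le_of_lt hab hω
  have part1 : ∀ A > (0 : ℝ), ∀ ε' > (0 : ℝ), ∃ x₀ : ℝ, ∀ x ≥ x₀, ∀ n : ℕ, 1 ≤ n →
        (1 - σ2 / ((m ^ 2 - m) * A ^ 2) - ε') *
            ∑ i ∈ Finset.range n,
              m ^ i * Fbar (m ^ (i + 1) * x + A * Real.sqrt (m ^ (i + 1) * x)) ≤
          (μ {ω | x < W n ω}).toReal := by
    intro A hA ε hε
    rcases lt_or_ge (1 - σ2 / ((m ^ 2 - m) * A ^ 2) - ε) 0 with hneg | hpos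
    · refine ⟨0, fun x _ n _ => ?_⟩
      refine le_trans ?_ ENNReal.toReal_nonneg
      refine mul_nonpos_of_nonpos_of_nonneg hneg.le (Finset.sum_nonneg fun i _ => ?_)
      exact mul_nonneg (by positivity) (hF0 _)
    · have e : σ2 / ((m ^ 2 - m) * A ^ 2) = σ2 / (m ^ 2 - m) * (1 / A ^ 2 + 0) := by
        rw [add_zero]; field_simp
      have hsq : Tendsto (fun x : ℝ => 1 / (A * Real.sqrt x)) atTop (nhds 0) := by
        simp only [one_div]
        exact tendsto_inv_atTop_zero.comp
          (Real.tendsto_sqrt_atTop.const_mul_atTop hA)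
      have hT1 : Tendsto (fun x : ℝ => 1 - σ2 / (m ^ 2 - m) * (1 / A ^ 2 + 1 / (A * Real.sqrt x)))
          atTop (nhds (1 - σ2 / ((m ^ 2 - m) * A ^ 2))) := by
        rw [e]
        exact ((hsq.const_add _).const_mul _).const_sub _
      have hT2 : Tendsto (fun x : ℝ => 1 - K / x) atTop (nhds (1 - 0)) :=
        (tendsto_const_nhds.div_atTop tendsto_id).const_sub _
      have hT3 := hT1.mul hT2
      rw [sub_zero, mul_one] at hT3
      have ev1 := hT1.eventually (lt_mem_nhds (show (0 : ℝ) < _ by linarith))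
      have ev2 := hT3.eventually
        (lt_mem_nhds (show 1 - σ2 / ((m ^ 2 - m) * A ^ 2) - ε < _ by linarith))
      obtain ⟨x₀, hx₀⟩ := eventually_atTop.1 (ev1.and (ev2.and (eventually_ge_atTop 1)))
      refine ⟨x₀, fun x hx n _ => ?_⟩
      obtain ⟨h1, h2, h3⟩ := hx₀ x hx
      have h4 := hK A hA x h3 n h1.le
      simp only [hW, hFbar]
      refine le_trans (mul_le_mul_of_nonneg_right h2.le ?_) h4
      exact Finset.sum_nonneg fun i _ => mul_nonneg (by positivity) ENNReal.toReal_nonneg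
  refine ⟨part1, ?_⟩
  intro hins ε hε
  rcases le_or_gt 1 ε with hε1 | hε1
  · refine ⟨0, fun x _ n _ => ?_⟩
    refine le_trans ?_ ENNReal.toReal_nonneg
    refine mul_nonpos_of_nonpos_of_nonneg (by linarith) (Finset.sum_nonneg fun i _ => ?_)
    exact mul_nonneg (by positivity) (hF0 _)
  · obtain ⟨N, hN⟩ := exists_nat_gt (σ2 / (m ^ 2 - m) / (ε / 4) + 1)
    have hq0 : 0 ≤ σ2 / (m ^ 2 - m) / (ε / 4) := by positivity
    have hN1 : (1 : ℝ) ≤ N := by linarith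
    have hN0 : (0 : ℝ) < N := by linarith
    obtain ⟨x₁, hx₁⟩ := part1 N hN0 (ε / 4) (by positivity)
    obtain ⟨y₀, hy₀⟩ := insens_iter Fbar hanti hF0 hins N (ε / 4) (by positivity)
    have hsN : σ2 / ((m ^ 2 - m) * (N : ℝ) ^ 2) ≤ ε / 4 := by
      rw [← div_div, div_le_iff₀ (by positivity)]
      have h1 : σ2 / (m ^ 2 - m) / (ε / 4) ≤ (N : ℝ) ^ 2 := by nlinarith
      rw [div_le_iff₀ (by positivity)] at h1
      linarith
    refine ⟨max x₁ (max y₀ 0), fun x hx n hn => ?_⟩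
    have hxa : x₁ ≤ x := (le_max_left _ _).trans hx
    have hxb : y₀ ≤ x := ((le_max_left _ _).trans (le_max_right _ _)).trans hx
    have hxc : 0 ≤ x := ((le_max_right _ _).trans (le_max_right _ _)).trans hx
    refine le_trans ?_ (hx₁ x hxa n hn)
    set S1 := ∑ i ∈ Finset.range n, m ^ i * Fbar (m ^ (i + 1) * x)
    set S2 := ∑ i ∈ Finset.range n,
      m ^ i * Fbar (m ^ (i + 1) * x + N * Real.sqrt (m ^ (i + 1) * x))
    have hS2 : 0 ≤ S2 := Finset.sum_nonneg fun i _ => mul_nonneg (by positivity) (hF0 _)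
    have hS1 : 0 ≤ S1 := Finset.sum_nonneg fun i _ => mul_nonneg (by positivity) (hF0 _)
    have h12 : (1 - ε / 4) * S1 ≤ S2 := by
      simp only [S1, S2, Finset.mul_sum]
      refine Finset.sum_le_sum fun i _ => ?_
      have hxy : x ≤ m ^ (i+1) * x := le_mul_of_one_le_left hxc (one_le_pow₀ hm1.le)
      have h1 := mul_le_mul_of_nonneg_left (hy₀ _ (hxb.trans hxy))
        (show 0 ≤ m ^ i by positivity)
      linarith
    have h3 : (1 - ε / 2) * S2
        ≤ (1 - σ2 / ((m ^ 2 - m) * (N : ℝ) ^ 2) - ε / 4) * S2 :=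
      mul_le_mul_of_nonneg_right (by linarith) hS2
    refine le_trans ?_ h3
    have h4 := mul_le_mul_of_nonneg_left h12 (show 0 ≤ 1 - ε / 2 by linarith)
    refine le_trans ?_ h4
    rw [← mul_assoc]
    refine mul_le_mul_of_nonneg_right ?_ hS1
    nlinarith
end
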